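/- Let p ∈ (1,∞) and s ∈ (0,1), and let v ∈ W^{s,p}(ℝⁿ) be a weak solution of the homogeneous Dirichlet problem −L_Φ v = 0 in Ω, v = g on ℝⁿ∖Ω, for some g ∈ W^{s,p}(ℝⁿ). Let B_R(x₀) ⊂ Ω. Then there exist constants α ∈ (0, sp/q_*) and c ≥ 1, both depending only on n, s, p, Λ, such that for all 0 < ρ ≤ r ≤ R: E(v; x₀, ρ) ≤ c (ρ/r)^α (r/R)^{sp/q_*} E(v; x₀, R) + c (ρ/r)^α ∫_r^R (r/t)^{sp/q_*} E(v; x₀, t) dt/t. -/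

import Mathlib

noncomputable section

open MeasureTheory Metric Set Filter Topology
open scoped ENNReal NNReal

/-- Euclidean space `ℝⁿ`. -/
abbrev Rn (n : ℕ) : Type := EuclideanSpace ℝ (Fin n)

/-- `q_* = max {1, p-1}`. -/
def qStar (p : ℝ) : ℝ := max 1 (p - 1)

/-- `q̄ = min {n(p-1)/(n-s), p}`. -/
def qBar (n : ℕ) (s p : ℝ) : ℝ := min ((n : ℝ) * (p - 1) / ((n : ℝ) - s)) p

/-- Gagliardo seminorm raised to the power `p`, as an `ℝ≥0∞`-valued double integral. -/
def gagliardo (n : ℕ) (s p : ℝ) (O : Set (Rn n)) (v : Rn n → ℝ) : ℝ≥0∞ :=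
  ∫⁻ x in O, ∫⁻ y in O, ENNReal.ofReal (|v x - v y| ^ p / ‖x - y‖ ^ ((n : ℝ) + s * p))

/-- `v ∈ W^{s,p}(O)`. -/
def memWsp (n : ℕ) (s p : ℝ) (O : Set (Rn n)) (v : Rn n → ℝ) : Prop :=
  AEMeasurable v (volume.restrict O) ∧
    (∫⁻ x in O, ENNReal.ofReal (|v x| ^ p)) < ⊤ ∧ gagliardo n s p O v < ⊤

/-- `Tail(v; x₀, r)`. -/
def tailFn (n : ℕ) (s p : ℝ) (v : Rn n → ℝ) (x₀ : Rn n) (r : ℝ) : ℝ≥0∞ :=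
  (ENNReal.ofReal (r ^ (s * p)) *
      ∫⁻ x in (ball x₀ r)ᶜ,
        ENNReal.ofReal (|v x| ^ (p - 1) / ‖x - x₀‖ ^ ((n : ℝ) + s * p))) ^ (1 / (p - 1))

/-- `v ∈ L^{p-1}_{sp}(ℝⁿ)`. -/
def memTailSpace (n : ℕ) (s p : ℝ) (v : Rn n → ℝ) : Prop :=
  AEMeasurable v (volume : Measure (Rn n)) ∧
    (∀ R : ℝ, (∫⁻ x in ball (0 : Rn n) R, ENNReal.ofReal (|v x| ^ (p - 1))) < ⊤) ∧
    ∀ z : Rn n, ∀ r : ℝ, 0 < r → tailFn n s p v z r < ⊤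

/-- `φ ∈ C_0^∞(O)`. -/
def IsTestFun (n : ℕ) (O : Set (Rn n)) (φ : Rn n → ℝ) : Prop :=
  ContDiff ℝ (⊤ : ℕ∞) φ ∧ HasCompactSupport φ ∧ tsupport φ ⊆ O

/-- The nonlocal form `⟨-L_Φ u, φ⟩`. -/
def nonlocalForm (n : ℕ) (Φ : ℝ → ℝ) (K : Rn n → Rn n → ℝ) (u φ : Rn n → ℝ) : ℝ :=
  ∫ x : Rn n, ∫ y : Rn n, Φ (u x - u y) * (φ x - φ y) * K x y

/-- Ellipticity/coercivity bounds on the kernel `K`. -/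
def KernelBounds (n : ℕ) (Λ s p : ℝ) (K : Rn n → Rn n → ℝ) : Prop :=
  Measurable (Function.uncurry K) ∧
    ∀ x y : Rn n, x ≠ y →
      1 / (Λ * ‖x - y‖ ^ ((n : ℝ) + s * p)) ≤ K x y ∧
        K x y ≤ Λ / ‖x - y‖ ^ ((n : ℝ) + s * p)

/-- Structure conditions on `Φ`. -/
def PhiBounds (Λ p : ℝ) (Φ : ℝ → ℝ) : Prop :=
  Continuous Φ ∧ Φ 0 = 0 ∧
    ∀ t : ℝ, |t| ^ p / Λ ≤ Φ t * t ∧ Φ t * t ≤ Λ * |t| ^ p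

/-- `∫ φ dμ` for a signed measure `μ`. -/
def sintegral (n : ℕ) (μ : MeasureTheory.SignedMeasure (Rn n)) (φ : Rn n → ℝ) : ℝ :=
  (∫ x, φ x ∂μ.toJordanDecomposition.posPart) -
    ∫ x, φ x ∂μ.toJordanDecomposition.negPart

/-- Weak (energy) solution of `-L_Φ u = f` in `Ω`, `u = g` on `ℝⁿ ∖ Ω`. -/
def WeakSol (n : ℕ) (Φ : ℝ → ℝ) (K : Rn n → Rn n → ℝ) (s p : ℝ)
    (Ω : Set (Rn n)) (f g u : Rn n → ℝ) : Prop :=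
  memWsp n s p univ u ∧ (∀ᵐ x : Rn n, x ∉ Ω → u x = g x) ∧
    ∀ φ : Rn n → ℝ, IsTestFun n Ω φ → nonlocalForm n Φ K u φ = ∫ x : Rn n, φ x * f x

/-- Weak subsolution of the homogeneous equation `-L_Φ w = 0` in `Ω`. -/
def WeakSubSol (n : ℕ) (Φ : ℝ → ℝ) (K : Rn n → Rn n → ℝ) (s p : ℝ)
    (Ω : Set (Rn n)) (w : Rn n → ℝ) : Prop :=
  memWsp n s p univ w ∧
    ∀ φ : Rn n → ℝ, IsTestFun n Ω φ → (∀ x, 0 ≤ φ x) → nonlocalForm n Φ K w φ ≤ 0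

/-- The approximation properties required of a SOLA. -/
def SOLAApprox (n : ℕ) (Φ : ℝ → ℝ) (K : Rn n → Rn n → ℝ) (s p : ℝ)
    (Ω : Set (Rn n)) (μ : MeasureTheory.SignedMeasure (Rn n)) (g u : Rn n → ℝ)
    (uj μj gj : ℕ → Rn n → ℝ) : Prop :=
  (∀ j, ContDiff ℝ (⊤ : ℕ∞) (μj j) ∧ HasCompactSupport (μj j)) ∧
  (∀ j, ContDiff ℝ (⊤ : ℕ∞) (gj j) ∧ HasCompactSupport (gj j)) ∧
  (∀ j, WeakSol n Φ K s p Ω (μj j) (gj j) (uj j)) ∧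
  (∀ᵐ x : Rn n, Tendsto (fun j => uj j x) atTop (𝓝 (u x))) ∧
  (∀ q : ℝ, qStar p ≤ q → q < qBar n s p → ∀ z : Rn n, ∀ r : ℝ, 0 < r →
    Tendsto (fun j => ∫⁻ x in ball z r, ENNReal.ofReal (|uj j x - u x| ^ q)) atTop (𝓝 0)) ∧
  (∀ φ : Rn n → ℝ, Continuous φ → HasCompactSupport φ → tsupport φ ⊆ Ω →
    Tendsto (fun j => ∫ x : Rn n, φ x * μj j x) atTop (𝓝 (sintegral n μ φ))) ∧
  (∀ z : Rn n, ∀ r : ℝ, 0 < r →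
    Filter.limsup (fun j => ∫⁻ x in ball z r, ENNReal.ofReal |μj j x|) atTop
      ≤ μ.totalVariation (closedBall z r)) ∧
  (∀ z : Rn n, ∀ r : ℝ, 0 < r →
    Tendsto (fun j =>
        (∫⁻ x in ball z r, ENNReal.ofReal (|gj j x - g x| ^ p)) +
          gagliardo n s p (ball z r) (fun x => gj j x - g x)) atTop (𝓝 0) ∧
      Tendsto (fun j => tailFn n s p (fun x => gj j x - g x) z r) atTop (𝓝 0))

/-- SOLA of the Dirichlet problem `-L_Φ u = μ` in `Ω`, `u = g` on `ℝⁿ ∖ Ω`. -/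
def IsSOLA (n : ℕ) (Φ : ℝ → ℝ) (K : Rn n → Rn n → ℝ) (s p : ℝ)
    (Ω : Set (Rn n)) (μ : MeasureTheory.SignedMeasure (Rn n)) (g u : Rn n → ℝ) : Prop :=
  (∀ h q : ℝ, 0 < h → h < s → qStar p ≤ q → q < qBar n s p → memWsp n h q Ω u) ∧
  (∀ φ : Rn n → ℝ, IsTestFun n Ω φ → nonlocalForm n Φ K u φ = sintegral n μ φ) ∧
  (∀ᵐ x : Rn n, x ∉ Ω → u x = g x) ∧
  ∃ uj μj gj : ℕ → Rn n → ℝ, SOLAApprox n Φ K s p Ω μ g u uj μj gj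

/-- Truncated Wolff potential `W^ν_{s,p}(x₀, r)`. -/
def wolff (n : ℕ) (s p : ℝ) (ν : Measure (Rn n)) (x₀ : Rn n) (r : ℝ) : ℝ≥0∞ :=
  ∫⁻ ρ in Ioc (0 : ℝ) r,
    (ν (ball x₀ ρ) / ENNReal.ofReal (ρ ^ ((n : ℝ) - s * p))) ^ (1 / (p - 1)) /
      ENNReal.ofReal ρ

/-- Integral average of `u` over `B_r(x₀)`. -/
def ballAvg (n : ℕ) (u : Rn n → ℝ) (x₀ : Rn n) (r : ℝ) : ℝ :=
  ⨍ x in ball x₀ r, u x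

/-- Local excess `A(f; x₀, r)`. -/
def locExcess (n : ℕ) (p : ℝ) (f : Rn n → ℝ) (x₀ : Rn n) (r : ℝ) : ℝ≥0∞ :=
  ((volume (ball x₀ r))⁻¹ *
      ∫⁻ x in ball x₀ r, ENNReal.ofReal (|f x - ballAvg n f x₀ r| ^ qStar p)) ^ (1 / qStar p)

/-- Global excess `E(f; x₀, r)`. -/
def excess (n : ℕ) (s p : ℝ) (f : Rn n → ℝ) (x₀ : Rn n) (r : ℝ) : ℝ≥0∞ :=
  locExcess n p f x₀ r + tailFn n s p (fun x => f x - ballAvg n f x₀ r) x₀ r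

/-- `g ∈ W^{s,p}_loc(ℝⁿ) ∩ L^{p-1}_{sp}(ℝⁿ)`. -/
def BoundaryDatum (n : ℕ) (s p : ℝ) (g : Rn n → ℝ) : Prop :=
  (∀ z : Rn n, ∀ r : ℝ, 0 < r → memWsp n s p (ball z r) g) ∧ memTailSpace n s p g

/-- Symmetric measurable kernel with ellipticity bounds. -/
def SymKernel (n : ℕ) (Λ s p : ℝ) (Kt : Rn n → Rn n → ℝ) : Prop :=
  KernelBounds n Λ s p Kt ∧ ∀ x y : Rn n, Kt x y = Kt y x

/-- Weak solution of the kernel-`Kt` fractional `p`-Laplace equation with datum `f` in `O`. -/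
def WeakSolP (n : ℕ) (Kt : Rn n → Rn n → ℝ) (s p : ℝ) (O : Set (Rn n))
    (f u : Rn n → ℝ) : Prop :=
  memWsp n s p univ u ∧
    ∀ φ : Rn n → ℝ, IsTestFun n O φ →
      (∫ x : Rn n, ∫ y : Rn n,
          |u x - u y| ^ (p - 2) * (u x - u y) * (φ x - φ y) * Kt x y) =
        ∫ x : Rn n, φ x * f x

/-- Standing assumptions on the structural parameters. -/
structure Admissible (n : ℕ) (s p L : ℝ) : Prop where
  one_le_dim : 1 ≤ n
  s_pos : 0 < s
  s_lt : s < 1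
  one_lt_p : 1 < p
  one_le_L : 1 ≤ L

/-- The kernel `|z|^{-n-sp}`, equal to `0` at the origin. -/
def fker (n : ℕ) (s p : ℝ) (z : Rn n) : ℝ := (‖z‖ ^ ((n : ℝ) + s * p))⁻¹

section Basic

variable {n : ℕ} {s p L : ℝ}

namespace Admissible

lemma p_pos (H : Admissible n s p L) : 0 < p := zero_lt_one.trans H.one_lt_p

lemma p_sub_pos (H : Admissible n s p L) : 0 < p - 1 := sub_pos.2 H.one_lt_p

lemma sp_pos (H : Admissible n s p L) : 0 < s * p := mul_pos H.s_pos H.p_pos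

lemma dim_pos (H : Admissible n s p L) : 0 < (n : ℝ) := by exact_mod_cast H.one_le_dim

lemma exponent_pos (H : Admissible n s p L) : 0 < (n : ℝ) + s * p := add_pos H.dim_pos H.sp_pos

lemma L_pos (H : Admissible n s p L) : 0 < L := zero_lt_one.trans_le H.one_le_L

lemma nontrivial (H : Admissible n s p L) : Nontrivial (Rn n) := by
  have : Nonempty (Fin n) := ⟨⟨0, H.one_le_dim⟩⟩
  infer_instance

end Admissible

lemma fker_nonneg (z : Rn n) : 0 ≤ fker n s p z := by unfold fker; positivity

lemma fker_neg (z : Rn n) : fker n s p (-z) = fker n s p z := by simp [fker]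

lemma fker_sub_comm (x y : Rn n) : fker n s p (x - y) = fker n s p (y - x) := by
  rw [← fker_neg, neg_sub]

lemma measurable_fker : Measurable (fker n s p) := by
  unfold fker; fun_prop

lemma fker_smul {σ : ℝ} (hσ : 0 < σ) (z : Rn n) :
    fker n s p (σ • z) = (σ ^ ((n : ℝ) + s * p))⁻¹ * fker n s p z := by
  unfold fker
  rw [norm_smul, Real.norm_of_nonneg hσ.le, Real.mul_rpow hσ.le (norm_nonneg _), mul_inv]

lemma fker_le_of_le (H : Admissible n s p L) {z w : Rn n} {c : ℝ} (hc : 0 < c) (hw : w ≠ 0)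
    (h : c * ‖w‖ ≤ ‖z‖) : fker n s p z ≤ (c ^ ((n : ℝ) + s * p))⁻¹ * fker n s p w := by
  unfold fker
  rw [← mul_inv, ← Real.mul_rpow hc.le (norm_nonneg _)]
  have h0 : 0 < c * ‖w‖ := mul_pos hc (norm_pos_iff.2 hw)
  exact inv_anti₀ (Real.rpow_pos_of_pos h0 _) (Real.rpow_le_rpow h0.le h H.exponent_pos.le)

lemma rpow_inv_le_fker (H : Admissible n s p L) {z : Rn n} {r : ℝ} (hz : z ≠ 0)
    (h : ‖z‖ ≤ r) : (r ^ ((n : ℝ) + s * p))⁻¹ ≤ fker n s p z := by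
  unfold fker
  have h0 : 0 < ‖z‖ := norm_pos_iff.2 hz
  exact inv_anti₀ (Real.rpow_pos_of_pos h0 _) (Real.rpow_le_rpow h0.le h H.exponent_pos.le)

lemma fker_le_rpow (H : Admissible n s p L) {z : Rn n} {r : ℝ} (hr : 0 < r) (h : r ≤ ‖z‖) :
    fker n s p z ≤ (r ^ ((n : ℝ) + s * p))⁻¹ := by
  unfold fker
  exact inv_anti₀ (Real.rpow_pos_of_pos hr _) (Real.rpow_le_rpow hr.le h H.exponent_pos.le)

/-! ### Change of variables -/

lemma measurableEmbedding_affine (x₀ : Rn n) {r : ℝ} (hr : 0 < r) :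
    MeasurableEmbedding (fun x : Rn n => x₀ + r • x) :=
  ((Homeomorph.addLeft x₀).measurableEmbedding).comp
    ((Homeomorph.smulOfNeZero r hr.ne').measurableEmbedding)

lemma map_affine_volume (x₀ : Rn n) {r : ℝ} (hr : 0 < r) :
    Measure.map (fun x : Rn n => x₀ + r • x) volume = ENNReal.ofReal (r ^ n)⁻¹ • volume := by
  have h1 : (fun x : Rn n => x₀ + r • x) = (fun x => x₀ + x) ∘ (fun x => r • x) := rfl
  rw [h1, ← Measure.map_map (measurable_const_add x₀) (measurable_const_smul r),
    Measure.map_addHaar_smul _ hr.ne', Measure.map_smul, map_add_left_eq_self]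
  rw [finrank_euclideanSpace_fin, abs_of_pos (by positivity)]

lemma lintegral_comp_affine (x₀ : Rn n) {r : ℝ} (hr : 0 < r) (f : Rn n → ℝ≥0∞) :
    ∫⁻ x, f (x₀ + r • x) = ENNReal.ofReal (r ^ n)⁻¹ * ∫⁻ x, f x := by
  rw [← (measurableEmbedding_affine x₀ hr).lintegral_map, map_affine_volume x₀ hr,
    lintegral_smul_measure, smul_eq_mul]

lemma setLIntegral_comp_affine (x₀ : Rn n) {r : ℝ} (hr : 0 < r) (f : Rn n → ℝ≥0∞)
    {S T : Set (Rn n)} (hS : MeasurableSet S) (hT : MeasurableSet T)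
    (h : ∀ x, x ∈ S ↔ x₀ + r • x ∈ T) :
    ∫⁻ x in S, f (x₀ + r • x) = ENNReal.ofReal (r ^ n)⁻¹ * ∫⁻ x in T, f x := by
  rw [← lintegral_indicator hS, ← lintegral_indicator hT, ← lintegral_comp_affine x₀ hr]
  refine lintegral_congr fun x => ?_
  by_cases hx : x ∈ S
  · rw [indicator_of_mem hx, indicator_of_mem ((h x).1 hx)]
  · rw [indicator_of_notMem hx, indicator_of_notMem (fun h' => hx ((h x).2 h'))]

lemma integral_comp_affine (x₀ : Rn n) {r : ℝ} (hr : 0 < r) (f : Rn n → ℝ) :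
    ∫ x, f (x₀ + r • x) = (r ^ n)⁻¹ * ∫ x, f x := by
  rw [← (measurableEmbedding_affine x₀ hr).integral_map, map_affine_volume x₀ hr,
    integral_smul_measure, ENNReal.toReal_ofReal (by positivity), smul_eq_mul]

lemma affine_mem_ball (x₀ : Rn n) {r t : ℝ} (hr : 0 < r) (x : Rn n) :
    x ∈ ball (0 : Rn n) t ↔ x₀ + r • x ∈ ball x₀ (r * t) := by
  simp [mem_ball, dist_eq_norm, norm_smul, abs_of_pos hr, hr]

/-! ### Integrals of the kernel -/

lemma lintegral_fker_near_lt_top (H : Admissible n s p L) :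
    ∫⁻ z : Rn n, ENNReal.ofReal ((min 1 ‖z‖) ^ p * fker n s p z) < ⊤ := by
  have := H.nontrivial
  have hint : Integrable (fun z : Rn n => (min 1 ‖z‖) ^ p * fker n s p z) := by
    have := (integrable_fun_norm_addHaar (volume : Measure (Rn n))
      (f := fun t : ℝ => (min 1 t) ^ p * (t ^ ((n : ℝ) + s * p))⁻¹)).2 ?_
    · exact this
    rw [finrank_euclideanSpace_fin, ← Ioc_union_Ioi_eq_Ioi (zero_le_one (α := ℝ)),
      integrableOn_union]
    constructor
    · have h1 : IntegrableOn (fun t : ℝ => t ^ (p - s * p - 1)) (Ioc 0 1) := by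
        rw [← intervalIntegrable_iff_integrableOn_Ioc_of_le zero_le_one]
        refine intervalIntegral.intervalIntegrable_rpow' ?_
        nlinarith [H.p_pos, H.s_lt]
      refine h1.congr_fun (fun t ht => ?_) measurableSet_Ioc
      have ht0 : 0 < t := ht.1
      simp only [smul_eq_mul]
      rw [min_eq_right ht.2, ← Real.rpow_natCast, ← Real.rpow_neg ht0.le, ← Real.rpow_add ht0,
        ← Real.rpow_add ht0, Nat.cast_sub H.one_le_dim]
      congr 1; push_cast; ring
    · have h1 : IntegrableOn (fun t : ℝ => t ^ (- (s * p) - 1)) (Ioi 1) :=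
        integrableOn_Ioi_rpow_of_lt (by linarith [H.sp_pos]) zero_lt_one
      refine h1.congr_fun (fun t ht => ?_) measurableSet_Ioi
      have ht0 : 0 < t := zero_lt_one.trans ht
      simp only [smul_eq_mul]
      rw [min_eq_left (le_of_lt ht), Real.one_rpow, one_mul, ← Real.rpow_natCast,
        ← Real.rpow_neg ht0.le, ← Real.rpow_add ht0, Nat.cast_sub H.one_le_dim]
      congr 1; push_cast; ring
  exact hint.lintegral_lt_top

lemma lintegral_fker_far_lt_top (H : Admissible n s p L) :
    ∫⁻ z in (ball (0 : Rn n) 1)ᶜ, ENNReal.ofReal (fker n s p z) < ⊤ := by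
  refine lt_of_le_of_lt ?_ (lintegral_fker_near_lt_top H)
  refine le_trans (setLIntegral_mono' measurableSet_ball.compl fun z hz => ?_)
    (setLIntegral_le_lintegral _ _)
  have : 1 ≤ ‖z‖ := by simpa using hz
  rw [min_eq_left this, Real.one_rpow, one_mul]

end Basic

section Solutions

variable {n : ℕ} {s p L : ℝ}

/-- `v` solves a homogeneous nonlocal equation in `O` whose flux `a` is comparable to
`|v(x) - v(y)|^{p-2} (v(x) - v(y)) |x - y|^{-n-sp}`. -/
structure IsSol (n : ℕ) (s p L : ℝ) (O : Set (Rn n)) (v : Rn n → ℝ) : Prop where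
  meas : Measurable v
  locLp : ∀ r : ℝ, ∫⁻ x in ball (0 : Rn n) r, ENNReal.ofReal (|v x| ^ p) < ⊤
  gag : ∫⁻ x, ∫⁻ y, ENNReal.ofReal (|v x - v y| ^ p * fker n s p (x - y)) < ⊤
  flux : ∃ a : Rn n → Rn n → ℝ, Measurable (Function.uncurry a) ∧
    (∀ x y, |v x - v y| ^ p * fker n s p (x - y) ≤ L * (a x y * (v x - v y))) ∧
    (∀ x y, |a x y| ≤ L * (|v x - v y| ^ (p - 1) * fker n s p (x - y))) ∧
    ∀ φ, IsTestFun n O φ → ∫ x, ∫ y, a x y * (φ x - φ y) = 0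

lemma add_rpow_le {a b q : ℝ} (ha : 0 ≤ a) (hb : 0 ≤ b) (hq : 0 ≤ q) :
    (a + b) ^ q ≤ 2 ^ q * (a ^ q + b ^ q) := by
  have h1 : (a + b) ^ q ≤ (2 * max a b) ^ q :=
    Real.rpow_le_rpow (by positivity) (by linarith [le_max_left a b, le_max_right a b]) hq
  rw [Real.mul_rpow zero_le_two (le_max_of_le_left ha)] at h1
  refine h1.trans (mul_le_mul_of_nonneg_left ?_ (by positivity))
  rcases max_cases a b with h | h <;> rw [h.1]
  · linarith [Real.rpow_nonneg hb q]
  · linarith [Real.rpow_nonneg ha q]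

lemma abs_sub_rpow_le (a b : ℝ) {q : ℝ} (hq : 0 ≤ q) :
    |a - b| ^ q ≤ 2 ^ q * (|a| ^ q + |b| ^ q) :=
  (Real.rpow_le_rpow (abs_nonneg _) (abs_sub a b) hq).trans
    (add_rpow_le (abs_nonneg _) (abs_nonneg _) hq)

lemma IsTestFun.comp_affine {O O' : Set (Rn n)} {φ : Rn n → ℝ} (hφ : IsTestFun n O' φ)
    (x₀ : Rn n) {σ : ℝ} (hσ : 0 < σ) (hO : ∀ x ∈ O', x₀ + σ • x ∈ O) :
    IsTestFun n O (fun z => φ (σ⁻¹ • (z - x₀))) := by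
  obtain ⟨h1, h2, h3⟩ := hφ
  let e : Rn n ≃ₜ Rn n := (Homeomorph.subRight x₀).trans
    (Homeomorph.smulOfNeZero σ⁻¹ (inv_ne_zero hσ.ne'))
  have he : (fun z => φ (σ⁻¹ • (z - x₀))) = φ ∘ e := rfl
  refine ⟨?_, ?_, ?_⟩
  · exact h1.comp ((contDiff_id.sub contDiff_const).const_smul _)
  · rw [he]; exact h2.comp_homeomorph e
  · rw [he, tsupport, Function.support_comp_eq_preimage, ← e.preimage_closure]
    intro z hz
    have := hO _ (h3 hz)
    have h4 : e z = σ⁻¹ • (z - x₀) := rfl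
    rwa [h4, smul_inv_smul₀ hσ.ne', add_sub_cancel] at this

lemma IsSol.affine (H : Admissible n s p L) {O O' : Set (Rn n)} {v : Rn n → ℝ}
    (hv : IsSol n s p L O v) (x₀ : Rn n) {σ l : ℝ} (c : ℝ) (hσ : 0 < σ) (hl : l ≠ 0)
    (hO : ∀ x ∈ O', x₀ + σ • x ∈ O) :
    IsSol n s p L O' (fun x => l * (v (x₀ + σ • x) - c)) := by
  have hD : 0 < σ ^ ((n : ℝ) + s * p) := Real.rpow_pos_of_pos hσ _
  have hker : ∀ x y : Rn n, fker n s p (x - y) =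
      σ ^ ((n : ℝ) + s * p) * fker n s p ((x₀ + σ • x) - (x₀ + σ • y)) := by
    intro x y
    rw [add_sub_add_left_eq_sub, ← smul_sub, fker_smul hσ, mul_inv_cancel_left₀ hD.ne']
  have hl0 : 0 < |l| := abs_pos.2 hl
  have hmul : ∀ x y : Rn n, ∀ q : ℝ,
      |l * (v (x₀ + σ • x) - c) - l * (v (x₀ + σ • y) - c)| ^ q =
      |l| ^ q * |v (x₀ + σ • x) - v (x₀ + σ • y)| ^ q := by
    intro x y q
    rw [← mul_sub, sub_sub_sub_cancel_right, abs_mul,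
      Real.mul_rpow (abs_nonneg _) (abs_nonneg _)]
  have haff : Measurable (fun x : Rn n => x₀ + σ • x) :=
    (measurableEmbedding_affine x₀ hσ).measurable
  refine ⟨?_, ?_, ?_, ?_⟩
  · exact ((hv.meas.comp haff).sub_const c).const_mul l
  · intro r
    have h1 : ∫⁻ x in ball (0 : Rn n) r, ENNReal.ofReal (|v (x₀ + σ • x)| ^ p) < ⊤ := by
      rw [setLIntegral_comp_affine x₀ hσ (fun z => ENNReal.ofReal (|v z| ^ p))
        measurableSet_ball measurableSet_ball (affine_mem_ball x₀ hσ)]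
      refine ENNReal.mul_lt_top ENNReal.ofReal_lt_top (lt_of_le_of_lt ?_
        (hv.locLp (‖x₀‖ + σ * r)))
      refine lintegral_mono_set (ball_subset_ball' ?_)
      rw [dist_zero_right, add_comm]
    have h2 : ∀ x, ENNReal.ofReal (|l * (v (x₀ + σ • x) - c)| ^ p) ≤
        ENNReal.ofReal (|l| ^ p * 2 ^ p) * (ENNReal.ofReal (|v (x₀ + σ • x)| ^ p) +
          ENNReal.ofReal (|c| ^ p)) := by
      intro x
      rw [← ENNReal.ofReal_add (by positivity) (by positivity),
        ← ENNReal.ofReal_mul (by positivity)]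
      refine ENNReal.ofReal_le_ofReal ?_
      rw [abs_mul, Real.mul_rpow (abs_nonneg _) (abs_nonneg _), mul_assoc]
      exact mul_le_mul_of_nonneg_left (abs_sub_rpow_le _ _ H.p_pos.le) (by positivity)
    refine lt_of_le_of_lt (lintegral_mono h2) ?_
    rw [lintegral_const_mul' _ _ ENNReal.ofReal_ne_top, lintegral_add_right _ measurable_const]
    refine ENNReal.mul_lt_top ENNReal.ofReal_lt_top (ENNReal.add_lt_top.2 ⟨h1, ?_⟩)
    rw [lintegral_const, Measure.restrict_apply_univ]
    exact ENNReal.mul_lt_top ENNReal.ofReal_lt_top measure_ball_lt_top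
  · have h1 : ∀ x y : Rn n, ENNReal.ofReal (|l * (v (x₀ + σ • x) - c) -
        l * (v (x₀ + σ • y) - c)| ^ p * fker n s p (x - y)) =
        ENNReal.ofReal (|l| ^ p * σ ^ ((n : ℝ) + s * p)) *
        ENNReal.ofReal (|v (x₀ + σ • x) - v (x₀ + σ • y)| ^ p *
          fker n s p ((x₀ + σ • x) - (x₀ + σ • y))) := by
      intro x y
      rw [← ENNReal.ofReal_mul (by positivity), hmul, hker]
      congr 1; ring
    simp_rw [h1]
    simp_rw [lintegral_const_mul' _ _ ENNReal.ofReal_ne_top]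
    have h2 : ∀ x : Rn n, ∫⁻ y, ENNReal.ofReal (|v (x₀ + σ • x) - v (x₀ + σ • y)| ^ p *
          fker n s p ((x₀ + σ • x) - (x₀ + σ • y))) = ENNReal.ofReal (σ ^ n)⁻¹ *
        ∫⁻ y, ENNReal.ofReal (|v (x₀ + σ • x) - v y| ^ p * fker n s p ((x₀ + σ • x) - y)) :=
      fun x => lintegral_comp_affine x₀ hσ
        (fun y => ENNReal.ofReal (|v (x₀ + σ • x) - v y| ^ p * fker n s p ((x₀ + σ • x) - y)))
    simp_rw [h2, lintegral_const_mul' _ _ ENNReal.ofReal_ne_top]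
    rw [lintegral_comp_affine x₀ hσ
        (fun x => ∫⁻ y, ENNReal.ofReal (|v x - v y| ^ p * fker n s p (x - y)))]
    exact ENNReal.mul_lt_top ENNReal.ofReal_lt_top (ENNReal.mul_lt_top ENNReal.ofReal_lt_top
      (ENNReal.mul_lt_top ENNReal.ofReal_lt_top hv.gag))
  · obtain ⟨a, ha, hlow, hup, heq⟩ := hv.flux
    have hpow : |l| ^ (p - 2) * l * l = |l| ^ p := by
      rw [mul_assoc, ← abs_mul_abs_self l, ← pow_two, ← Real.rpow_two, ← Real.rpow_add hl0]
      congr 1; ring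
    have hpow' : |l| ^ (p - 2) * |l| = |l| ^ (p - 1) := by
      nth_rewrite 2 [← Real.rpow_one |l|]
      rw [← Real.rpow_add hl0]
      congr 1; ring
    refine ⟨fun x y => (|l| ^ (p - 2) * l * σ ^ ((n : ℝ) + s * p)) *
      a (x₀ + σ • x) (x₀ + σ • y), ?_, ?_, ?_, ?_⟩
    · refine Measurable.const_mul ?_ _
      exact ha.comp ((haff.comp measurable_fst).prodMk (haff.comp measurable_snd))
    · intro x y
      rw [hmul, hker]
      have := mul_le_mul_of_nonneg_left (hlow (x₀ + σ • x) (x₀ + σ • y))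
        (by positivity : 0 ≤ |l| ^ p * σ ^ ((n : ℝ) + s * p))
      refine le_trans (le_of_eq (by ring)) (this.trans (le_of_eq ?_))
      rw [← hpow]; ring
    · intro x y
      rw [hmul, hker]
      have := mul_le_mul_of_nonneg_left (hup (x₀ + σ • x) (x₀ + σ • y))
        (by positivity : 0 ≤ |l| ^ (p - 1) * σ ^ ((n : ℝ) + s * p))
      refine le_trans (le_of_eq ?_) (this.trans (le_of_eq (by ring)))
      rw [abs_mul, abs_mul, abs_mul, abs_of_pos hD, abs_of_nonneg (Real.rpow_nonneg hl0.le _),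
        hpow']
    · intro φ hφ
      have h0 := heq _ (hφ.comp_affine x₀ hσ hO)
      set ψ : Rn n → ℝ := fun z => φ (σ⁻¹ • (z - x₀)) with hψ
      have hφψ : ∀ x, φ x = ψ (x₀ + σ • x) := by
        intro x; simp only [hψ]; rw [add_sub_cancel_left, inv_smul_smul₀ hσ.ne']
      simp_rw [hφψ, mul_assoc, integral_const_mul]
      have h2 : ∀ x : Rn n, ∫ y, a (x₀ + σ • x) (x₀ + σ • y) *
          (ψ (x₀ + σ • x) - ψ (x₀ + σ • y)) = (σ ^ n)⁻¹ *
          ∫ y, a (x₀ + σ • x) y * (ψ (x₀ + σ • x) - ψ y) := fun x =>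
        integral_comp_affine x₀ hσ (fun y => a (x₀ + σ • x) y * (ψ (x₀ + σ • x) - ψ y))
      simp_rw [h2, integral_const_mul]
      rw [integral_comp_affine x₀ hσ (fun x => ∫ y, a x y * (ψ x - ψ y)), h0]
      simp

end Solutions

section Density

variable {n : ℕ} {s p L : ℝ}

lemma continuous_integral_mul_translate {P Q : ℝ≥0∞} [P.HolderConjugate Q] [Fact (1 ≤ P)]
    [Fact (1 ≤ Q)] (hQ : Q ≠ ⊤) {G F : Rn n × Rn n → ℝ} (hG : MemLp G P) (hF : MemLp F Q) :
    Continuous (fun h : Rn n => ∫ z, G z * F (z + (h, h))) := by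
  let T : C(Rn n, C(Rn n × Rn n, Rn n × Rn n)) :=
    (ContinuousMap.mk (fun a : Rn n × (Rn n × Rn n) => a.2 + (a.1, a.1))
      (by fun_prop)).curry
  have hT : ∀ h, MeasurePreserving (T h) volume volume := fun h =>
    (measurePreserving_add_right volume h).prod (measurePreserving_add_right volume h)
  have h1 : Continuous (fun h => Lp.compMeasurePreserving (T h) (hT h) (hF.toLp F)) :=
    Continuous.compMeasurePreservingLp continuous_const T.continuous hT hQ
  have h2 := ((ContinuousLinearMap.mul ℝ ℝ).lpPairing volume P Q (hG.toLp G)).continuous.comp h1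
  refine h2.congr fun h => ?_
  simp only [Function.comp]
  rw [ContinuousLinearMap.lpPairing_eq_integral]
  refine integral_congr_ae ?_
  rw [Lp.toLp_compMeasurePreserving hF (hT h)]
  filter_upwards [hG.coeFn_toLp, (hF.comp_measurePreserving (hT h)).coeFn_toLp] with z hz1 hz2
  rw [hz1, hz2]; rfl

lemma measurable_diff_fker {φ : Rn n → ℝ} (hφ : Measurable φ) (q : ℝ) :
    Measurable (fun z : Rn n × Rn n => |φ z.1 - φ z.2| ^ q * fker n s p (z.1 - z.2)) := by
  have := measurable_fker (n := n) (s := s) (p := p)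
  fun_prop

lemma integrable_diff_fker {φ : Rn n → ℝ} (hφ : Measurable φ)
    (hg : ∫⁻ x, ∫⁻ y, ENNReal.ofReal (|φ x - φ y| ^ p * fker n s p (x - y)) < ⊤) :
    Integrable (fun z : Rn n × Rn n => |φ z.1 - φ z.2| ^ p * fker n s p (z.1 - z.2)) := by
  have hm := measurable_diff_fker (n := n) (s := s) (p := p) hφ p
  refine ⟨hm.aestronglyMeasurable, ?_⟩
  rw [hasFiniteIntegral_iff_ofReal (ae_of_all _ fun z =>
    mul_nonneg (by positivity) (fker_nonneg _)), Measure.volume_eq_prod,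
    lintegral_prod _ hm.ennreal_ofReal.aemeasurable]
  exact hg

lemma rpow_sub_one_mul_le (hp : 1 < p) {t u : ℝ} (ht : 0 ≤ t) (hu : 0 ≤ u) :
    t ^ (p - 1) * u ≤ t ^ p + u ^ p := by
  have hM : 0 ≤ max t u := le_max_of_le_left ht
  have h1 : t ^ (p - 1) * u ≤ (max t u) ^ (p - 1) * max t u := by
    gcongr
    · exact le_max_left _ _
    · exact le_max_right _ _
  have h2 : (max t u) ^ (p - 1) * max t u = (max t u) ^ p := by
    rw [← Real.rpow_add_one' hM (by linarith)]; congr 1; ring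
  rw [h2] at h1
  refine h1.trans ?_
  rcases max_cases t u with h | h <;> rw [h.1]
  · linarith [Real.rpow_nonneg hu p]
  · linarith [Real.rpow_nonneg ht p]

lemma integrable_flux (H : Admissible n s p L) {v φ : Rn n → ℝ} {a : Rn n → Rn n → ℝ}
    (hv : Measurable v) (hφ : Measurable φ) (ha : Measurable (Function.uncurry a))
    (hgv : ∫⁻ x, ∫⁻ y, ENNReal.ofReal (|v x - v y| ^ p * fker n s p (x - y)) < ⊤)
    (hgφ : ∫⁻ x, ∫⁻ y, ENNReal.ofReal (|φ x - φ y| ^ p * fker n s p (x - y)) < ⊤)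
    (hup : ∀ x y, |a x y| ≤ L * (|v x - v y| ^ (p - 1) * fker n s p (x - y))) :
    Integrable (fun z : Rn n × Rn n => a z.1 z.2 * (φ z.1 - φ z.2)) := by
  have h := ((integrable_diff_fker hv hgv).add (integrable_diff_fker hφ hgφ)).const_mul L
  refine h.mono' ?_ (ae_of_all _ fun z => ?_)
  · exact (ha.mul ((hφ.comp measurable_fst).sub (hφ.comp measurable_snd))).aestronglyMeasurable
  · rw [Real.norm_eq_abs, abs_mul]
    have h1 := mul_le_mul_of_nonneg_right (hup z.1 z.2) (abs_nonneg (φ z.1 - φ z.2))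
    refine h1.trans ?_
    have h2 := rpow_sub_one_mul_le H.one_lt_p (abs_nonneg (v z.1 - v z.2))
      (abs_nonneg (φ z.1 - φ z.2))
    have h3 := mul_le_mul_of_nonneg_right h2 (fker_nonneg (s := s) (p := p) (z.1 - z.2))
    simp only [Pi.add_apply]
    have h4 := mul_le_mul_of_nonneg_left h3 H.L_pos.le
    linarith

lemma lintegral_diff_translate {φ : Rn n → ℝ} (h : Rn n) :
    ∫⁻ x, ∫⁻ y, ENNReal.ofReal (|φ (x + h) - φ (y + h)| ^ p * fker n s p (x - y)) =
    ∫⁻ x, ∫⁻ y, ENNReal.ofReal (|φ x - φ y| ^ p * fker n s p (x - y)) := by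
  have h1 : ∀ x, ∫⁻ y, ENNReal.ofReal (|φ (x + h) - φ (y + h)| ^ p * fker n s p (x - y)) =
      ∫⁻ y, ENNReal.ofReal (|φ (x + h) - φ y| ^ p * fker n s p (x + h - y)) := by
    intro x
    rw [← lintegral_add_right_eq_self (fun y =>
      ENNReal.ofReal (|φ (x + h) - φ y| ^ p * fker n s p (x + h - y))) h]
    simp only [add_sub_add_right_eq_sub]
  simp_rw [h1]
  exact lintegral_add_right_eq_self
    (fun x => ∫⁻ y, ENNReal.ofReal (|φ x - φ y| ^ p * fker n s p (x - y))) h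

lemma continuous_flux_translate (H : Admissible n s p L) {v φ : Rn n → ℝ}
    {a : Rn n → Rn n → ℝ}
    (hv : Measurable v) (hφ : Measurable φ) (ha : Measurable (Function.uncurry a))
    (hgv : ∫⁻ x, ∫⁻ y, ENNReal.ofReal (|v x - v y| ^ p * fker n s p (x - y)) < ⊤)
    (hgφ : ∫⁻ x, ∫⁻ y, ENNReal.ofReal (|φ x - φ y| ^ p * fker n s p (x - y)) < ⊤)
    (hup : ∀ x y, |a x y| ≤ L * (|v x - v y| ^ (p - 1) * fker n s p (x - y))) :
    Continuous (fun h : Rn n =>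
      ∫ z : Rn n × Rn n, a z.1 z.2 * (φ (z.1 + h) - φ (z.2 + h))) := by
  have hpp := H.p_pos
  have hp1 := H.p_sub_pos
  set P := ENNReal.ofReal (p / (p - 1))
  set Q := ENNReal.ofReal p
  have hconj : (p / (p - 1)).HolderConjugate p := (Real.HolderConjugate.conjExponent H.one_lt_p).symm
  have hP1 : 1 ≤ p / (p - 1) := by rw [le_div_iff₀ hp1]; linarith
  have hP0 : 0 < p / (p - 1) := by positivity
  have : P.HolderConjugate Q := hconj.ennrealOfReal
  have : Fact (1 ≤ P) := ⟨by simpa [P] using hP1⟩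
  have : Fact (1 ≤ Q) := ⟨by simpa [Q] using H.one_lt_p.le⟩
  have hkm := measurable_fker (n := n) (s := s) (p := p)
  let G : Rn n × Rn n → ℝ := fun z => a z.1 z.2 * (fker n s p (z.1 - z.2)) ^ (-(1 / p))
  let F : Rn n × Rn n → ℝ := fun z => (φ z.1 - φ z.2) * (fker n s p (z.1 - z.2)) ^ (1 / p)
  have hGm : Measurable G := by
    have : Measurable (fun z : Rn n × Rn n => a z.1 z.2) := ha
    simp only [G]; fun_prop
  have hFm : Measurable F := by simp only [F]; fun_prop
  have hF : MemLp F Q := by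
    rw [← integrable_norm_rpow_iff hFm.aestronglyMeasurable (by simpa [Q] using hpp)
      ENNReal.ofReal_ne_top, ENNReal.toReal_ofReal hpp.le]
    refine (integrable_diff_fker hφ hgφ).congr (ae_of_all _ fun z => ?_)
    have hk := fker_nonneg (s := s) (p := p) (z.1 - z.2)
    simp only [F, Real.norm_eq_abs, abs_mul, abs_of_nonneg (Real.rpow_nonneg hk _)]
    rw [Real.mul_rpow (abs_nonneg _) (Real.rpow_nonneg hk _), ← Real.rpow_mul hk,
      one_div_mul_cancel hpp.ne', Real.rpow_one]
  have hG : MemLp G P := by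
    rw [← integrable_norm_rpow_iff hGm.aestronglyMeasurable (by simpa [P] using hP0)
      ENNReal.ofReal_ne_top, ENNReal.toReal_ofReal hP0.le]
    refine ((integrable_diff_fker hv hgv).const_mul (L ^ (p / (p - 1)))).mono'
      (hGm.norm.pow_const _).aestronglyMeasurable (ae_of_all _ fun z => ?_)
    have hk := fker_nonneg (s := s) (p := p) (z.1 - z.2)
    rw [Real.norm_of_nonneg (by positivity)]
    simp only [G, Real.norm_eq_abs, abs_mul, abs_of_nonneg (Real.rpow_nonneg hk _)]
    rcases hk.eq_or_lt with hk0 | hk0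
    · have : |a z.1 z.2| = 0 := by
        have := hup z.1 z.2
        rw [← hk0] at this
        exact le_antisymm (by simpa using this) (abs_nonneg _)
      rw [this, zero_mul, Real.zero_rpow hP0.ne', ← hk0]; simp
    · have h1 : |a z.1 z.2| * fker n s p (z.1 - z.2) ^ (-(1 / p)) ≤
          L * (|v z.1 - v z.2| ^ (p - 1) * fker n s p (z.1 - z.2) ^ ((p - 1) / p)) := by
        refine (mul_le_mul_of_nonneg_right (hup z.1 z.2) (Real.rpow_nonneg hk _)).trans
          (le_of_eq ?_)
        have : fker n s p (z.1 - z.2) ^ ((p - 1) / p) =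
            fker n s p (z.1 - z.2) * fker n s p (z.1 - z.2) ^ (-(1 / p)) := by
          nth_rewrite 2 [← Real.rpow_one (fker n s p (z.1 - z.2))]
          rw [← Real.rpow_add hk0]; congr 1; field_simp; ring
        rw [this]; ring
      refine (Real.rpow_le_rpow (by positivity) h1 hP0.le).trans (le_of_eq ?_)
      rw [Real.mul_rpow H.L_pos.le (by positivity), Real.mul_rpow (by positivity) (by positivity),
        ← Real.rpow_mul (abs_nonneg _), ← Real.rpow_mul hk]
      have e1 : (p - 1) * (p / (p - 1)) = p := by field_simp
      have e2 : (p - 1) / p * (p / (p - 1)) = 1 := by field_simp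
      rw [e1, e2, Real.rpow_one]
  refine (continuous_integral_mul_translate (P := P) (Q := Q) ENNReal.ofReal_ne_top hG hF).congr
    fun h => integral_congr_ae (ae_of_all _ fun z => ?_)
  simp only [G, F, Prod.fst_add, Prod.snd_add, add_sub_add_right_eq_sub]
  have hk := fker_nonneg (s := s) (p := p) (z.1 - z.2)
  rcases hk.eq_or_lt with hk0 | hk0
  · have : a z.1 z.2 = 0 := by
      have := hup z.1 z.2
      rw [← hk0] at this
      exact abs_eq_zero.1 (le_antisymm (by simpa using this) (abs_nonneg _))
    rw [this]; ring
  · have : fker n s p (z.1 - z.2) ^ (-(1 / p)) * fker n s p (z.1 - z.2) ^ (1 / p) = 1 := by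
      rw [← Real.rpow_add hk0]; simp
    linear_combination (a z.1 z.2 * (φ (z.1 + h) - φ (z.2 + h))) * this

end Density

section ExtendedTest

variable {n : ℕ} {s p L : ℝ}

lemma isTestFun_convolution {b : ℝ} (β : ContDiffBump (0 : Rn n)) (hβ : b + β.rOut < 1)
    {φ : Rn n → ℝ} (hφ : LocallyIntegrable φ) (hφs : ∀ x, x ∉ closedBall 0 b → φ x = 0) :
    IsTestFun n (ball 0 1)
      (MeasureTheory.convolution (β.normed volume) φ (ContinuousLinearMap.lsmul ℝ ℝ) volume) := by
  set ψ := MeasureTheory.convolution (β.normed volume) φ (ContinuousLinearMap.lsmul ℝ ℝ) volume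
  have hsup : tsupport ψ ⊆ closedBall 0 (b + β.rOut) := by
    refine closure_minimal ?_ isClosed_closedBall
    refine (support_convolution_subset _).trans ?_
    rintro _ ⟨x, hx, y, hy, rfl⟩
    have hx' : x ∈ ball (0 : Rn n) β.rOut := by
      rwa [β.support_normed_eq] at hx
    have hy' : y ∈ closedBall (0 : Rn n) b := by
      by_contra h
      exact hy (hφs y h)
    rw [mem_closedBall_zero_iff] at hy' ⊢
    rw [mem_ball_zero_iff] at hx'
    exact (norm_add_le x y).trans (by linarith)
  refine ⟨?_, ?_, hsup.trans (closedBall_subset_ball hβ)⟩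
  · exact β.hasCompactSupport_normed.contDiff_convolution_left _ β.contDiff_normed hφ
  · exact HasCompactSupport.of_support_subset_isCompact (isCompact_closedBall 0 (b + β.rOut))
      (subset_closure.trans hsup)

lemma integral_flux_eq_zero (H : Admissible n s p L) {v φ : Rn n → ℝ} {a : Rn n → Rn n → ℝ}
    (hv : Measurable v) (hφ : Measurable φ) (ha : Measurable (Function.uncurry a))
    (hgv : ∫⁻ x, ∫⁻ y, ENNReal.ofReal (|v x - v y| ^ p * fker n s p (x - y)) < ⊤)
    (hgφ : ∫⁻ x, ∫⁻ y, ENNReal.ofReal (|φ x - φ y| ^ p * fker n s p (x - y)) < ⊤)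
    (hup : ∀ x y, |a x y| ≤ L * (|v x - v y| ^ (p - 1) * fker n s p (x - y)))
    (htest : ∀ φ, IsTestFun n (ball 0 1) φ → ∫ x, ∫ y, a x y * (φ x - φ y) = 0)
    {b : ℝ} (hb : b < 1) (hφi : Integrable φ) (hφs : ∀ x, x ∉ closedBall 0 b → φ x = 0) :
    ∫ z : Rn n × Rn n, a z.1 z.2 * (φ z.1 - φ z.2) = 0 := by
  have ha' : Measurable (fun z : Rn n × Rn n => a z.1 z.2) := ha
  have hkm := measurable_fker (n := n) (s := s) (p := p)
  set I : Rn n → ℝ := fun h => ∫ z : Rn n × Rn n, a z.1 z.2 * (φ (z.1 + h) - φ (z.2 + h))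
    with hI
  have hIc : Continuous I := continuous_flux_translate H hv hφ ha hgv hgφ hup
  have hgφt : ∀ h : Rn n, ∫⁻ x, ∫⁻ y, ENNReal.ofReal
      (|φ (x + h) - φ (y + h)| ^ p * fker n s p (x - y)) < ⊤ := fun h => by
    rwa [lintegral_diff_translate]
  have hφt : ∀ h : Rn n, Measurable (fun x => φ (x + h)) := fun h =>
    hφ.comp (measurable_id.add_const h)
  have key : ∀ β : ContDiffBump (0 : Rn n), b + β.rOut < 1 →
      MeasureTheory.convolution (β.normed volume) I (ContinuousLinearMap.lsmul ℝ ℝ) volume 0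
        = 0 := by
    intro β hβ
    set w := β.normed (volume : Measure (Rn n)) with hw
    have hwi : Integrable w := (β.contDiff_normed (n := 0)).continuous.integrable_of_hasCompactSupport
      β.hasCompactSupport_normed
    have hwm : Measurable w := (β.contDiff_normed (n := 0)).continuous.measurable
    have hw0 : ∀ t, 0 ≤ w t := fun t => β.nonneg_normed t
    have hint : Integrable (fun q : Rn n × (Rn n × Rn n) =>
        w q.1 * (a q.2.1 q.2.2 * (φ (q.2.1 + -q.1) - φ (q.2.2 + -q.1)))) := by
      have hm : Measurable (fun q : Rn n × (Rn n × Rn n) =>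
        w q.1 * (a q.2.1 q.2.2 * (φ (q.2.1 + -q.1) - φ (q.2.2 + -q.1)))) := by
        have : Measurable (fun q : Rn n × (Rn n × Rn n) => a q.2.1 q.2.2) :=
          ha'.comp measurable_snd
        fun_prop
      set g1 := fun z : Rn n × Rn n => |v z.1 - v z.2| ^ p * fker n s p (z.1 - z.2)
      set g2 := fun z : Rn n × Rn n => |φ z.1 - φ z.2| ^ p * fker n s p (z.1 - z.2) with hg2
      have hi1 : Integrable g1 := integrable_diff_fker hv hgv
      have hi2 : Integrable g2 := integrable_diff_fker hφ hgφ
      have hmp : ∀ t : Rn n, MeasurePreserving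
          (fun z : Rn n × Rn n => (z.1 + t, z.2 + t)) volume volume := fun t =>
        (measurePreserving_add_right volume t).prod (measurePreserving_add_right volume t)
      have hG2 : Integrable (fun q : Rn n × (Rn n × Rn n) =>
          w q.1 * g2 (q.2.1 + -q.1, q.2.2 + -q.1)) := by
        have hm2 : Measurable g2 := measurable_diff_fker hφ p
        rw [Measure.volume_eq_prod, integrable_prod_iff (by
          refine Measurable.aestronglyMeasurable ?_; fun_prop)]
        refine ⟨ae_of_all _ fun t => ?_, ?_⟩
        · exact ((hmp (-t)).integrable_comp_of_integrable hi2).const_mul (w t)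
        · have : ∀ t : Rn n, ∫ z : Rn n × Rn n, ‖w t * g2 (z.1 + -t, z.2 + -t)‖ =
              w t * ∫ z, g2 z := by
            intro t
            rw [← integral_const_mul, ← (hmp (-t)).map_eq, integral_map (hmp (-t)).aemeasurable
              ((hm2.const_mul _).aestronglyMeasurable), (hmp (-t)).map_eq]
            refine integral_congr_ae (ae_of_all _ fun z => ?_)
            exact Real.norm_of_nonneg (mul_nonneg (hw0 t) (mul_nonneg (by positivity)
              (fker_nonneg _)))
          simp only [this]
          exact hwi.mul_const _
      have hG1 : Integrable (fun q : Rn n × (Rn n × Rn n) => w q.1 * g1 q.2) :=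
        hwi.mul_prod hi1
      refine ((hG1.add hG2).const_mul L).mono' hm.aestronglyMeasurable (ae_of_all _ fun q => ?_)
      rw [norm_mul, Real.norm_of_nonneg (hw0 _), Real.norm_eq_abs, abs_mul]
      have h1 := mul_le_mul_of_nonneg_right (hup q.2.1 q.2.2)
        (abs_nonneg (φ (q.2.1 + -q.1) - φ (q.2.2 + -q.1)))
      have h2 := rpow_sub_one_mul_le H.one_lt_p (abs_nonneg (v q.2.1 - v q.2.2))
        (abs_nonneg (φ (q.2.1 + -q.1) - φ (q.2.2 + -q.1)))
      have h3 := mul_le_mul_of_nonneg_right h2 (fker_nonneg (s := s) (p := p) (q.2.1 - q.2.2))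
      have h4 := mul_le_mul_of_nonneg_left h3 H.L_pos.le
      have h5 := mul_le_mul_of_nonneg_left (h1.trans (le_trans (le_of_eq (by ring)) h4)) (hw0 q.1)
      refine h5.trans (le_of_eq ?_)
      simp only [g1, g2, Pi.add_apply, add_sub_add_right_eq_sub]
      ring
    set ψ := MeasureTheory.convolution w φ (ContinuousLinearMap.lsmul ℝ ℝ) volume with hψ
    have htψ := isTestFun_convolution β hβ hφi.locallyIntegrable hφs
    have hinner : ∀ z : Rn n × Rn n,
        ∫ t, w t * (a z.1 z.2 * (φ (z.1 + -t) - φ (z.2 + -t))) =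
          a z.1 z.2 * (ψ z.1 - ψ z.2) := by
      intro z
      have hc : ∀ x, Integrable (fun t => w t * φ (x + -t)) := fun x => by
        have := HasCompactSupport.convolutionExists_left (f := w) (μ := volume)
          (ContinuousLinearMap.lsmul ℝ ℝ) β.hasCompactSupport_normed
          (β.contDiff_normed (n := 0)).continuous hφi.locallyIntegrable x
        refine Integrable.congr this (ae_of_all _ fun t => ?_)
        simp [sub_eq_add_neg, hw]
      have hψx : ∀ x, ψ x = ∫ t, w t * φ (x + -t) := fun x => by
        simp only [hψ, convolution_def, ContinuousLinearMap.lsmul_apply, smul_eq_mul,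
          sub_eq_add_neg]
      rw [hψx, hψx, ← integral_sub (hc _) (hc _), ← integral_const_mul]
      refine integral_congr_ae (ae_of_all _ fun t => ?_)
      simp only; ring
    have hz := htest ψ htψ
    have hiψ : Integrable (fun z : Rn n × Rn n => a z.1 z.2 * (ψ z.1 - ψ z.2)) := by
      have := hint.integral_prod_right
      simpa only [hinner] using this
    rw [← integral_prod (fun z : Rn n × Rn n => a z.1 z.2 * (ψ z.1 - ψ z.2)) hiψ,
      ← Measure.volume_eq_prod] at hz
    rw [convolution_def]
    simp only [ContinuousLinearMap.lsmul_apply, smul_eq_mul, zero_sub, hI]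
    simp only [← integral_const_mul]
    rw [integral_integral_swap hint]
    simp only [hinner]
    exact hz
  have hδ : 0 < (1 - b) / 2 := by linarith
  let β : ℕ → ContDiffBump (0 : Rn n) := fun k =>
    { rIn := (1 - b) / 4 * (1 / ((k : ℝ) + 1))
      rOut := (1 - b) / 2 * (1 / ((k : ℝ) + 1))
      rIn_pos := by have : 0 < 1 - b := by linarith
                    positivity
      rIn_lt_rOut := by
        have : (0 : ℝ) < 1 / ((k : ℝ) + 1) := by positivity
        nlinarith }
  have hlim : Tendsto (fun k => (β k).rOut) atTop (𝓝 0) := by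
    have := (tendsto_one_div_add_atTop_nhds_zero_nat (𝕜 := ℝ)).const_mul ((1 - b) / 2)
    simpa only [mul_zero] using this
  have hconv := ContDiffBump.convolution_tendsto_right_of_continuous (μ := volume) hlim hIc 0
  have hall : ∀ k, b + (β k).rOut < 1 := by
    intro k
    have h1 : (1 : ℝ) / ((k : ℝ) + 1) ≤ 1 := by
      rw [div_le_one (by positivity)]; linarith [(Nat.cast_nonneg k : (0 : ℝ) ≤ k)]
    have h2 : (β k).rOut ≤ (1 - b) / 2 * 1 := mul_le_mul_of_nonneg_left h1 hδ.le
    linarith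
  have h0 : I 0 = 0 := by
    refine tendsto_nhds_unique hconv ?_
    simp only [fun k => key (β k) (hall k)]
    exact tendsto_const_nhds
  simpa [hI] using h0

end ExtendedTest

section Cutoff

variable {n : ℕ} {s p L : ℝ}

lemma lintegral_le_of_integral_eq_zero {Z : Type*} [MeasurableSpace Z] {μ : Measure Z}
    {f G E : Z → ℝ} (hf : Integrable f μ) (h0 : ∫ z, f z ∂μ = 0) (hE : ∀ z, 0 ≤ E z)
    (hEm : Measurable E) (hG0 : ∀ z, 0 ≤ G z)
    (hG : ∀ z, G z ≤ f z + E z) :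
    ∫⁻ z, ENNReal.ofReal (G z) ∂μ ≤ ∫⁻ z, ENNReal.ofReal (E z) ∂μ := by
  have hpos := hf.lintegral_lt_top
  have hneg := hf.neg.lintegral_lt_top
  have heq : ∫⁻ z, ENNReal.ofReal (f z) ∂μ = ∫⁻ z, ENNReal.ofReal (-f z) ∂μ := by
    have h1 := integral_eq_lintegral_pos_part_sub_lintegral_neg_part hf
    rw [h0] at h1
    exact (ENNReal.toReal_eq_toReal_iff' hpos.ne hneg.ne).1 (by simp only [Pi.neg_apply]; linarith)
  have key : ∫⁻ z, ENNReal.ofReal (G z) ∂μ + ∫⁻ z, ENNReal.ofReal (-f z) ∂μ ≤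
      ∫⁻ z, ENNReal.ofReal (E z) ∂μ + ∫⁻ z, ENNReal.ofReal (f z) ∂μ := by
    have hnm : AEMeasurable (fun z => ENNReal.ofReal (-f z)) μ :=
      hf.neg.aemeasurable.ennreal_ofReal
    rw [← lintegral_add_right' _ hnm, ← lintegral_add_left' hEm.ennreal_ofReal.aemeasurable]
    refine lintegral_mono fun z => ?_
    simp only
    rcases le_total 0 (f z) with h | h
    · rw [ENNReal.ofReal_of_nonpos (by linarith : -f z ≤ 0), add_zero,
        ← ENNReal.ofReal_add (hE z) h]
      exact ENNReal.ofReal_le_ofReal (by linarith [hG z])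
    · rw [ENNReal.ofReal_of_nonpos h, add_zero, ← ENNReal.ofReal_add (hG0 z) (by linarith)]
      exact ENNReal.ofReal_le_ofReal (by linarith [hG z])
  rw [heq] at key
  exact ENNReal.le_of_add_le_add_right (by simpa using hneg.ne) key

lemma rpow_sub_rpow_le (hp : 1 ≤ p) {t u : ℝ} (hu : 0 ≤ u) (hut : u ≤ t) :
    t ^ p - u ^ p ≤ p * (t ^ (p - 1) * (t - u)) := by
  rcases (hu.trans hut).eq_or_lt with h | ht
  · have : u = 0 := by linarith
    subst this; subst h; simp
  · have h1 := one_add_mul_self_le_rpow_one_add (s := u / t - 1)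
      (by have : 0 ≤ u / t := by positivity
          linarith) hp
    rw [add_sub_cancel, Real.div_rpow hu ht.le] at h1
    have h2 : 0 < t ^ p := by positivity
    have h3 := mul_le_mul_of_nonneg_right h1 h2.le
    rw [div_mul_cancel₀ _ h2.ne'] at h3
    have h4 : t ^ p = t ^ (p - 1) * t := by
      rw [← Real.rpow_add_one' ht.le (by linarith)]; congr 1; ring
    have h5 : (1 + p * (u / t - 1)) * t ^ p = t ^ p + p * (t ^ (p - 1) * (u - t)) := by
      rw [h4]; field_simp
    rw [h5] at h3
    linarith

lemma flux_mul_cutoff_ge (hp : 1 < p) (hL : 0 ≤ L) {X Y e f a κ : ℝ} (hY : 0 ≤ Y)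
    (hYX : Y ≤ X) (he : 0 ≤ e) (hf : 0 ≤ f) (ha0 : 0 ≤ a)
    (ha : a ≤ L * ((X - Y) ^ (p - 1) * κ)) (hκ : 0 ≤ κ) :
    -(L * p ^ p * (X ^ p * |e - f| ^ p * κ)) ≤ a * (X * e ^ p - Y * f ^ p) := by
  have hX : 0 ≤ X := hY.trans hYX
  have hp0 : 0 ≤ p := by linarith
  have hR : 0 ≤ L * p ^ p * (X ^ p * |e - f| ^ p * κ) := by positivity
  rcases le_total f e with hfe | hef
  · have : Y * f ^ p ≤ X * e ^ p :=
      mul_le_mul hYX (Real.rpow_le_rpow hf hfe hp0) (by positivity) hX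
    nlinarith [mul_nonneg ha0 (sub_nonneg.2 this)]
  · have h1 := rpow_sub_rpow_le hp.le he hef
    have hfp : f ^ p = f ^ (p - 1) * f := by
      rw [← Real.rpow_add_one' hf (by linarith)]; congr 1; ring
    have hf1 : 0 ≤ f ^ (p - 1) := by positivity
    have h2 : f ^ (p - 1) * ((X - Y) * f - p * (X * (f - e))) ≤ X * e ^ p - Y * f ^ p := by
      have := mul_le_mul_of_nonneg_left h1 hX
      rw [hfp] at this ⊢
      linarith
    have h3 := mul_le_mul_of_nonneg_left h2 ha0
    refine le_trans ?_ h3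
    rcases le_total (p * (X * (f - e))) ((X - Y) * f) with h | h
    · have : 0 ≤ a * (f ^ (p - 1) * ((X - Y) * f - p * (X * (f - e)))) :=
        mul_nonneg ha0 (mul_nonneg hf1 (by linarith))
      linarith
    · set t := p * (X * (f - e)) with ht
      have ht0 : 0 ≤ t := mul_nonneg hp0 (mul_nonneg hX (by linarith))
      have hXY : 0 ≤ X - Y := by linarith
      have h4 : ((X - Y) * f) ^ (p - 1) ≤ t ^ (p - 1) :=
        Real.rpow_le_rpow (mul_nonneg hXY hf) h (by linarith)
      have htp : t ^ p = t ^ (p - 1) * t := by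
        rw [← Real.rpow_add_one' ht0 (by linarith)]; congr 1; ring
      have h5 : a * (f ^ (p - 1) * t) ≤ L * (t ^ p * κ) := by
        calc a * (f ^ (p - 1) * t) ≤ L * ((X - Y) ^ (p - 1) * κ) * (f ^ (p - 1) * t) :=
              mul_le_mul_of_nonneg_right ha (by positivity)
          _ = L * (((X - Y) * f) ^ (p - 1) * t * κ) := by
              rw [Real.mul_rpow hXY hf]; ring
          _ ≤ L * (t ^ (p - 1) * t * κ) := by gcongr
          _ = _ := by rw [htp]
      have h6 : t ^ p = p ^ p * (X ^ p * |e - f| ^ p) := by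
        rw [ht, Real.mul_rpow hp0 (mul_nonneg hX (by linarith)), Real.mul_rpow hX (by linarith),
          abs_sub_comm, abs_of_nonneg (by linarith : 0 ≤ f - e)]
      have h7 : 0 ≤ a * (f ^ (p - 1) * ((X - Y) * f)) := by positivity
      rw [h6] at h5
      nlinarith

/-- A Lipschitz cutoff which is `1` on `ball 0 r` and vanishes outside `ball 0 (r + d / 2)`. -/
def cutoff (r d : ℝ) (x : Rn n) : ℝ := max 0 (min 1 ((r + d / 2 - ‖x‖) / (d / 2)))

lemma cutoff_nonneg (r d : ℝ) (x : Rn n) : 0 ≤ cutoff r d x := le_max_left _ _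

lemma cutoff_le_one (r d : ℝ) (x : Rn n) : cutoff r d x ≤ 1 :=
  max_le zero_le_one (min_le_left _ _)

lemma continuous_cutoff (r d : ℝ) : Continuous (cutoff r d : Rn n → ℝ) := by
  unfold cutoff; fun_prop

lemma cutoff_eq_one {r d : ℝ} (hd : 0 < d) {x : Rn n} (hx : x ∈ ball (0 : Rn n) r) :
    cutoff r d x = 1 := by
  rw [mem_ball_zero_iff] at hx
  have : 1 ≤ (r + d / 2 - ‖x‖) / (d / 2) := by rw [le_div_iff₀ (by positivity)]; linarith
  rw [cutoff, min_eq_left this, max_eq_right zero_le_one]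

lemma cutoff_eq_zero {r d : ℝ} (hd : 0 < d) {x : Rn n}
    (hx : x ∉ ball (0 : Rn n) (r + d / 2)) : cutoff r d x = 0 := by
  rw [mem_ball_zero_iff, not_lt] at hx
  refine max_eq_left ((min_le_right _ _).trans ?_)
  exact div_nonpos_of_nonpos_of_nonneg (by linarith) (by positivity)

lemma abs_cutoff_sub_le {r d : ℝ} (hd : 0 < d) (hd1 : d ≤ 1) (x y : Rn n) :
    |cutoff r d x - cutoff r d y| ≤ 2 / d * min 1 ‖x - y‖ := by
  rw [mul_min_of_nonneg _ _ (by positivity)]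
  refine le_min ?_ ?_
  · have h1 : |cutoff r d x - cutoff r d y| ≤ 1 :=
      abs_sub_le_iff.2 ⟨by linarith [cutoff_nonneg r d y, cutoff_le_one r d x],
        by linarith [cutoff_nonneg r d x, cutoff_le_one r d y]⟩
    have h2 : 1 ≤ 2 / d * 1 := by rw [mul_one, le_div_iff₀ hd]; linarith
    exact h1.trans h2
  · unfold cutoff
    refine (abs_max_sub_max_le_max _ _ _ _).trans (max_le (by simp; positivity) ?_)
    refine (abs_min_sub_min_le_max _ _ _ _).trans (max_le (by simp; positivity) ?_)
    rw [← sub_div, abs_div, abs_of_pos (by positivity : 0 < d / 2), sub_sub_sub_cancel_left]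
    have := abs_norm_sub_norm_le y x
    rw [norm_sub_rev] at this
    rw [div_le_iff₀ (by positivity)]
    calc |‖y‖ - ‖x‖| ≤ ‖x - y‖ := this
      _ = 2 / d * ‖x - y‖ * (d / 2) := by field_simp

end Cutoff

section Caccioppoli

variable {n : ℕ} {s p L : ℝ}

/-- The truncation `(v - k)₊`. -/
def truncAbove (v : Rn n → ℝ) (k : ℝ) (x : Rn n) : ℝ := max (v x - k) 0

lemma truncAbove_nonneg (v : Rn n → ℝ) (k : ℝ) (x : Rn n) : 0 ≤ truncAbove v k x := le_max_right _ _

lemma measurable_truncAbove {v : Rn n → ℝ} (hv : Measurable v) (k : ℝ) : Measurable (truncAbove v k) :=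
  (hv.sub_const k).max measurable_const

lemma truncAbove_of_le {v : Rn n → ℝ} {k : ℝ} {x : Rn n} (h : v x ≤ k) : truncAbove v k x = 0 :=
  max_eq_right (by linarith)

lemma truncAbove_of_ge {v : Rn n → ℝ} {k : ℝ} {x : Rn n} (h : k ≤ v x) : truncAbove v k x = v x - k :=
  max_eq_left (by linarith)

lemma abs_truncAbove_sub_le (v : Rn n → ℝ) (k : ℝ) (x y : Rn n) :
    |truncAbove v k x - truncAbove v k y| ≤ |v x - v y| := by
  unfold truncAbove
  refine (abs_max_sub_max_le_max _ _ _ _).trans (max_le ?_ (by simp))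
  rw [sub_sub_sub_cancel_right]

/-- The kernel `min(1, |z|)^p |z|^{-n-sp}`. -/
def mfker (n : ℕ) (s p : ℝ) (z : Rn n) : ℝ := (min 1 ‖z‖) ^ p * fker n s p z

lemma mfker_nonneg (z : Rn n) : 0 ≤ mfker n s p z :=
  mul_nonneg (by positivity) (fker_nonneg z)

lemma mfker_sub_comm (x y : Rn n) : mfker n s p (x - y) = mfker n s p (y - x) := by
  rw [mfker, mfker, norm_sub_rev, fker_sub_comm]

lemma measurable_mfker : Measurable (mfker n s p) := by
  have := measurable_fker (n := n) (s := s) (p := p)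
  unfold mfker; fun_prop

lemma lintegral_lintegral_mul_sub {u m : Rn n → ℝ≥0∞} (hu : Measurable u) (hm : Measurable m) :
    ∫⁻ x, ∫⁻ y, u x * m (x - y) = (∫⁻ x, u x) * ∫⁻ z, m z := by
  have : ∀ x, ∫⁻ y, u x * m (x - y) = u x * ∫⁻ z, m z := fun x => by
    rw [lintegral_const_mul _ (by fun_prop),
      lintegral_sub_left_eq_self m x]
  simp_rw [this]
  rw [lintegral_mul_const _ hu]

lemma lintegral_lintegral_mul_sub' {u m : Rn n → ℝ≥0∞} (hu : Measurable u) (hm : Measurable m) :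
    ∫⁻ x, ∫⁻ y, u y * m (x - y) = (∫⁻ x, u x) * ∫⁻ z, m z := by
  rw [lintegral_lintegral_swap (by fun_prop)]
  have : ∀ y, ∫⁻ x, u y * m (x - y) = u y * ∫⁻ z, m z := fun y => by
    rw [lintegral_const_mul _ (by fun_prop),
      lintegral_sub_right_eq_self m y]
  simp_rw [this]
  rw [lintegral_mul_const _ hu]

lemma lintegral_lintegral_prod {u g : Rn n → ℝ≥0∞} (hu : Measurable u) (hg : Measurable g) :
    ∫⁻ x, ∫⁻ y, u x * g y = (∫⁻ x, u x) * ∫⁻ y, g y := by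
  simp_rw [lintegral_const_mul _ hg]
  rw [lintegral_mul_const _ hu]

lemma lintegral_truncAbove_rpow_lt_top (H : Admissible n s p L) {v : Rn n → ℝ}
    (hloc : ∀ r : ℝ, ∫⁻ x in ball (0 : Rn n) r, ENNReal.ofReal (|v x| ^ p) < ⊤) (k r : ℝ) :
    ∫⁻ x in ball (0 : Rn n) r, ENNReal.ofReal (truncAbove v k x ^ p) < ⊤ := by
  have hp := H.p_pos
  have h2 : ∀ x, ENNReal.ofReal (truncAbove v k x ^ p) ≤
      ENNReal.ofReal (2 ^ p) * (ENNReal.ofReal (|v x| ^ p) + ENNReal.ofReal (|k| ^ p)) := by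
    intro x
    rw [← ENNReal.ofReal_add (by positivity) (by positivity), ← ENNReal.ofReal_mul (by positivity)]
    refine ENNReal.ofReal_le_ofReal (le_trans ?_ (abs_sub_rpow_le (v x) k hp.le))
    exact Real.rpow_le_rpow (truncAbove_nonneg _ _ _)
      (max_le (le_abs_self _) (abs_nonneg _)) hp.le
  refine (lintegral_mono h2).trans_lt ?_
  rw [lintegral_const_mul' _ _ ENNReal.ofReal_ne_top, lintegral_add_right _ measurable_const]
  refine ENNReal.mul_lt_top ENNReal.ofReal_lt_top (ENNReal.add_lt_top.2 ⟨hloc r, ?_⟩)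
  rw [lintegral_const, Measure.restrict_apply_univ]
  exact ENNReal.mul_lt_top ENNReal.ofReal_lt_top measure_ball_lt_top

lemma gagliardo_cutoff_lt_top (H : Admissible n s p L) {v : Rn n → ℝ} (hv : Measurable v)
    (hloc : ∀ r : ℝ, ∫⁻ x in ball (0 : Rn n) r, ENNReal.ofReal (|v x| ^ p) < ⊤)
    (hgv : ∫⁻ x, ∫⁻ y, ENNReal.ofReal (|v x - v y| ^ p * fker n s p (x - y)) < ⊤)
    (k : ℝ) {r d : ℝ} (hd : 0 < d) (hd1 : d ≤ 1) :
    ∫⁻ x, ∫⁻ y, ENNReal.ofReal (|truncAbove v k x * cutoff r d x ^ p -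
      truncAbove v k y * cutoff r d y ^ p| ^ p * fker n s p (x - y)) < ⊤ := by
  have hp := H.p_pos
  set w := truncAbove v k with hw
  set η : Rn n → ℝ := cutoff r d with hη
  have hη0 : ∀ x, 0 ≤ η x := cutoff_nonneg r d
  have hη1 : ∀ x, η x ≤ 1 := cutoff_le_one r d
  have hw0 : ∀ x, 0 ≤ w x := truncAbove_nonneg v k
  have hwm : Measurable w := measurable_truncAbove hv k
  set B := ball (0 : Rn n) (r + d / 2)
  set C : ℝ := p * (2 / d) with hC
  have hC0 : 0 ≤ C := by positivity
  set U : Rn n → ℝ := B.indicator (fun x => w x ^ p) with hU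
  have hU0 : ∀ x, 0 ≤ U x := fun x => indicator_nonneg (fun x _ => by have := hw0 x; positivity) x
  have hUm : Measurable U := (hwm.pow_const p).indicator measurableSet_ball
  have hpow : ∀ x y, η y ≤ η x → |η x ^ p - η y ^ p| ≤ C * min 1 ‖x - y‖ := by
    intro x y hxy
    rw [abs_of_nonneg (sub_nonneg.2 (Real.rpow_le_rpow (hη0 y) hxy hp.le))]
    refine (rpow_sub_rpow_le H.one_lt_p.le (hη0 y) hxy).trans ?_
    have h1 : η x ^ (p - 1) ≤ 1 := Real.rpow_le_one (hη0 x) (hη1 x) H.p_sub_pos.le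
    have h2 := abs_cutoff_sub_le (r := r) hd hd1 x y
    rw [abs_of_nonneg (by simpa [hη] using hxy)] at h2
    have h3 : η x ^ (p - 1) * (η x - η y) ≤ 1 * (2 / d * min 1 ‖x - y‖) :=
      mul_le_mul h1 h2 (by linarith) zero_le_one
    calc p * (η x ^ (p - 1) * (η x - η y)) ≤ p * (1 * (2 / d * min 1 ‖x - y‖)) := by gcongr
      _ = _ := by rw [hC]; ring
  have hpow' : ∀ x y, |η x ^ p - η y ^ p| ≤ C * min 1 ‖x - y‖ := by
    intro x y
    rcases le_total (η y) (η x) with h | h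
    · exact hpow x y h
    · rw [abs_sub_comm, norm_sub_rev]; exact hpow y x h
  have hz1 : ∀ x, η x ^ p ≤ 1 := fun x => Real.rpow_le_one (hη0 x) (hη1 x) hp.le
  have hz0 : ∀ x, 0 ≤ η x ^ p := fun x => Real.rpow_nonneg (hη0 x) p
  have hbound : ∀ x y, x ∈ B → |w x * η x ^ p - w y * η y ^ p| ^ p ≤
      2 ^ p * (|v x - v y| ^ p + C ^ p * (U x * (min 1 ‖x - y‖) ^ p)) := by
    intro x y hx
    have hUx : U x = w x ^ p := indicator_of_mem hx _
    have h1 : |w x * η x ^ p - w y * η y ^ p| ≤ |v x - v y| + w x * (C * min 1 ‖x - y‖) := by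
      have e : w x * η x ^ p - w y * η y ^ p =
        η y ^ p * (w x - w y) + w x * (η x ^ p - η y ^ p) := by ring
      rw [e]
      refine (abs_add_le _ _).trans (add_le_add ?_ ?_)
      · rw [abs_mul, abs_of_nonneg (hz0 y)]
        exact (mul_le_of_le_one_left (abs_nonneg _) (hz1 y)).trans (abs_truncAbove_sub_le v k x y)
      · rw [abs_mul, abs_of_nonneg (hw0 x)]
        exact mul_le_mul_of_nonneg_left (hpow' x y) (hw0 x)
    have hm : 0 ≤ min 1 ‖x - y‖ := le_min zero_le_one (norm_nonneg _)
    refine (Real.rpow_le_rpow (abs_nonneg _) h1 hp.le).trans ?_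
    refine (add_rpow_le (abs_nonneg _) (by have := hw0 x; positivity) hp.le).trans (le_of_eq ?_)
    rw [Real.mul_rpow (hw0 x) (by positivity), Real.mul_rpow hC0 hm, hUx]
    ring
  have hbd : ∀ x y, |w x * η x ^ p - w y * η y ^ p| ^ p * fker n s p (x - y) ≤
      2 ^ p * (|v x - v y| ^ p * fker n s p (x - y)) +
        2 ^ p * C ^ p * (U x * mfker n s p (x - y)) +
        2 ^ p * C ^ p * (U y * mfker n s p (x - y)) := by
    intro x y
    have hk := fker_nonneg (s := s) (p := p) (x - y)
    have hm : 0 ≤ min 1 ‖x - y‖ := le_min zero_le_one (norm_nonneg _)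
    have hmm := mfker_nonneg (s := s) (p := p) (x - y)
    have t1 : 0 ≤ 2 ^ p * C ^ p * (U x * mfker n s p (x - y)) := by have := hU0 x; positivity
    have t2 : 0 ≤ 2 ^ p * C ^ p * (U y * mfker n s p (x - y)) := by have := hU0 y; positivity
    by_cases hx : x ∈ B
    · have := mul_le_mul_of_nonneg_right (hbound x y hx) hk
      have e : mfker n s p (x - y) = (min 1 ‖x - y‖) ^ p * fker n s p (x - y) := rfl
      rw [e] at t2 ⊢
      linarith
    · by_cases hy : y ∈ B
      · have := mul_le_mul_of_nonneg_right (hbound y x hy) hk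
        have e : mfker n s p (x - y) = (min 1 ‖x - y‖) ^ p * fker n s p (x - y) := rfl
        rw [e] at t1 ⊢
        rw [abs_sub_comm, abs_sub_comm (v y), norm_sub_rev] at this
        linarith
      · have e1 : η x = 0 := cutoff_eq_zero hd hx
        have e2 : η y = 0 := cutoff_eq_zero hd hy
        rw [e1, e2, Real.zero_rpow hp.ne']
        simp only [mul_zero, sub_zero, abs_zero, Real.zero_rpow hp.ne', zero_mul]
        positivity
  have hJ := lintegral_fker_near_lt_top H
  have hUi : ∫⁻ x, ENNReal.ofReal (U x) < ⊤ := by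
    have : ∀ x, ENNReal.ofReal (U x) = B.indicator (fun x => ENNReal.ofReal (w x ^ p)) x := by
      intro x
      by_cases hx : x ∈ B <;> simp [hU, hx]
    simp_rw [this]
    rw [lintegral_indicator measurableSet_ball]
    exact lintegral_truncAbove_rpow_lt_top H hloc k _
  have hmm := measurable_mfker (n := n) (s := s) (p := p)
  have hkm := measurable_fker (n := n) (s := s) (p := p)
  have hbd' : ∀ x y, ENNReal.ofReal
      (|w x * η x ^ p - w y * η y ^ p| ^ p * fker n s p (x - y)) ≤
      ENNReal.ofReal (2 ^ p) * ENNReal.ofReal (|v x - v y| ^ p * fker n s p (x - y)) +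
        ENNReal.ofReal (2 ^ p * C ^ p) *
          (ENNReal.ofReal (U x) * ENNReal.ofReal (mfker n s p (x - y))) +
        ENNReal.ofReal (2 ^ p * C ^ p) *
          (ENNReal.ofReal (U y) * ENNReal.ofReal (mfker n s p (x - y))) := by
    intro x y
    have hk := fker_nonneg (s := s) (p := p) (x - y)
    have hm := mfker_nonneg (s := s) (p := p) (x - y)
    have h1 := hU0 x
    have h2 := hU0 y
    rw [← ENNReal.ofReal_mul h1, ← ENNReal.ofReal_mul h2, ← ENNReal.ofReal_mul (by positivity),
      ← ENNReal.ofReal_mul (by positivity), ← ENNReal.ofReal_mul (by positivity),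
      ← ENNReal.ofReal_add (by positivity) (by positivity),
      ← ENNReal.ofReal_add (by positivity) (by positivity)]
    exact ENNReal.ofReal_le_ofReal (hbd x y)
  refine (lintegral_mono fun x => lintegral_mono fun y => hbd' x y).trans_lt ?_
  have hUm' : Measurable (fun x => ENNReal.ofReal (U x)) := hUm.ennreal_ofReal
  have hmm' : Measurable (fun x => ENNReal.ofReal (mfker n s p x)) := hmm.ennreal_ofReal
  have split : ∀ (f1 f2 f3 : Rn n → Rn n → ℝ≥0∞) (c1 c2 : ℝ≥0∞), c1 ≠ ⊤ → c2 ≠ ⊤ →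
      Measurable (Function.uncurry f2) → Measurable (Function.uncurry f3) →
      ∫⁻ x, ∫⁻ y, (c1 * f1 x y + c2 * f2 x y + c2 * f3 x y) =
      c1 * (∫⁻ x, ∫⁻ y, f1 x y) + c2 * (∫⁻ x, ∫⁻ y, f2 x y) + c2 * (∫⁻ x, ∫⁻ y, f3 x y) := by
    intro f1 f2 f3 c1 c2 h1 h2 m2 m3
    have e : ∀ x, ∫⁻ y, (c1 * f1 x y + c2 * f2 x y + c2 * f3 x y) =
        c1 * (∫⁻ y, f1 x y) + c2 * (∫⁻ y, f2 x y) + c2 * (∫⁻ y, f3 x y) := by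
      intro x
      have m2x : Measurable (f2 x) := m2.of_uncurry_left
      have m3x : Measurable (f3 x) := m3.of_uncurry_left
      rw [lintegral_add_right _ (m3x.const_mul _), lintegral_add_right _ (m2x.const_mul _),
        lintegral_const_mul' _ _ h1, lintegral_const_mul' _ _ h2, lintegral_const_mul' _ _ h2]
    simp_rw [e]
    rw [lintegral_add_right _ (m3.lintegral_prod_right.const_mul _),
      lintegral_add_right _ (m2.lintegral_prod_right.const_mul _),
      lintegral_const_mul' _ _ h1, lintegral_const_mul' _ _ h2, lintegral_const_mul' _ _ h2]
  rw [split _ _ _ _ _ ENNReal.ofReal_ne_top ENNReal.ofReal_ne_top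
    (by simp only [Function.uncurry_def]; fun_prop) (by simp only [Function.uncurry_def]; fun_prop),
    lintegral_lintegral_mul_sub hUm' hmm', lintegral_lintegral_mul_sub' hUm' hmm']
  have hJ' : ∫⁻ z, ENNReal.ofReal (mfker n s p z) < ⊤ := hJ
  exact ENNReal.add_lt_top.2 ⟨ENNReal.add_lt_top.2
    ⟨ENNReal.mul_lt_top ENNReal.ofReal_lt_top hgv,
      ENNReal.mul_lt_top ENNReal.ofReal_lt_top (ENNReal.mul_lt_top hUi hJ')⟩,
    ENNReal.mul_lt_top ENNReal.ofReal_lt_top (ENNReal.mul_lt_top hUi hJ')⟩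

end Caccioppoli

section CaccioppoliEstimate

variable {n : ℕ} {s p L : ℝ}

lemma fker_sub_le_of_far (H : Admissible n s p L) {r d : ℝ} (hd : 0 < d)
    (hrd : r + d ≤ 1) {x y : Rn n} (hx : x ∉ ball (0 : Rn n) (r + d)) (hx0 : x ≠ 0)
    (hy : y ∈ ball (0 : Rn n) (r + d / 2)) :
    fker n s p (x - y) ≤ ((d / 2) ^ ((n : ℝ) + s * p))⁻¹ * fker n s p x := by
  refine fker_le_of_le H (by positivity) hx0 ?_
  rw [mem_ball_zero_iff] at hy
  rw [mem_ball_zero_iff, not_lt] at hx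
  have h1 := norm_sub_norm_le x y
  have h2 : (r + d) * (1 - d / 2) ≤ ‖x‖ * (1 - d / 2) ∨ d > 2 := by
    by_cases h : d ≤ 2
    · exact Or.inl (mul_le_mul_of_nonneg_right hx (by linarith))
    · exact Or.inr (by linarith)
  rcases h2 with h2 | h2
  · have : (r + d) * (d / 2) ≤ 1 * (d / 2) := mul_le_mul_of_nonneg_right hrd (by positivity)
    linarith
  · exfalso
    have := norm_nonneg y
    linarith

lemma flux_test_ge (H : Admissible n s p L) {v : Rn n → ℝ} {x y : Rn n} {k r d a : ℝ}
    (hr : 0 < r) (hd : 0 < d) (hrd : r + d ≤ 1) (hxy : v y ≤ v x) (ha0 : 0 ≤ a)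
    (ha1 : |v x - v y| ^ (p - 1) * fker n s p (x - y) ≤ L * a)
    (ha2 : a ≤ L * (|v x - v y| ^ (p - 1) * fker n s p (x - y)))
    {B : Set (Rn n)} (hB : B = ball 0 (r + d)) :
    (ball 0 r ×ˢ (B ∩ {y | v y ≤ k})).indicator (fun z : Rn n × Rn n =>
      L⁻¹ * (truncAbove v k z.1 * (|v z.1 - v z.2| ^ (p - 1) * fker n s p (z.1 - z.2)))) (x, y) ≤
    a * (truncAbove v k x * cutoff r d x ^ p - truncAbove v k y * cutoff r d y ^ p) +
    (L * p ^ p * (2 / d) ^ p *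
      (B.indicator (fun x => truncAbove v k x ^ p) x * mfker n s p (x - y) +
        B.indicator (fun x => truncAbove v k x ^ p) y * mfker n s p (x - y)) +
      L * ((d / 2) ^ ((n : ℝ) + s * p))⁻¹ *
      (B.indicator (truncAbove v k) x *
          Bᶜ.indicator (fun y => truncAbove v k y ^ (p - 1) * fker n s p y) y +
        B.indicator (truncAbove v k) y *
          Bᶜ.indicator (fun y => truncAbove v k y ^ (p - 1) * fker n s p y) x)) := by
  have hp := H.p_pos
  have hL := H.L_pos
  set w := truncAbove v k with hw
  have hw0 : ∀ x, 0 ≤ w x := truncAbove_nonneg v k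
  set η : Rn n → ℝ := cutoff r d with hη
  have hη0 : ∀ x, 0 ≤ η x := cutoff_nonneg r d
  have hη1 : ∀ x, η x ≤ 1 := cutoff_le_one r d
  set U : Rn n → ℝ := B.indicator (fun x => w x ^ p) with hU
  set W : Rn n → ℝ := B.indicator w with hW
  set V : Rn n → ℝ := Bᶜ.indicator (fun y => w y ^ (p - 1) * fker n s p y) with hV
  have hU0 : ∀ x, 0 ≤ U x := fun x =>
    indicator_nonneg (fun x _ => Real.rpow_nonneg (hw0 x) p) x
  have hW0 : ∀ x, 0 ≤ W x := fun x => indicator_nonneg (fun x _ => hw0 x) x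
  have hV0 : ∀ x, 0 ≤ V x := fun x =>
    indicator_nonneg (fun x _ => mul_nonneg (Real.rpow_nonneg (hw0 x) _) (fker_nonneg _)) x
  have hm0 := mfker_nonneg (s := s) (p := p) (x - y)
  have hk0 := fker_nonneg (s := s) (p := p) (x - y)
  set C1 := L * p ^ p * (2 / d) ^ p with hC1
  set C2 := L * ((d / 2) ^ ((n : ℝ) + s * p))⁻¹ with hC2
  have hC10 : 0 ≤ C1 := by positivity
  have hC20 : 0 ≤ C2 := by positivity
  have e1 : 0 ≤ C1 * (U x * mfker n s p (x - y)) := mul_nonneg hC10 (mul_nonneg (hU0 _) hm0)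
  have e2 : 0 ≤ C1 * (U y * mfker n s p (x - y)) := mul_nonneg hC10 (mul_nonneg (hU0 _) hm0)
  have e3 : 0 ≤ C2 * (W x * V y) := mul_nonneg hC20 (mul_nonneg (hW0 _) (hV0 _))
  have e4 : 0 ≤ C2 * (W y * V x) := mul_nonneg hC20 (mul_nonneg (hW0 _) (hV0 _))
  have hsub : ball (0 : Rn n) (r + d / 2) ⊆ B := by
    rw [hB]; exact ball_subset_ball (by linarith)
  have hηB : ∀ z, z ∉ B → η z ^ p = 0 := fun z hz => by
    rw [hη, cutoff_eq_zero hd (fun h => hz (hsub h)), Real.zero_rpow hp.ne']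
  rw [mul_add, mul_add]
  rcases le_or_gt (v x) k with hxk | hxk
  · have hwx : w x = 0 := truncAbove_of_le hxk
    have hwy : w y = 0 := truncAbove_of_le (hxy.trans hxk)
    have : (ball 0 r ×ˢ (B ∩ {y | v y ≤ k})).indicator (fun z : Rn n × Rn n =>
        L⁻¹ * (w z.1 * (|v z.1 - v z.2| ^ (p - 1) * fker n s p (z.1 - z.2)))) (x, y) = 0 := by
      refine (indicator_apply_eq_zero).2 fun _ => ?_
      simp [hwx]
    rw [this, hwx, hwy]
    simp only [zero_mul, sub_zero, mul_zero]
    linarith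
  · rcases le_or_gt (v y) k with hyk | hyk
    · have hwy : w y = 0 := truncAbove_of_le hyk
      rw [hwy, zero_mul, sub_zero]
      have hpos : 0 ≤ a * (w x * η x ^ p) :=
        mul_nonneg ha0 (mul_nonneg (hw0 x) (Real.rpow_nonneg (hη0 x) p))
      by_cases hmem : (x, y) ∈ ball (0 : Rn n) r ×ˢ (B ∩ {y | v y ≤ k})
      · rw [indicator_of_mem hmem]
        have hx1 : η x = 1 := cutoff_eq_one hd hmem.1
        rw [hx1, Real.one_rpow, mul_one]
        have : L⁻¹ * (w x * (|v x - v y| ^ (p - 1) * fker n s p (x - y))) ≤ a * w x := by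
          have h := mul_le_mul_of_nonneg_left ha1 (mul_nonneg (inv_nonneg.2 hL.le) (hw0 x))
          have e : L⁻¹ * w x * (L * a) = a * w x := by field_simp
          rw [e] at h
          linarith
        linarith
      · rw [indicator_of_notMem hmem]
        linarith
    · have hmem : (x, y) ∉ ball (0 : Rn n) r ×ˢ (B ∩ {y | v y ≤ k}) := fun h =>
        absurd h.2.2 (not_le.2 hyk)
      rw [indicator_of_notMem hmem]
      have hwx : w x = v x - k := truncAbove_of_ge hxk.le
      have hwy : w y = v y - k := truncAbove_of_ge hyk.le
      have hdiff : |v x - v y| = w x - w y := by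
        rw [abs_of_nonneg (by linarith), hwx, hwy]; ring
      rw [hdiff] at ha2
      by_cases hx : x ∈ B
      · have hUx : U x = w x ^ p := indicator_of_mem hx _
        have h1 := flux_mul_cutoff_ge H.one_lt_p hL.le (hw0 y) (by linarith) (hη0 x) (hη0 y) ha0
          ha2 hk0
        have h2 : |η x - η y| ^ p ≤ (2 / d) ^ p * (min 1 ‖x - y‖) ^ p := by
          rw [← Real.mul_rpow (by positivity) (by positivity)]
          exact Real.rpow_le_rpow (abs_nonneg _) (abs_cutoff_sub_le hd (by linarith) x y) hp.le
        have h3 : L * p ^ p * (w x ^ p * |η x - η y| ^ p * fker n s p (x - y)) ≤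
            C1 * (U x * mfker n s p (x - y)) := by
          have hwp : 0 ≤ w x ^ p := Real.rpow_nonneg (hw0 x) p
          calc L * p ^ p * (w x ^ p * |η x - η y| ^ p * fker n s p (x - y))
              ≤ L * p ^ p * (w x ^ p * ((2 / d) ^ p * (min 1 ‖x - y‖) ^ p) *
                fker n s p (x - y)) := by gcongr
            _ = _ := by rw [hUx, hC1, mfker]; ring
        linarith
      · rw [hηB x hx]
        by_cases hy : y ∈ ball (0 : Rn n) (r + d / 2)
        · have hx0 : x ≠ 0 := by
            rintro rfl
            exact hx (by rw [hB]; exact mem_ball_self (by linarith))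
          have hWy : W y = w y := indicator_of_mem (hsub hy) _
          have hVx : V x = w x ^ (p - 1) * fker n s p x := indicator_of_mem hx _
          have h1 := fker_sub_le_of_far H hd hrd (hB ▸ hx) hx0 hy
          have h2 : (w x - w y) ^ (p - 1) ≤ w x ^ (p - 1) :=
            Real.rpow_le_rpow (by linarith) (by linarith [hw0 y]) H.p_sub_pos.le
          have hw1 : 0 ≤ w x ^ (p - 1) := Real.rpow_nonneg (hw0 x) _
          have h3 : a ≤ L * (w x ^ (p - 1) *
              (((d / 2) ^ ((n : ℝ) + s * p))⁻¹ * fker n s p x)) := by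
            refine ha2.trans ?_
            gcongr
          have h4 : w y * η y ^ p ≤ w y :=
            mul_le_of_le_one_right (hw0 y) (Real.rpow_le_one (hη0 y) (hη1 y) hp.le)
          have h5 : a * (w y * η y ^ p) ≤ C2 * (W y * V x) := by
            calc a * (w y * η y ^ p) ≤ a * w y := mul_le_mul_of_nonneg_left h4 ha0
              _ ≤ L * (w x ^ (p - 1) *
              (((d / 2) ^ ((n : ℝ) + s * p))⁻¹ * fker n s p x)) * w y :=
                mul_le_mul_of_nonneg_right h3 (hw0 y)
              _ = _ := by rw [hWy, hVx, hC2]; ring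
          linarith
        · have : η y ^ p = 0 := by
            rw [hη, cutoff_eq_zero hd hy, Real.zero_rpow hp.ne']
          rw [this]
          simp only [mul_zero, sub_zero]
          linarith

end CaccioppoliEstimate

section CaccioppoliIntegrated

variable {n : ℕ} {s p L : ℝ}

lemma integrable_truncAbove_mul_cutoff (H : Admissible n s p L) {v : Rn n → ℝ}
    (hv : Measurable v)
    (hloc : ∀ r : ℝ, ∫⁻ x in ball (0 : Rn n) r, ENNReal.ofReal (|v x| ^ p) < ⊤)
    (k : ℝ) {r d : ℝ} (hd : 0 < d) :
    Integrable (fun x => truncAbove v k x * cutoff r d x ^ p) := by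
  have hp := H.p_pos
  have hwm := measurable_truncAbove hv k
  refine ⟨(hwm.mul ((continuous_cutoff r d).measurable.pow_const p)).aestronglyMeasurable, ?_⟩
  have hb : ∀ x, ‖truncAbove v k x * cutoff r d x ^ p‖ₑ ≤
      (ball (0 : Rn n) (r + d / 2)).indicator
        (fun x => 1 + ENNReal.ofReal (truncAbove v k x ^ p)) x := by
    intro x
    have hw0 := truncAbove_nonneg v k x
    by_cases hx : x ∈ ball (0 : Rn n) (r + d / 2)
    · rw [indicator_of_mem hx, Real.enorm_eq_ofReal
        (mul_nonneg hw0 (Real.rpow_nonneg (cutoff_nonneg _ _ _) _)), ← ENNReal.ofReal_one,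
        ← ENNReal.ofReal_add zero_le_one (by positivity)]
      refine ENNReal.ofReal_le_ofReal ?_
      have h1 : truncAbove v k x * cutoff r d x ^ p ≤ truncAbove v k x :=
        mul_le_of_le_one_right hw0
          (Real.rpow_le_one (cutoff_nonneg _ _ _) (cutoff_le_one _ _ _) hp.le)
      rcases le_total (truncAbove v k x) 1 with h | h
      · linarith [Real.rpow_nonneg hw0 p]
      · have := Real.rpow_le_rpow_of_exponent_le h H.one_lt_p.le
        rw [Real.rpow_one] at this
        linarith
    · rw [cutoff_eq_zero hd hx, Real.zero_rpow hp.ne']; simp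
  refine (lintegral_mono hb).trans_lt ?_
  rw [lintegral_indicator measurableSet_ball, lintegral_add_left measurable_const]
  refine ENNReal.add_lt_top.2 ⟨?_, lintegral_truncAbove_rpow_lt_top H hloc k _⟩
  simpa using measure_ball_lt_top

theorem caccioppoli (H : Admissible n s p L) : ∃ C : ℝ, 0 < C ∧ ∀ v : Rn n → ℝ,
    IsSol n s p L (ball 0 1) v → ∀ k r d : ℝ, 0 < r → 0 < d → r + d ≤ 1 →
    ∫⁻ x in ball 0 r, ∫⁻ y in ball 0 (r + d) ∩ {y | v y ≤ k},
      ENNReal.ofReal (truncAbove v k x * (|v x - v y| ^ (p - 1) * fker n s p (x - y))) ≤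
    ENNReal.ofReal (C * (d ^ ((n : ℝ) + s * p + p))⁻¹) *
      ((∫⁻ x in ball 0 (r + d), ENNReal.ofReal (truncAbove v k x ^ p)) +
        (∫⁻ x in ball 0 (r + d), ENNReal.ofReal (truncAbove v k x)) *
          ∫⁻ y in (ball 0 (r + d))ᶜ, ENNReal.ofReal (truncAbove v k y ^ (p - 1) * fker n s p y)) := by
  have hp := H.p_pos
  have hL := H.L_pos
  have hD := H.exponent_pos
  set J := ∫⁻ z, ENNReal.ofReal (mfker n s p z) with hJdef
  have hJ : J < ⊤ := lintegral_fker_near_lt_top H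
  set D := (n : ℝ) + s * p with hDdef
  refine ⟨L * (2 * (L * p ^ p * 2 ^ p) * J.toReal + 2 * (L * 2 ^ D)), by positivity, ?_⟩
  intro v hv k r d hr hd hrd
  obtain ⟨a, ham, ha1, ha2, hatest⟩ := hv.flux
  have hd1 : d ≤ 1 := by linarith
  set w := truncAbove v k with hw
  have hw0 : ∀ x, 0 ≤ w x := truncAbove_nonneg v k
  have hwm : Measurable w := measurable_truncAbove hv.meas k
  set η : Rn n → ℝ := cutoff r d with hη
  have hηm : Measurable η := (continuous_cutoff r d).measurable
  set B := ball (0 : Rn n) (r + d) with hB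
  have hBm : MeasurableSet B := measurableSet_ball
  have hkm := measurable_fker (n := n) (s := s) (p := p)
  have hmm := measurable_mfker (n := n) (s := s) (p := p)
  set φ : Rn n → ℝ := fun x => w x * η x ^ p with hφ
  have hφm : Measurable φ := by simp only [hφ]; fun_prop
  have hgφ : ∫⁻ x, ∫⁻ y, ENNReal.ofReal (|φ x - φ y| ^ p * fker n s p (x - y)) < ⊤ :=
    gagliardo_cutoff_lt_top H hv.meas hv.locLp hv.gag k hd hd1
  have hφi : Integrable φ := integrable_truncAbove_mul_cutoff H hv.meas hv.locLp k hd
  have hzero := integral_flux_eq_zero H hv.meas hφm ham hv.gag hgφ ha2 hatest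
    (b := r + d / 2) (by linarith) hφi (fun x hx => by
      have : x ∉ ball (0 : Rn n) (r + d / 2) := fun h => hx (ball_subset_closedBall h)
      simp only [hφ, hη]
      rw [cutoff_eq_zero hd this, Real.zero_rpow hp.ne', mul_zero])
  have hint := integrable_flux H hv.meas hφm ham hv.gag hgφ ha2
  set U : Rn n → ℝ := B.indicator (fun x => w x ^ p) with hU
  set W : Rn n → ℝ := B.indicator w with hW
  set V : Rn n → ℝ := Bᶜ.indicator (fun y => w y ^ (p - 1) * fker n s p y) with hV
  have hU0 : ∀ x, 0 ≤ U x := fun x =>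
    indicator_nonneg (fun x _ => Real.rpow_nonneg (hw0 x) p) x
  have hW0 : ∀ x, 0 ≤ W x := fun x => indicator_nonneg (fun x _ => hw0 x) x
  have hV0 : ∀ x, 0 ≤ V x := fun x =>
    indicator_nonneg (fun x _ => mul_nonneg (Real.rpow_nonneg (hw0 x) _) (fker_nonneg _)) x
  have hUm : Measurable U := (hwm.pow_const p).indicator hBm
  have hWm : Measurable W := hwm.indicator hBm
  have hVm : Measurable V := ((hwm.pow_const _).mul hkm).indicator hBm.compl
  set C1 := L * p ^ p * (2 / d) ^ p with hC1
  set C2 := L * ((d / 2) ^ D)⁻¹ with hC2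
  have hC10 : 0 ≤ C1 := by positivity
  have hC20 : 0 ≤ C2 := by positivity
  set S := B ∩ {y | v y ≤ k} with hS
  have hSm : MeasurableSet S := hBm.inter (measurableSet_le hv.meas measurable_const)
  set g : Rn n × Rn n → ℝ := fun z =>
    L⁻¹ * (w z.1 * (|v z.1 - v z.2| ^ (p - 1) * fker n s p (z.1 - z.2))) with hg
  have hg0 : ∀ z, 0 ≤ g z := fun z => by
    have h1 := hw0 z.1
    have h2 := fker_nonneg (s := s) (p := p) (z.1 - z.2)
    simp only [hg]; positivity
  have hgm : Measurable g := by
    have := hv.meas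
    simp only [hg]; fun_prop
  set E : Rn n × Rn n → ℝ := fun z =>
    C1 * (U z.1 * mfker n s p (z.1 - z.2) + U z.2 * mfker n s p (z.1 - z.2)) +
      C2 * (W z.1 * V z.2 + W z.2 * V z.1) with hE
  have hEm : Measurable E := by simp only [hE]; fun_prop
  have hE0 : ∀ z, 0 ≤ E z := fun z => by
    have h1 := hU0 z.1
    have h2 := hU0 z.2
    have h3 := hW0 z.1
    have h4 := hW0 z.2
    have h5 := hV0 z.1
    have h6 := hV0 z.2
    have h7 := mfker_nonneg (s := s) (p := p) (z.1 - z.2)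
    simp only [hE]; positivity
  have hdir : ∀ x y, v y ≤ v x → ∀ b : ℝ,
      |v x - v y| ^ p * fker n s p (x - y) ≤ L * (b * (v x - v y)) →
      |b| ≤ L * (|v x - v y| ^ (p - 1) * fker n s p (x - y)) →
      (ball 0 r ×ˢ S).indicator g (x, y) ≤ b * (φ x - φ y) + E (x, y) := by
    intro x y hxy b hb1 hb2
    have hk0 := fker_nonneg (s := s) (p := p) (x - y)
    have hb0 : 0 ≤ b ∧ |v x - v y| ^ (p - 1) * fker n s p (x - y) ≤ L * b := by
      rcases hxy.eq_or_lt with h | h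
      · have e : |v x - v y| ^ (p - 1) = 0 := by
          rw [h, sub_self, abs_zero, Real.zero_rpow H.p_sub_pos.ne']
        rw [e] at hb2 ⊢
        have : b = 0 := abs_eq_zero.1 (le_antisymm (by simpa using hb2) (abs_nonneg _))
        rw [this]; simp
      · have hpos : 0 < v x - v y := by linarith
        have e : |v x - v y| ^ p = |v x - v y| ^ (p - 1) * (v x - v y) := by
          rw [abs_of_pos hpos, ← Real.rpow_add_one' hpos.le (by linarith)]; congr 1; ring
        rw [e] at hb1
        have h2 : |v x - v y| ^ (p - 1) * fker n s p (x - y) ≤ L * b := by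
          refine le_of_mul_le_mul_right ?_ hpos
          linarith
        refine ⟨?_, h2⟩
        have : 0 ≤ L * b := le_trans (by positivity) h2
        exact nonneg_of_mul_nonneg_right this hL
    exact flux_test_ge H hr hd hrd hxy hb0.1 hb0.2 ((le_abs_self b).trans hb2) rfl
  have hpt : ∀ z : Rn n × Rn n, (ball 0 r ×ˢ S).indicator g z ≤
      a z.1 z.2 * (φ z.1 - φ z.2) + E z := by
    rintro ⟨x, y⟩
    rcases le_total (v y) (v x) with h | h
    · exact hdir x y h _ (ha1 x y) (ha2 x y)
    · have h1 := hdir y x h (-a x y) (by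
          have := ha1 x y
          rw [abs_sub_comm, fker_sub_comm] at this
          linarith) (by
          have := ha2 x y
          rw [abs_sub_comm (v x), fker_sub_comm] at this
          rwa [abs_neg])
      have h2 : E (y, x) = E (x, y) := by
        simp only [hE, mfker_sub_comm y x]; ring
      have h3 : 0 ≤ (ball 0 r ×ˢ S).indicator g (y, x) := indicator_nonneg (fun z _ => hg0 z) _
      have h4 : (ball 0 r ×ˢ S).indicator g (x, y) = 0 := by
        refine indicator_apply_eq_zero.2 fun hmem => ?_
        have hy : v y ≤ k := hmem.2.2
        have : w x = 0 := truncAbove_of_le (h.trans hy)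
        simp [hg, this]
      rw [h4]
      rw [h2] at h1
      simp only
      linarith
  have key := lintegral_le_of_integral_eq_zero hint hzero hE0 hEm
    (fun z => indicator_nonneg (fun z _ => hg0 z) z) hpt
  have hleft : ∫⁻ z, ENNReal.ofReal ((ball 0 r ×ˢ S).indicator g z) = ENNReal.ofReal L⁻¹ *
      ∫⁻ x in ball 0 r, ∫⁻ y in S,
      ENNReal.ofReal (w x * (|v x - v y| ^ (p - 1) * fker n s p (x - y))) := by
    have e : ∀ z, ENNReal.ofReal ((ball 0 r ×ˢ S).indicator g z) =
        (ball 0 r ×ˢ S).indicator (fun z => ENNReal.ofReal (g z)) z := fun z => by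
      by_cases hz : z ∈ ball (0 : Rn n) r ×ˢ S
      · rw [indicator_of_mem hz, indicator_of_mem hz]
      · rw [indicator_of_notMem hz, indicator_of_notMem hz, ENNReal.ofReal_zero]
    simp_rw [e]
    rw [lintegral_indicator (measurableSet_ball.prod hSm), Measure.volume_eq_prod,
      ← Measure.prod_restrict, lintegral_prod _ hgm.ennreal_ofReal.aemeasurable]
    simp only [hg]
    simp_rw [ENNReal.ofReal_mul (inv_nonneg.2 hL.le),
      lintegral_const_mul' _ _ ENNReal.ofReal_ne_top]
  have hUm' := hUm.ennreal_ofReal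
  have hWm' := hWm.ennreal_ofReal
  have hVm' := hVm.ennreal_ofReal
  have hmm' := hmm.ennreal_ofReal
  have hright : ∫⁻ z, ENNReal.ofReal (E z) =
      ENNReal.ofReal C1 * (2 * ((∫⁻ x, ENNReal.ofReal (U x)) * J)) +
      ENNReal.ofReal C2 * (2 * ((∫⁻ x, ENNReal.ofReal (W x)) * ∫⁻ x, ENNReal.ofReal (V x))) := by
    have e : ∀ z : Rn n × Rn n, ENNReal.ofReal (E z) =
        ENNReal.ofReal C1 * (ENNReal.ofReal (U z.1) * ENNReal.ofReal (mfker n s p (z.1 - z.2)) +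
          ENNReal.ofReal (U z.2) * ENNReal.ofReal (mfker n s p (z.1 - z.2))) +
        ENNReal.ofReal C2 * (ENNReal.ofReal (W z.1) * ENNReal.ofReal (V z.2) +
          ENNReal.ofReal (V z.1) * ENNReal.ofReal (W z.2)) := by
      intro z
      have h1 := hU0 z.1
      have h2 := hU0 z.2
      have h3 := hW0 z.1
      have h4 := hW0 z.2
      have h5 := hV0 z.1
      have h6 := hV0 z.2
      have h7 := mfker_nonneg (s := s) (p := p) (z.1 - z.2)
      rw [← ENNReal.ofReal_mul h1, ← ENNReal.ofReal_mul h2, ← ENNReal.ofReal_mul h3,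
        ← ENNReal.ofReal_mul h5, ← ENNReal.ofReal_add (by positivity) (by positivity),
        ← ENNReal.ofReal_add (by positivity) (by positivity), ← ENNReal.ofReal_mul hC10,
        ← ENNReal.ofReal_mul hC20, ← ENNReal.ofReal_add (by positivity) (by positivity)]
      simp only [hE, mul_comm (V z.1)]
    simp_rw [e]
    rw [Measure.volume_eq_prod, lintegral_prod _ (by fun_prop)]
    have e2 : ∀ x, ∫⁻ y, (ENNReal.ofReal C1 *
        (ENNReal.ofReal (U x) * ENNReal.ofReal (mfker n s p (x - y)) +
          ENNReal.ofReal (U y) * ENNReal.ofReal (mfker n s p (x - y))) +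
        ENNReal.ofReal C2 * (ENNReal.ofReal (W x) * ENNReal.ofReal (V y) +
          ENNReal.ofReal (V x) * ENNReal.ofReal (W y))) =
        ENNReal.ofReal C1 * ((∫⁻ y, ENNReal.ofReal (U x) * ENNReal.ofReal (mfker n s p (x - y))) +
          ∫⁻ y, ENNReal.ofReal (U y) * ENNReal.ofReal (mfker n s p (x - y))) +
        ENNReal.ofReal C2 * ((∫⁻ y, ENNReal.ofReal (W x) * ENNReal.ofReal (V y)) +
          ∫⁻ y, ENNReal.ofReal (V x) * ENNReal.ofReal (W y)) := by
      intro x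
      rw [lintegral_add_left (by fun_prop), lintegral_const_mul' _ _ ENNReal.ofReal_ne_top,
        lintegral_const_mul' _ _ ENNReal.ofReal_ne_top, lintegral_add_left (by fun_prop),
        lintegral_add_left (by fun_prop)]
    have m1 : Measurable fun x => ∫⁻ y, ENNReal.ofReal (U x) *
        ENNReal.ofReal (mfker n s p (x - y)) :=
      Measurable.lintegral_prod_right' (f := fun z : Rn n × Rn n => ENNReal.ofReal (U z.1) *
        ENNReal.ofReal (mfker n s p (z.1 - z.2))) (by fun_prop)
    have m2 : Measurable fun x => ∫⁻ y, ENNReal.ofReal (U y) *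
        ENNReal.ofReal (mfker n s p (x - y)) :=
      Measurable.lintegral_prod_right' (f := fun z : Rn n × Rn n => ENNReal.ofReal (U z.2) *
        ENNReal.ofReal (mfker n s p (z.1 - z.2))) (by fun_prop)
    have m3 : Measurable fun x => ∫⁻ y, ENNReal.ofReal (W x) * ENNReal.ofReal (V y) :=
      Measurable.lintegral_prod_right' (f := fun z : Rn n × Rn n => ENNReal.ofReal (W z.1) *
        ENNReal.ofReal (V z.2)) (by fun_prop)
    simp_rw [e2]
    rw [lintegral_add_left (by fun_prop), lintegral_const_mul' _ _ ENNReal.ofReal_ne_top,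
      lintegral_const_mul' _ _ ENNReal.ofReal_ne_top, lintegral_add_left m1, lintegral_add_left m3,
      lintegral_lintegral_mul_sub hUm' hmm', lintegral_lintegral_mul_sub' hUm' hmm',
      lintegral_lintegral_prod hWm' hVm', lintegral_lintegral_prod hVm' hWm', ← two_mul,
      mul_comm (∫⁻ x, ENNReal.ofReal (V x)), ← two_mul]
  rw [hleft, hright] at key
  have indU : ∫⁻ x, ENNReal.ofReal (U x) = ∫⁻ x in B, ENNReal.ofReal (w x ^ p) := by
    rw [← lintegral_indicator hBm]
    refine lintegral_congr fun x => ?_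
    by_cases hx : x ∈ B <;> simp [hU, hx]
  have indW : ∫⁻ x, ENNReal.ofReal (W x) = ∫⁻ x in B, ENNReal.ofReal (w x) := by
    rw [← lintegral_indicator hBm]
    refine lintegral_congr fun x => ?_
    by_cases hx : x ∈ B <;> simp [hW, hx]
  have indV : ∫⁻ x, ENNReal.ofReal (V x) =
      ∫⁻ x in Bᶜ, ENNReal.ofReal (w x ^ (p - 1) * fker n s p x) := by
    rw [← lintegral_indicator hBm.compl]
    refine lintegral_congr fun x => ?_
    by_cases hx : x ∈ B <;> simp [hV, hx]
  rw [indU, indW, indV] at key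
  set X := ∫⁻ x in B, ENNReal.ofReal (w x ^ p)
  set Y := (∫⁻ x in B, ENNReal.ofReal (w x)) *
    ∫⁻ x in Bᶜ, ENNReal.ofReal (w x ^ (p - 1) * fker n s p x)
  set Q := ∫⁻ x in ball 0 r, ∫⁻ y in S,
      ENNReal.ofReal (w x * (|v x - v y| ^ (p - 1) * fker n s p (x - y)))
  have hQ : Q = ENNReal.ofReal L * (ENNReal.ofReal L⁻¹ * Q) := by
    rw [← mul_assoc, ← ENNReal.ofReal_mul hL.le, mul_inv_cancel₀ hL.ne', ENNReal.ofReal_one,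
      one_mul]
  rw [hQ]
  have hdN : 0 < d ^ (D + p) := by positivity
  have hdp : (d ^ p)⁻¹ ≤ (d ^ (D + p))⁻¹ :=
    inv_anti₀ hdN (Real.rpow_le_rpow_of_exponent_ge hd hd1 (by linarith))
  have hdD : (d ^ D)⁻¹ ≤ (d ^ (D + p))⁻¹ :=
    inv_anti₀ hdN (Real.rpow_le_rpow_of_exponent_ge hd hd1 (by linarith))
  have hJr : J = ENNReal.ofReal J.toReal := (ENNReal.ofReal_toReal hJ.ne).symm
  have hC1' : C1 ≤ L * p ^ p * 2 ^ p * (d ^ (D + p))⁻¹ := by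
    rw [hC1, Real.div_rpow zero_le_two hd.le, div_eq_mul_inv, ← mul_assoc]
    gcongr
  have hC2' : C2 ≤ L * 2 ^ D * (d ^ (D + p))⁻¹ := by
    rw [hC2, Real.div_rpow hd.le zero_le_two, inv_div, div_eq_mul_inv, ← mul_assoc]
    gcongr
  have two : (2 : ℝ≥0∞) = ENNReal.ofReal 2 := by simp
  clear_value C1 C2
  calc ENNReal.ofReal L * (ENNReal.ofReal L⁻¹ * Q)
      ≤ ENNReal.ofReal L * (ENNReal.ofReal C1 * (2 * (X * J)) + ENNReal.ofReal C2 * (2 * Y)) := by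
        gcongr
    _ = ENNReal.ofReal (L * (C1 * (2 * J.toReal))) * X + ENNReal.ofReal (L * (C2 * 2)) * Y := by
        rw [ENNReal.ofReal_mul hL.le, ENNReal.ofReal_mul hC10, ENNReal.ofReal_mul zero_le_two,
          ENNReal.ofReal_mul hL.le, ENNReal.ofReal_mul hC20, ← two, ← hJr]
        ring
    _ ≤ _ := by
        rw [mul_add (ENNReal.ofReal _) X Y]
        have t1 : 0 ≤ L * (2 * (L * 2 ^ D)) * (d ^ (D + p))⁻¹ := by positivity
        have t2 : 0 ≤ L * (2 * (L * p ^ p * 2 ^ p) * J.toReal) * (d ^ (D + p))⁻¹ := by positivity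
        refine add_le_add (mul_le_mul_left (ENNReal.ofReal_le_ofReal ?_) _)
          (mul_le_mul_left (ENNReal.ofReal_le_ofReal ?_) _)
        · calc L * (C1 * (2 * J.toReal)) ≤
              L * (L * p ^ p * 2 ^ p * (d ^ (D + p))⁻¹ * (2 * J.toReal)) := by gcongr
            _ ≤ _ := by linarith
        · calc L * (C2 * 2) ≤ L * (L * 2 ^ D * (d ^ (D + p))⁻¹ * 2) := by gcongr
            _ ≤ _ := by linarith

end CaccioppoliIntegrated

section LevelSets

variable {n : ℕ} {s p L : ℝ}

/-- If the superlevel set occupies at most half of `ball x R`, the integral of the kernel over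
the sublevel set is bounded below. -/
lemma le_setLIntegral_sublevel (H : Admissible n s p L) {v : Rn n → ℝ} (hv : Measurable v)
    {k r d m R : ℝ} (hm : 0 < m) (hRd : R ≤ d) {x : Rn n} (hx : x ∈ ball (0 : Rn n) r)
    (hmeas : volume (ball (0 : Rn n) (r + d) ∩ {y | k < v y}) ≤ ENNReal.ofReal m)
    (hR : volume (ball x R) = ENNReal.ofReal (2 * m)) :
    ENNReal.ofReal ((R ^ ((n : ℝ) + s * p))⁻¹ * m) * ENNReal.ofReal (truncAbove v k x ^ p) ≤
      ∫⁻ y in ball 0 (r + d) ∩ {y | v y ≤ k},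
        ENNReal.ofReal (truncAbove v k x * (|v x - v y| ^ (p - 1) * fker n s p (x - y))) := by
  rcases le_or_gt (v x) k with hxk | hxk
  · rw [truncAbove_of_le hxk, Real.zero_rpow H.p_pos.ne', ENNReal.ofReal_zero, mul_zero]
    exact zero_le
  set w := truncAbove v k
  have hw0 : 0 ≤ w x := truncAbove_nonneg v k x
  set S := ball (0 : Rn n) (r + d) ∩ {y | v y ≤ k}
  have hsub : ball x R ⊆ ball (0 : Rn n) (r + d) := ball_subset_ball' (by
    rw [mem_ball] at hx; linarith)
  have hvol : ENNReal.ofReal m ≤ volume (ball x R ∩ S) := by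
    have h1 : volume (ball x R) ≤ volume (ball x R ∩ S) +
        volume (ball (0 : Rn n) (r + d) ∩ {y | k < v y}) := by
      refine (measure_mono fun y hy => ?_).trans (measure_union_le _ _)
      rcases le_or_gt (v y) k with h | h
      · exact Or.inl ⟨hy, hsub hy, h⟩
      · exact Or.inr ⟨hsub hy, h⟩
    rw [hR, two_mul, ENNReal.ofReal_add hm.le hm.le] at h1
    exact (ENNReal.add_le_add_iff_right ENNReal.ofReal_ne_top).1
      (h1.trans (add_le_add_right hmeas _))
  have hmS : MeasurableSet (ball x R ∩ S) :=
    measurableSet_ball.inter (measurableSet_ball.inter (measurableSet_le hv measurable_const))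
  have hR0 : 0 < R := by
    by_contra h
    rw [ball_eq_empty.2 (not_lt.1 h), measure_empty] at hR
    have := ENNReal.ofReal_pos.2 (by positivity : 0 < 2 * m)
    exact this.ne hR
  calc ENNReal.ofReal ((R ^ ((n : ℝ) + s * p))⁻¹ * m) * ENNReal.ofReal (w x ^ p)
      = ENNReal.ofReal ((R ^ ((n : ℝ) + s * p))⁻¹ * w x ^ p) * ENNReal.ofReal m := by
        rw [← ENNReal.ofReal_mul (by positivity), ← ENNReal.ofReal_mul (by positivity)]
        congr 1; ring
    _ ≤ ENNReal.ofReal ((R ^ ((n : ℝ) + s * p))⁻¹ * w x ^ p) * volume (ball x R ∩ S) := by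
        gcongr
    _ = ∫⁻ _ in ball x R ∩ S, ENNReal.ofReal ((R ^ ((n : ℝ) + s * p))⁻¹ * w x ^ p) := by
        rw [lintegral_const, Measure.restrict_apply_univ]
    _ ≤ ∫⁻ y in ball x R ∩ S, ENNReal.ofReal
          (w x * (|v x - v y| ^ (p - 1) * fker n s p (x - y))) := by
        refine setLIntegral_mono' hmS fun y hy => ENNReal.ofReal_le_ofReal ?_
        have hyk : v y ≤ k := hy.2.2
        have hne : x - y ≠ 0 := by
          rw [sub_ne_zero]; rintro rfl; exact absurd hxk (not_lt.2 hyk)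
        have h2 : (R ^ ((n : ℝ) + s * p))⁻¹ ≤ fker n s p (x - y) :=
          rpow_inv_le_fker H hne (by
            have := hy.1; rw [mem_ball, dist_comm, dist_eq_norm] at this; exact this.le)
        have h3 : w x ≤ |v x - v y| := by
          have : w x = v x - k := truncAbove_of_ge hxk.le
          rw [this]; exact (by linarith : v x - k ≤ v x - v y).trans (le_abs_self _)
        have h4 : w x ^ p = w x * w x ^ (p - 1) := by
          rw [← Real.rpow_one_add' hw0 (by linarith [H.p_pos])]; congr 1; ring
        rw [h4]
        calc (R ^ ((n : ℝ) + s * p))⁻¹ * (w x * w x ^ (p - 1))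
            = w x * (w x ^ (p - 1) * (R ^ ((n : ℝ) + s * p))⁻¹) := by ring
          _ ≤ _ := by
            gcongr
            exact H.p_sub_pos.le
    _ ≤ _ := lintegral_mono_set inter_subset_right

theorem lintegral_truncAbove_le (H : Admissible n s p L) : ∃ C : ℝ, 0 < C ∧ ∀ v : Rn n → ℝ,
    IsSol n s p L (ball 0 1) v → ∀ k r d m T : ℝ, 0 < r → 0 < d → r + d ≤ 1 → 0 < m →
    volume (ball (0 : Rn n) (r + d) ∩ {y | k < v y}) ≤ ENNReal.ofReal m →
    ∫⁻ y in (ball 0 (r + d))ᶜ, ENNReal.ofReal (truncAbove v k y ^ (p - 1) * fker n s p y) ≤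
      ENNReal.ofReal T →
    ∫⁻ x in ball 0 r, ENNReal.ofReal (truncAbove v k x ^ p) ≤
      ENNReal.ofReal (C * (d ^ ((n : ℝ) + s * p + p))⁻¹ * m ^ (s * p / n)) *
        ((∫⁻ x in ball 0 (r + d), ENNReal.ofReal (truncAbove v k x ^ p)) +
          ENNReal.ofReal T * ∫⁻ x in ball 0 (r + d), ENNReal.ofReal (truncAbove v k x)) := by
  obtain ⟨C, hC, hcac⟩ := caccioppoli H
  have := H.nontrivial
  set ω := (volume (ball (0 : Rn n) 1)).toReal with hω
  have hω0 : 0 < ω := ENNReal.toReal_pos (measure_ball_pos _ _ one_pos).ne' measure_ball_lt_top.ne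
  have hn := H.dim_pos
  have hsp := H.sp_pos
  set θ := s * p / n with hθ
  have hθ0 : 0 < θ := div_pos hsp hn
  have hDn : (n : ℝ) + s * p = n * (1 + θ) := by rw [hθ]; field_simp
  refine ⟨max (C * (2 / ω) ^ (1 + θ)) ((ω / 2) ^ θ)⁻¹, lt_max_of_lt_left (by positivity), ?_⟩
  intro v hv k r d m T hr hd hrd hm hmeas hT
  set C' := max (C * (2 / ω) ^ (1 + θ)) ((ω / 2) ^ θ)⁻¹ with hC'
  have hC'0 : 0 < C' := lt_max_of_lt_left (by positivity)
  have hd1 : d ≤ 1 := by linarith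
  set Z := ∫⁻ x in ball 0 (r + d), ENNReal.ofReal (truncAbove v k x ^ p)
  set M := ∫⁻ x in ball 0 (r + d), ENNReal.ofReal (truncAbove v k x)
  set R := (2 * m / ω) ^ ((n : ℝ)⁻¹) with hRdef
  have hbase : 0 < 2 * m / ω := by positivity
  have hR0 : 0 < R := Real.rpow_pos_of_pos hbase _
  have hRn : R ^ (n : ℝ) = 2 * m / ω := by
    rw [hRdef, ← Real.rpow_mul hbase.le, inv_mul_cancel₀ hn.ne', Real.rpow_one]
  rcases lt_or_ge d R with hdR | hRd
  · have h1 : d ^ (n : ℝ) ≤ 2 * m / ω := by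
      rw [← hRn]; exact Real.rpow_le_rpow hd.le hdR.le hn.le
    have h2 : ω / 2 * d ^ (n : ℝ) ≤ m := by
      calc ω / 2 * d ^ (n : ℝ) ≤ ω / 2 * (2 * m / ω) := by gcongr
        _ = m := by field_simp
    have h3 : (ω / 2) ^ θ * d ^ (s * p) ≤ m ^ θ := by
      have : d ^ (s * p) = (d ^ (n : ℝ)) ^ θ := by
        rw [← Real.rpow_mul hd.le, hθ]; congr 1; field_simp
      rw [this, ← Real.mul_rpow (by positivity) (by positivity)]
      exact Real.rpow_le_rpow (by positivity) h2 hθ0.le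
    have h4 : 1 ≤ C' * (d ^ ((n : ℝ) + s * p + p))⁻¹ * m ^ θ := by
      calc (1 : ℝ) = ((ω / 2) ^ θ)⁻¹ * 1 * (ω / 2) ^ θ := by field_simp
        _ ≤ C' * ((d ^ ((n : ℝ) + s * p + p))⁻¹ * d ^ (s * p)) * (ω / 2) ^ θ := by
          gcongr
          · exact le_max_right _ _
          · rw [inv_mul_eq_div, one_le_div (by positivity)]
            exact Real.rpow_le_rpow_of_exponent_ge hd hd1 (by linarith [H.p_pos])
        _ = C' * (d ^ ((n : ℝ) + s * p + p))⁻¹ * ((ω / 2) ^ θ * d ^ (s * p)) := by ring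
        _ ≤ _ := by gcongr
    calc _ ≤ Z := lintegral_mono_set (ball_subset_ball (by linarith))
      _ ≤ 1 * (Z + ENNReal.ofReal T * M) := by rw [one_mul]; exact le_self_add
      _ ≤ _ := by
        gcongr
        rw [← ENNReal.ofReal_one]; exact ENNReal.ofReal_le_ofReal h4
  · set I := ∫⁻ x in ball 0 r, ENNReal.ofReal (truncAbove v k x ^ p)
    have hRvol : ∀ x : Rn n, volume (ball x R) = ENNReal.ofReal (2 * m) := by
      intro x
      rw [Measure.addHaar_ball volume x hR0.le, finrank_euclideanSpace, Fintype.card_fin,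
        ← Real.rpow_natCast, hRn, ← ENNReal.ofReal_toReal measure_ball_lt_top.ne, ← hω,
        ← ENNReal.ofReal_mul hbase.le, div_mul_cancel₀ _ hω0.ne']
    set b := (R ^ ((n : ℝ) + s * p))⁻¹ * m with hb
    have hb0 : 0 < b := by positivity
    have h1 : ENNReal.ofReal b * I ≤ ENNReal.ofReal (C * (d ^ ((n : ℝ) + s * p + p))⁻¹) *
        (Z + ENNReal.ofReal T * M) := by
      rw [← lintegral_const_mul' _ _ ENNReal.ofReal_ne_top]
      refine (setLIntegral_mono' measurableSet_ball fun x hx =>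
        le_setLIntegral_sublevel H hv.meas hm hRd hx hmeas (hRvol x)).trans
        ((hcac v hv k r d hr hd hrd).trans ?_)
      rw [mul_comm (ENNReal.ofReal T)]
      gcongr
    have hb2 : b⁻¹ = (2 / ω) ^ (1 + θ) * m ^ θ := by
      rw [hb, hDn, Real.rpow_mul hR0.le, hRn, mul_inv, inv_inv, mul_div_right_comm,
        Real.mul_rpow (by positivity) hm.le, Real.rpow_one_add' hm.le (by positivity)]
      field_simp
    calc I = ENNReal.ofReal b⁻¹ * (ENNReal.ofReal b * I) := by
          rw [← mul_assoc, ← ENNReal.ofReal_mul (by positivity), inv_mul_cancel₀ hb0.ne',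
            ENNReal.ofReal_one, one_mul]
      _ ≤ ENNReal.ofReal b⁻¹ * (ENNReal.ofReal (C * (d ^ ((n : ℝ) + s * p + p))⁻¹) *
        (Z + ENNReal.ofReal T * M)) := by gcongr
      _ = ENNReal.ofReal (C * (2 / ω) ^ (1 + θ) * (d ^ ((n : ℝ) + s * p + p))⁻¹ * m ^ θ) *
          (Z + ENNReal.ofReal T * M) := by
          rw [← mul_assoc, ← ENNReal.ofReal_mul (by positivity), hb2]
          congr 2; ring
      _ ≤ _ := by
          gcongr
          exact le_max_left _ _

end LevelSets

section LocalBound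

variable {n : ℕ} {s p L : ℝ}

lemma truncAbove_anti (v : Rn n → ℝ) {h k : ℝ} (hk : h ≤ k) (x : Rn n) :
    truncAbove v k x ≤ truncAbove v h x :=
  max_le_max (by linarith) le_rfl

lemma volume_superlevel_le {v : Rn n → ℝ} (hv : Measurable v) {h k δ q : ℝ} (hδ : 0 < δ)
    (hk : h + δ ≤ k) (hq : 0 < q) (B : Set (Rn n)) :
    volume (B ∩ {y | k < v y}) ≤
      ENNReal.ofReal ((δ ^ q)⁻¹) * ∫⁻ x in B, ENNReal.ofReal (truncAbove v h x ^ q) := by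
  have hm : MeasurableSet {y | k < v y} := measurableSet_lt measurable_const hv
  have h1 : ENNReal.ofReal (δ ^ q) * volume (B ∩ {y | k < v y}) ≤
      ∫⁻ x in B, ENNReal.ofReal (truncAbove v h x ^ q) := by
    rw [inter_comm, ← Measure.restrict_apply hm, ← setLIntegral_const]
    refine (setLIntegral_mono' hm fun y hy => ENNReal.ofReal_le_ofReal ?_).trans
      (setLIntegral_le_lintegral _ _)
    have hy' : k < v y := hy
    exact Real.rpow_le_rpow hδ.le (le_max_of_le_left (by linarith)) hq.le
  calc volume (B ∩ {y | k < v y})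
      = ENNReal.ofReal ((δ ^ q)⁻¹) * (ENNReal.ofReal (δ ^ q) * volume (B ∩ {y | k < v y})) := by
        rw [← mul_assoc, ← ENNReal.ofReal_mul (by positivity), inv_mul_cancel₀ (by positivity),
          ENNReal.ofReal_one, one_mul]
    _ ≤ _ := by gcongr

lemma setLIntegral_truncAbove_le (hp : 1 < p) (v : Rn n → ℝ) {h k δ : ℝ} (hδ : 0 < δ)
    (hk : h + δ ≤ k) {B : Set (Rn n)} :
    ∫⁻ x in B, ENNReal.ofReal (truncAbove v k x) ≤
      ENNReal.ofReal ((δ ^ (p - 1))⁻¹) * ∫⁻ x in B, ENNReal.ofReal (truncAbove v h x ^ p) := by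
  rw [← lintegral_const_mul' _ _ ENNReal.ofReal_ne_top]
  refine lintegral_mono fun x => ?_
  rw [← ENNReal.ofReal_mul (by positivity)]
  refine ENNReal.ofReal_le_ofReal ?_
  rcases le_or_gt (v x) k with hx | hx
  · rw [truncAbove_of_le hx]
    exact mul_nonneg (by positivity) (Real.rpow_nonneg (truncAbove_nonneg _ _ _) _)
  · have h1 : truncAbove v h x = v x - h := truncAbove_of_ge (by linarith)
    have h2 : truncAbove v k x = v x - k := truncAbove_of_ge hx.le
    rw [h1, h2]
    have h3 : δ ≤ v x - h := by linarith
    have h4 : (v x - h) ^ p = (v x - h) * (v x - h) ^ (p - 1) := by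
      rw [← Real.rpow_one_add' (by linarith) (by linarith)]; congr 1; ring
    have h5 : δ ^ (p - 1) ≤ (v x - h) ^ (p - 1) := Real.rpow_le_rpow hδ.le h3 (by linarith)
    have h6 : 0 < δ ^ (p - 1) := by positivity
    rw [h4, inv_mul_eq_div, le_div_iff₀ h6]
    exact mul_le_mul (by linarith) h5 h6.le (by linarith)

lemma truncAbove_mono_tail (hp : 1 < p) (v : Rn n → ℝ) {h k : ℝ} (hk : h ≤ k)
    {A B : Set (Rn n)} (hAB : A ⊆ B) :
    ∫⁻ y in A, ENNReal.ofReal (truncAbove v k y ^ (p - 1) * fker n s p y) ≤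
      ∫⁻ y in B, ENNReal.ofReal (truncAbove v h y ^ (p - 1) * fker n s p y) := by
  refine (lintegral_mono_set hAB).trans (lintegral_mono fun y => ENNReal.ofReal_le_ofReal ?_)
  exact mul_le_mul_of_nonneg_right (Real.rpow_le_rpow (truncAbove_nonneg _ _ _)
    (truncAbove_anti v hk y) (by linarith)) (fker_nonneg _)

/-- De Giorgi iteration: a small `L^p` norm of the positive part forces an upper bound. -/
theorem local_upper_bound (H : Admissible n s p L) {T : ℝ} (hT : 0 ≤ T) : ∃ ε : ℝ, 0 < ε ∧
    ∀ v : Rn n → ℝ, IsSol n s p L (ball 0 1) v →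
    ∫⁻ x in ball 0 (1 / 2), ENNReal.ofReal (truncAbove v 0 x ^ p) ≤ ENNReal.ofReal ε →
    ∫⁻ y in (ball 0 (1 / 4))ᶜ, ENNReal.ofReal (truncAbove v 0 y ^ (p - 1) * fker n s p y) ≤
      ENNReal.ofReal T →
    ∀ᵐ x ∂volume.restrict (ball (0 : Rn n) (1 / 4)), v x ≤ 1 := by
  obtain ⟨C, hC, hkey⟩ := lintegral_truncAbove_le H
  have hp := H.p_pos
  have hp1 := H.one_lt_p
  have hn := H.dim_pos
  set θ := s * p / n with hθ
  have hθ0 : 0 < θ := div_pos H.sp_pos hn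
  set N := (n : ℝ) + s * p + p with hN
  have hN0 : 0 < N := add_pos H.exponent_pos hp
  set A := C * 8 ^ N * 2 ^ (p * θ) * (1 + T * 2 ^ (p - 1)) with hA
  have hA0 : 0 < A := by positivity
  set b : ℝ := 2 ^ (N + p * θ + (p - 1)) with hb
  have hb0 : 0 < b := by positivity
  set l : ℝ := b ^ (-θ⁻¹) with hl
  have hl0 : 0 < l := by positivity
  have hlθ : b * l ^ θ = 1 := by
    rw [hl, ← Real.rpow_mul hb0.le, neg_mul, inv_mul_cancel₀ hθ0.ne', Real.rpow_neg_one,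
      mul_inv_cancel₀ hb0.ne']
  have hl1 : l < 1 := by
    rw [hl]
    refine Real.rpow_lt_one_of_one_lt_of_neg ?_ (by simpa using hθ0)
    exact Real.one_lt_rpow one_lt_two (by nlinarith [mul_pos hp hθ0])
  set ε := (l / A) ^ (θ⁻¹) with hε
  have hε0 : 0 < ε := by positivity
  have hεθ : A * ε ^ θ = l := by
    rw [hε, ← Real.rpow_mul (by positivity), inv_mul_cancel₀ hθ0.ne', Real.rpow_one]
    field_simp
  refine ⟨ε, hε0, fun v hv hsmall htail => ?_⟩
  let k : ℕ → ℝ := fun j => 1 - (1 / 2) ^ j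
  let ρ : ℕ → ℝ := fun j => 1 / 4 + (1 / 4) * (1 / 2) ^ j
  have hpow1 : ∀ j : ℕ, ((1 : ℝ) / 2) ^ j ≤ 1 := fun j => pow_le_one₀ (by norm_num) (by norm_num)
  have main : ∀ j, ∫⁻ x in ball 0 (ρ j), ENNReal.ofReal (truncAbove v (k j) x ^ p) ≤
      ENNReal.ofReal (ε * l ^ j) := by
    intro j
    induction j with
    | zero =>
      have h1 : ρ 0 = 1 / 2 := by simp only [ρ]; norm_num
      have h2 : k 0 = 0 := by simp only [k]; norm_num
      rw [h1, h2, pow_zero, mul_one]; exact hsmall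
    | succ j ih =>
      set t : ℝ := (1 / 2) ^ j with ht
      have ht0 : 0 < t := by positivity
      set y := ε * l ^ j with hy
      have hy0 : 0 < y := by positivity
      have e1 : ρ j = ρ (j + 1) + t / 8 := by
        simp only [ρ, pow_succ, ← ht]; ring
      have e2 : k j + t / 2 = k (j + 1) := by
        simp only [k, pow_succ, ← ht]; ring
      have hkj : k j ≤ k (j + 1) := by linarith
      have hk0 : 0 ≤ k (j + 1) := by
        simp only [k]; linarith [hpow1 (j + 1)]
      have hρ1 : ρ j ≤ 1 := by simp only [ρ]; linarith [hpow1 j]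
      have hρ0 : 1 / 4 ≤ ρ (j + 1) := by
        simp only [ρ]; linarith [show (0 : ℝ) < (1 / 2) ^ (j + 1) by positivity]
      have hρ0' : 1 / 4 ≤ ρ j := by linarith
      set m := ((t / 2) ^ p)⁻¹ * y with hm
      have hm0 : 0 < m := by positivity
      have hvol : volume (ball (0 : Rn n) (ρ (j + 1) + t / 8) ∩ {y | k (j + 1) < v y}) ≤
          ENNReal.ofReal m := by
        rw [← e1, hm, ENNReal.ofReal_mul (by positivity)]
        refine (volume_superlevel_le hv.meas (by positivity : 0 < t / 2) e2.le hp _).trans ?_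
        gcongr
      have h1 := hkey v hv (k (j + 1)) (ρ (j + 1)) (t / 8) m T (by linarith) (by positivity)
        (by rw [← e1]; exact hρ1) hm0 hvol
        ((truncAbove_mono_tail hp1 v hk0 (compl_subset_compl.2 (ball_subset_ball
          (by rw [← e1]; exact hρ0')))).trans htail)
      refine h1.trans ?_
      rw [← e1]
      have h2 : ∫⁻ x in ball 0 (ρ j), ENNReal.ofReal (truncAbove v (k (j + 1)) x ^ p) ≤
          ENNReal.ofReal y := by
        refine (lintegral_mono fun x => ENNReal.ofReal_le_ofReal ?_).trans ih
        exact Real.rpow_le_rpow (truncAbove_nonneg _ _ _) (truncAbove_anti v hkj x) hp.le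
      have h3 : ∫⁻ x in ball 0 (ρ j), ENNReal.ofReal (truncAbove v (k (j + 1)) x) ≤
          ENNReal.ofReal (((t / 2) ^ (p - 1))⁻¹ * y) := by
        rw [ENNReal.ofReal_mul (by positivity)]
        refine (setLIntegral_truncAbove_le hp1 v (by positivity : 0 < t / 2) e2.le).trans ?_
        gcongr
      have h4 : C * ((t / 8) ^ N)⁻¹ * m ^ θ * (y + T * (((t / 2) ^ (p - 1))⁻¹ * y)) ≤
          ε * l ^ (j + 1) := by
        have t1 : t ≤ 1 := hpow1 j
        have a1 : ((t / 8) ^ N)⁻¹ = 8 ^ N * (t ^ N)⁻¹ := by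
          rw [Real.div_rpow ht0.le (by norm_num), inv_div, div_eq_mul_inv]
        have a2 : ((t / 2) ^ (p - 1))⁻¹ = 2 ^ (p - 1) * (t ^ (p - 1))⁻¹ := by
          rw [Real.div_rpow ht0.le (by norm_num), inv_div, div_eq_mul_inv]
        have a3 : m ^ θ = 2 ^ (p * θ) * (t ^ (p * θ))⁻¹ * y ^ θ := by
          rw [hm, Real.mul_rpow (by positivity) hy0.le, Real.inv_rpow (by positivity),
            ← Real.rpow_mul (by positivity), Real.div_rpow ht0.le (by norm_num), inv_div,
            div_eq_mul_inv]
        have a4 : 1 ≤ (t ^ (p - 1))⁻¹ :=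
          (one_le_inv₀ (by positivity)).2 (Real.rpow_le_one ht0.le t1 (by linarith))
        have a5 : (t ^ N)⁻¹ * (t ^ (p * θ))⁻¹ * (t ^ (p - 1))⁻¹ = b ^ j := by
          have : t = (2 ^ j)⁻¹ := by rw [ht, one_div, inv_pow]
          rw [← mul_inv, ← mul_inv, ← Real.rpow_add ht0, ← Real.rpow_add ht0, this,
            Real.inv_rpow (by positivity), inv_inv, hb, ← Real.rpow_natCast,
            ← Real.rpow_natCast, ← Real.rpow_mul (by norm_num), ← Real.rpow_mul (by norm_num),
            mul_comm]
        have a6 : y ^ θ = ε ^ θ * (l ^ θ) ^ j := by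
          rw [hy, Real.mul_rpow hε0.le (by positivity), ← Real.rpow_natCast,
            ← Real.rpow_mul hl0.le, ← Real.rpow_natCast, ← Real.rpow_mul hl0.le, mul_comm θ]
        calc C * ((t / 8) ^ N)⁻¹ * m ^ θ * (y + T * (((t / 2) ^ (p - 1))⁻¹ * y))
            = C * 8 ^ N * (t ^ N)⁻¹ * (2 ^ (p * θ) * (t ^ (p * θ))⁻¹ * y ^ θ) *
              (1 + T * 2 ^ (p - 1) * (t ^ (p - 1))⁻¹) * y := by
              rw [a1, a2, a3]; ring
          _ ≤ C * 8 ^ N * (t ^ N)⁻¹ * (2 ^ (p * θ) * (t ^ (p * θ))⁻¹ * y ^ θ) *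
              ((t ^ (p - 1))⁻¹ + T * 2 ^ (p - 1) * (t ^ (p - 1))⁻¹) * y := by gcongr
          _ = A * ((t ^ N)⁻¹ * (t ^ (p * θ))⁻¹ * (t ^ (p - 1))⁻¹) * y ^ θ * y := by
              rw [hA]; ring
          _ = (A * ε ^ θ) * (b * l ^ θ) ^ j * y := by
              rw [a5, a6, mul_pow]; ring
          _ = ε * l ^ (j + 1) := by
              rw [hlθ, hεθ, one_pow, hy, pow_succ]; ring
      calc _ ≤ ENNReal.ofReal (C * ((t / 8) ^ N)⁻¹ * m ^ θ) * (ENNReal.ofReal y +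
            ENNReal.ofReal T * ENNReal.ofReal (((t / 2) ^ (p - 1))⁻¹ * y)) := by gcongr
        _ = ENNReal.ofReal (C * ((t / 8) ^ N)⁻¹ * m ^ θ *
            (y + T * (((t / 2) ^ (p - 1))⁻¹ * y))) := by
            rw [← ENNReal.ofReal_mul hT, ← ENNReal.ofReal_add hy0.le (by positivity),
              ← ENNReal.ofReal_mul (by positivity)]
        _ ≤ _ := ENNReal.ofReal_le_ofReal h4
  have hlim : ∫⁻ x in ball 0 (1 / 4), ENNReal.ofReal (truncAbove v 1 x ^ p) ≤ 0 := by
    have ht : Tendsto (fun j : ℕ => ENNReal.ofReal (ε * l ^ j)) atTop (𝓝 0) := by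
      have := (tendsto_pow_atTop_nhds_zero_of_lt_one hl0.le hl1).const_mul ε
      rw [mul_zero] at this
      simpa using ENNReal.tendsto_ofReal this
    refine ge_of_tendsto' ht fun j => le_trans ?_ (main j)
    refine (lintegral_mono_set (ball_subset_ball ?_)).trans (lintegral_mono fun x =>
      ENNReal.ofReal_le_ofReal (Real.rpow_le_rpow (truncAbove_nonneg _ _ _)
        (truncAbove_anti v ?_ x) hp.le))
    · simp only [ρ]; linarith [show (0 : ℝ) < (1 / 2) ^ j by positivity]
    · simp only [k]; linarith [show (0 : ℝ) < (1 / 2) ^ j by positivity]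
  have hae := (lintegral_eq_zero_iff (by
    have := measurable_truncAbove hv.meas 1
    fun_prop)).1 (le_antisymm hlim zero_le)
  filter_upwards [hae] with x hx
  by_contra hcon
  have h1 : 0 < truncAbove v 1 x := lt_max_of_lt_left (by linarith)
  have h2 : 0 < truncAbove v 1 x ^ p := Real.rpow_pos_of_pos h1 p
  exact (ENNReal.ofReal_pos.2 h2).ne' hx

end LocalBound

section ReverseHolder

variable {n : ℕ} {s p L : ℝ}

lemma le_of_absorbing_recursion {F : ℕ → ℝ≥0∞} {M : ℝ≥0∞} (hM : M < ⊤) (hF : ∀ j, F j ≤ M)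
    {c B : ℝ} (hc : 0 ≤ c) (hB : 1 ≤ B)
    (h : ∀ j, F j ≤ ENNReal.ofReal (c * B ^ j) + ENNReal.ofReal ((2 * B)⁻¹) * F (j + 1)) :
    F 0 ≤ ENNReal.ofReal (2 * c) := by
  have hB0 : 0 < B := by linarith
  have key : ∀ J : ℕ, F 0 ≤ ENNReal.ofReal (c * (2 - 2 * (1 / 2) ^ J)) +
      ENNReal.ofReal (((2 * B)⁻¹) ^ J) * F J := by
    intro J
    induction J with
    | zero => simp
    | succ J ih =>
      have hpow : ((1 : ℝ) / 2) ^ J ≤ 1 := pow_le_one₀ (by norm_num) (by norm_num)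
      refine ih.trans ?_
      calc _ ≤ ENNReal.ofReal (c * (2 - 2 * (1 / 2) ^ J)) + ENNReal.ofReal (((2 * B)⁻¹) ^ J) *
            (ENNReal.ofReal (c * B ^ J) + ENNReal.ofReal ((2 * B)⁻¹) * F (J + 1)) := by
            gcongr; exact h J
        _ = _ := by
            rw [mul_add, ← mul_assoc, ← ENNReal.ofReal_mul (by positivity),
              ← ENNReal.ofReal_mul (by positivity), ← add_assoc,
              ← ENNReal.ofReal_add (mul_nonneg hc (by linarith)) (by positivity), pow_succ _ J]
            congr 2
            have e : ((2 * B)⁻¹) ^ J * (c * B ^ J) = c * (1 / 2) ^ J := by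
              rw [mul_left_comm, ← mul_pow]
              congr 2
              field_simp
            rw [e]; ring
  have hlim : Tendsto (fun J : ℕ => ENNReal.ofReal (2 * c) +
      ENNReal.ofReal (((2 * B)⁻¹) ^ J) * M) atTop (𝓝 (ENNReal.ofReal (2 * c) + 0 * M)) := by
    refine tendsto_const_nhds.add (ENNReal.Tendsto.mul_const ?_ (Or.inr hM.ne))
    have : Tendsto (fun J : ℕ => ((2 * B)⁻¹) ^ J) atTop (𝓝 0) :=
      tendsto_pow_atTop_nhds_zero_of_lt_one (by positivity)
        (inv_lt_one_of_one_lt₀ (by linarith))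
    simpa using ENNReal.tendsto_ofReal this
  rw [zero_mul, add_zero] at hlim
  refine ge_of_tendsto' hlim fun J => (key J).trans ?_
  refine add_le_add (ENNReal.ofReal_le_ofReal ?_) (by gcongr; exact hF J)
  nlinarith [show (0 : ℝ) < (1 / 2) ^ J by positivity]

/-- Reverse Hölder inequality: a bound for a low power of the positive part and for its tail
gives an `L^p` bound on a smaller ball. -/
theorem reverse_holder (H : Admissible n s p L) {q T : ℝ} (hq : 0 < q) (hT : 0 ≤ T) :
    ∃ C : ℝ, 0 < C ∧ ∀ v : Rn n → ℝ, IsSol n s p L (ball 0 1) v →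
    ∫⁻ x in ball 0 1, ENNReal.ofReal (truncAbove v 0 x ^ q) ≤ 1 →
    ∫⁻ y in (ball 0 (1 / 2))ᶜ, ENNReal.ofReal (truncAbove v 0 y ^ (p - 1) * fker n s p y) ≤
      ENNReal.ofReal T →
    ∫⁻ x in ball 0 (1 / 2), ENNReal.ofReal (truncAbove v 0 x ^ p) ≤ ENNReal.ofReal C := by
  obtain ⟨C, hC, hkey⟩ := lintegral_truncAbove_le H
  have := H.nontrivial
  have hp := H.p_pos
  have hp1 := H.one_lt_p
  have hn := H.dim_pos
  set θ := s * p / n with hθ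
  have hθ0 : 0 < θ := div_pos H.sp_pos hn
  set N := (n : ℝ) + s * p + p with hN
  have hN0 : 0 < N := add_pos H.exponent_pos hp
  set ω := (volume (ball (0 : Rn n) 1)).toReal with hω
  have hω0 : 0 < ω := ENNReal.toReal_pos (measure_ball_pos _ _ one_pos).ne' measure_ball_lt_top.ne
  have hωv : volume (ball (0 : Rn n) 1) = ENNReal.ofReal ω :=
    (ENNReal.ofReal_toReal measure_ball_lt_top.ne).symm
  set e := p / (q * θ) with he
  have he0 : 0 < e := by positivity
  set B : ℝ := 2 ^ (N * e) with hB
  have hB0 : 0 < B := by positivity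
  have hB1 : 1 ≤ B := Real.one_le_rpow one_le_two (by positivity)
  set κ := (2 * B)⁻¹ with hκ
  have hκ0 : 0 < κ := by positivity
  have hκ1 : κ ≤ 1 := inv_le_one_of_one_le₀ (by linarith)
  set G := C * 4 ^ N * (1 + T) * 2 ^ p / κ with hG
  have hG0 : 0 < G := by positivity
  set c := 2 ^ p * G ^ e * ω + ω with hc
  have hc0 : 0 < c := by positivity
  refine ⟨2 * c, by positivity, fun v hv hint htail => ?_⟩
  set ρ : ℕ → ℝ := fun j => 1 - (1 / 2) * (1 / 2) ^ j with hρ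
  set F : ℕ → ℝ≥0∞ := fun j =>
    ∫⁻ x in ball 0 (ρ j), ENNReal.ofReal (truncAbove v 0 x ^ p) with hF
  have hpow0 : ∀ j : ℕ, (0 : ℝ) < (1 / 2) ^ j := fun j => by positivity
  have hpow1 : ∀ j : ℕ, ((1 : ℝ) / 2) ^ j ≤ 1 := fun j => pow_le_one₀ (by norm_num) (by norm_num)
  have hρ1 : ∀ j, ρ j ≤ 1 := fun j => by simp only [hρ]; linarith [hpow0 j]
  have hF0 : ∫⁻ x in ball 0 (1 / 2), ENNReal.ofReal (truncAbove v 0 x ^ p) = F 0 := by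
    simp only [hF, hρ]; norm_num
  rw [hF0]
  refine le_of_absorbing_recursion (lintegral_truncAbove_rpow_lt_top H hv.locLp 0 1)
    (fun j => lintegral_mono_set (ball_subset_ball (hρ1 j))) hc0.le hB1 fun j => ?_
  set t : ℝ := (1 / 2) ^ j with ht
  have ht0 : 0 < t := hpow0 j
  have t1 : t ≤ 1 := hpow1 j
  have e1 : ρ (j + 1) = ρ j + t / 4 := by simp only [hρ, pow_succ, ← ht]; ring
  have hρj : 1 / 2 ≤ ρ j := by simp only [hρ]; linarith [hpow1 j]
  set h := (G * (t ^ N)⁻¹) ^ ((q * θ)⁻¹) with hh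
  have hh0 : 0 < h := by positivity
  have hhqθ : (h ^ q) ^ θ = G * (t ^ N)⁻¹ := by
    rw [← Real.rpow_mul hh0.le, hh, ← Real.rpow_mul (by positivity),
      inv_mul_cancel₀ (by positivity), Real.rpow_one]
  have hhp : h ^ p = G ^ e * B ^ j := by
    have h2 : t⁻¹ = 2 ^ j := by rw [ht, one_div, inv_pow, inv_inv]
    rw [hh, ← Real.rpow_mul (by positivity), Real.mul_rpow hG0.le (by positivity), he,
      inv_mul_eq_div, ← Real.inv_rpow ht0.le, h2, ← Real.rpow_mul (by positivity), hB, he,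
      ← Real.rpow_natCast 2 j, ← Real.rpow_natCast _ j, ← Real.rpow_mul (by norm_num),
      ← Real.rpow_mul (by norm_num), mul_comm (j : ℝ)]
  set m := (h ^ q)⁻¹ with hm
  have hm0 : 0 < m := by positivity
  set b := ball (0 : Rn n) (ρ (j + 1)) with hb
  have hbB : b ⊆ ball 0 1 := ball_subset_ball (hρ1 _)
  have hvol : volume (ball (0 : Rn n) (ρ j + t / 4) ∩ {y | h < v y}) ≤ ENNReal.ofReal m := by
    rw [← e1]
    refine (volume_superlevel_le hv.meas hh0 (by rw [zero_add]) hq _).trans ?_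
    calc _ ≤ ENNReal.ofReal ((h ^ q)⁻¹) * 1 := by
          gcongr
          exact (lintegral_mono_set hbB).trans hint
      _ = _ := mul_one _
  have h1 := hkey v hv h (ρ j) (t / 4) m T (by linarith) (by positivity)
    (by rw [← e1]; exact hρ1 _) hm0 hvol
    ((truncAbove_mono_tail hp1 v hh0.le (compl_subset_compl.2 (ball_subset_ball
      (by linarith)))).trans htail)
  rw [← e1] at h1
  have hco : C * ((t / 4) ^ N)⁻¹ * m ^ θ = κ / (2 ^ p * (1 + T)) := by
    rw [hm, Real.inv_rpow (by positivity), hhqθ, Real.div_rpow ht0.le (by norm_num), hG]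
    have : 0 < t ^ N := by positivity
    field_simp
  rw [hco] at h1
  have hw0 := truncAbove_nonneg v
  have hw1 : ∀ x, truncAbove v h x ≤ truncAbove v 0 x := truncAbove_anti v hh0.le
  have hmeas := measurable_truncAbove hv.meas
  have i1 : ∫⁻ x in b, ENNReal.ofReal (truncAbove v h x ^ p) ≤ F (j + 1) :=
    lintegral_mono fun x => ENNReal.ofReal_le_ofReal
      (Real.rpow_le_rpow (hw0 _ _) (hw1 x) hp.le)
  have hvolB : ∀ {r : ℝ}, r ≤ 1 → volume (ball (0 : Rn n) r) ≤ ENNReal.ofReal ω := fun hr => by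
    rw [← hωv]; exact measure_mono (ball_subset_ball hr)
  have i2 : ∫⁻ x in b, ENNReal.ofReal (truncAbove v h x) ≤ F (j + 1) + ENNReal.ofReal ω := by
    calc _ ≤ ∫⁻ x in b, (ENNReal.ofReal (truncAbove v 0 x ^ p) + 1) := by
          refine lintegral_mono fun x => ?_
          rw [← ENNReal.ofReal_one, ← ENNReal.ofReal_add (Real.rpow_nonneg (hw0 _ _) _)
            zero_le_one]
          refine ENNReal.ofReal_le_ofReal ((hw1 x).trans ?_)
          rcases le_or_gt (truncAbove v 0 x) 1 with hx | hx
          · linarith [Real.rpow_nonneg (hw0 0 x) p]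
          · linarith [Real.self_le_rpow_of_one_le hx.le hp1.le]
      _ = F (j + 1) + volume b := by
          rw [lintegral_add_right _ measurable_const, setLIntegral_one]
      _ ≤ _ := by gcongr; exact hvolB (hρ1 _)
  calc F j ≤ ∫⁻ x in ball 0 (ρ j), ENNReal.ofReal (2 ^ p) *
        (ENNReal.ofReal (h ^ p) + ENNReal.ofReal (truncAbove v h x ^ p)) := by
        refine lintegral_mono fun x => ?_
        rw [← ENNReal.ofReal_add (by positivity) (Real.rpow_nonneg (hw0 _ _) _),
          ← ENNReal.ofReal_mul (by positivity)]
        refine ENNReal.ofReal_le_ofReal (le_trans (Real.rpow_le_rpow (hw0 _ _) ?_ hp.le)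
          (add_rpow_le hh0.le (hw0 h x) hp.le))
        exact max_le (by linarith [le_max_left (v x - h) 0, show truncAbove v h x = max (v x - h) 0
          from rfl]) (add_nonneg hh0.le (hw0 _ _))
    _ = ENNReal.ofReal (2 ^ p) * (ENNReal.ofReal (h ^ p) * volume (ball (0 : Rn n) (ρ j)) +
        ∫⁻ x in ball 0 (ρ j), ENNReal.ofReal (truncAbove v h x ^ p)) := by
        rw [lintegral_const_mul' _ _ ENNReal.ofReal_ne_top, lintegral_add_left measurable_const,
          setLIntegral_const]
    _ ≤ ENNReal.ofReal (2 ^ p) * (ENNReal.ofReal (h ^ p) * ENNReal.ofReal ω +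
        ENNReal.ofReal (κ / (2 ^ p * (1 + T))) *
          (F (j + 1) + ENNReal.ofReal T * (F (j + 1) + ENNReal.ofReal ω))) := by
        gcongr
        · exact hvolB (hρ1 _)
        · refine h1.trans ?_
          gcongr
    _ ≤ ENNReal.ofReal (2 ^ p) * (ENNReal.ofReal (h ^ p) * ENNReal.ofReal ω +
        ENNReal.ofReal (κ / (2 ^ p * (1 + T))) *
          (ENNReal.ofReal (1 + T) * (F (j + 1) + ENNReal.ofReal ω))) := by
        gcongr
        rw [ENNReal.ofReal_add zero_le_one hT, ENNReal.ofReal_one, add_mul, one_mul]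
        gcongr
        exact le_self_add
    _ = ENNReal.ofReal (2 ^ p * (h ^ p * ω) + κ * ω) + ENNReal.ofReal κ * F (j + 1) := by
        rw [mul_add, ← mul_assoc (ENNReal.ofReal (κ / (2 ^ p * (1 + T)))),
          ← ENNReal.ofReal_mul (by positivity), ← mul_assoc, ← mul_assoc,
          ← ENNReal.ofReal_mul (by positivity), ← ENNReal.ofReal_mul (by positivity),
          ← ENNReal.ofReal_mul (by positivity), mul_add, ← ENNReal.ofReal_mul (by positivity),
          ENNReal.ofReal_add (by positivity) (by positivity)]
        have e3 : 2 ^ p * (κ / (2 ^ p * (1 + T))) * (1 + T) = κ := by field_simp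
        rw [e3]
        ring
    _ ≤ _ := by
        gcongr
        rw [hhp, hc, add_mul]
        have hBj : 1 ≤ B ^ j := one_le_pow₀ hB1
        have : κ * ω ≤ ω * B ^ j := by
          rw [mul_comm]; gcongr; exact hκ1.trans hBj
        linarith [show 2 ^ p * (G ^ e * B ^ j * ω) = 2 ^ p * G ^ e * ω * B ^ j by ring]

end ReverseHolder

section SupBound

variable {n : ℕ} {s p L : ℝ}

lemma one_le_qStar (p : ℝ) : 1 ≤ qStar p := le_max_left _ _

lemma qStar_pos (p : ℝ) : 0 < qStar p := zero_lt_one.trans_le (one_le_qStar p)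

lemma sub_one_le_qStar (p : ℝ) : p - 1 ≤ qStar p := le_max_right _ _

/-- `v - c` is bounded by `X` on the unit ball (in `L^{q_*}`) and in its exterior
(in the tail norm). -/
structure Controlled (n : ℕ) (s p : ℝ) (v : Rn n → ℝ) (c X : ℝ) : Prop where
  inner : ∫⁻ x in ball (0 : Rn n) 1, ENNReal.ofReal (|v x - c| ^ qStar p) ≤
    ENNReal.ofReal (X ^ qStar p)
  outer : ∫⁻ x in (ball (0 : Rn n) 1)ᶜ, ENNReal.ofReal (|v x - c| ^ (p - 1) * fker n s p x) ≤
    ENNReal.ofReal (X ^ (p - 1))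

lemma IsSol.mul_sub (H : Admissible n s p L) {O : Set (Rn n)} {v : Rn n → ℝ}
    (hv : IsSol n s p L O v) {l : ℝ} (hl : l ≠ 0) (c : ℝ) :
    IsSol n s p L O (fun x => l * (v x - c)) := by
  simpa using hv.affine H 0 c one_pos hl (O' := O) (fun x hx => by simpa using hx)

lemma setLIntegral_fker_annulus_le (H : Admissible n s p L) {g : Rn n → ℝ} (hg : ∀ x, 0 ≤ g x)
    {r : ℝ} (hr : 0 < r) :
    ∫⁻ x in (ball (0 : Rn n) r)ᶜ, ENNReal.ofReal (g x * fker n s p x) ≤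
      ENNReal.ofReal ((r ^ ((n : ℝ) + s * p))⁻¹) * (∫⁻ x in ball 0 1, ENNReal.ofReal (g x)) +
      ∫⁻ x in (ball (0 : Rn n) 1)ᶜ, ENNReal.ofReal (g x * fker n s p x) := by
  have h1 : (ball (0 : Rn n) r)ᶜ ⊆ (ball 0 1 \ ball 0 r) ∪ (ball 0 1)ᶜ := by
    intro x hx
    by_cases h : x ∈ ball (0 : Rn n) 1
    · exact Or.inl ⟨h, hx⟩
    · exact Or.inr h
  refine (lintegral_mono_set h1).trans ((lintegral_union_le _ _ _).trans (add_le_add ?_ le_rfl))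
  rw [← lintegral_const_mul' _ _ ENNReal.ofReal_ne_top]
  refine (setLIntegral_mono' (measurableSet_ball.diff measurableSet_ball) fun x hx => ?_).trans
    (lintegral_mono_set sdiff_subset)
  rw [← ENNReal.ofReal_mul (by positivity), mul_comm]
  refine ENNReal.ofReal_le_ofReal (mul_le_mul_of_nonneg_right (fker_le_rpow H hr ?_) (hg x))
  simpa using hx.2

lemma truncAbove_zero_mul {a : ℝ} (ha : 0 ≤ a) (v : Rn n → ℝ) (c : ℝ) (x : Rn n) :
    truncAbove (fun y => a * (v y - c)) 0 x = a * truncAbove v c x := by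
  simp only [truncAbove, sub_zero]
  rw [mul_max_of_nonneg _ _ ha, mul_zero]

lemma truncAbove_zero_le_abs (v : Rn n → ℝ) (x : Rn n) : truncAbove v 0 x ≤ |v x| := by
  simp only [truncAbove, sub_zero]
  exact max_le (le_abs_self _) (abs_nonneg _)

lemma exists_upper_bound (H : Admissible n s p L) : ∃ M : ℝ, 1 ≤ M ∧ ∀ v : Rn n → ℝ,
    IsSol n s p L (ball 0 1) v → Controlled n s p v 0 1 →
    ∀ᵐ x ∂volume.restrict (ball (0 : Rn n) (1 / 4)), v x ≤ M := by
  have hp := H.p_pos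
  have hp1 := H.p_sub_pos
  set ω := (volume (ball (0 : Rn n) 1)).toReal with hω
  have hωv : volume (ball (0 : Rn n) 1) = ENNReal.ofReal ω :=
    (ENNReal.ofReal_toReal measure_ball_lt_top.ne).symm
  have hω0 : 0 ≤ ω := ENNReal.toReal_nonneg
  set T := (((1 : ℝ) / 4) ^ ((n : ℝ) + s * p))⁻¹ * (1 + ω) + 1 with hT
  have hT0 : 0 ≤ T := by positivity
  obtain ⟨C, hC, hRH⟩ := reverse_holder H (qStar_pos p) hT0
  obtain ⟨ε, hε, hLB⟩ := local_upper_bound H hT0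
  refine ⟨max 1 ((C / ε) ^ p⁻¹), le_max_left _ _, fun v hv hc => ?_⟩
  set M := max 1 ((C / ε) ^ p⁻¹) with hM
  have hM1 : 1 ≤ M := le_max_left _ _
  have hM0 : 0 < M := by linarith
  have hw0 := truncAbove_nonneg v
  have hin : ∫⁻ x in ball (0 : Rn n) 1, ENNReal.ofReal (truncAbove v 0 x ^ qStar p) ≤ 1 := by
    refine (lintegral_mono fun x => ENNReal.ofReal_le_ofReal ?_).trans (hc.inner.trans (by simp))
    rw [sub_zero]
    exact Real.rpow_le_rpow (hw0 _ _) (truncAbove_zero_le_abs v x) (qStar_pos p).le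
  have hin' : ∫⁻ x in ball (0 : Rn n) 1, ENNReal.ofReal (truncAbove v 0 x ^ (p - 1)) ≤
      ENNReal.ofReal (1 + ω) := by
    calc _ ≤ ∫⁻ x in ball (0 : Rn n) 1, (ENNReal.ofReal (truncAbove v 0 x ^ qStar p) + 1) := by
          refine lintegral_mono fun x => ?_
          rw [← ENNReal.ofReal_one, ← ENNReal.ofReal_add (Real.rpow_nonneg (hw0 _ _) _)
            zero_le_one]
          refine ENNReal.ofReal_le_ofReal ?_
          rcases le_or_gt (truncAbove v 0 x) 1 with hx | hx
          · linarith [Real.rpow_nonneg (hw0 0 x) (qStar p), Real.rpow_le_one (hw0 0 x) hx hp1.le]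
          · linarith [Real.rpow_le_rpow_of_exponent_le hx.le (sub_one_le_qStar p)]
      _ ≤ 1 + ENNReal.ofReal ω := by
          rw [lintegral_add_right _ measurable_const, setLIntegral_one, hωv]
          gcongr
      _ = _ := by rw [ENNReal.ofReal_add zero_le_one hω0, ENNReal.ofReal_one]
  have hout : ∫⁻ y in (ball 0 1)ᶜ, ENNReal.ofReal (truncAbove v 0 y ^ (p - 1) * fker n s p y) ≤
      1 := by
    refine (lintegral_mono fun x => ENNReal.ofReal_le_ofReal ?_).trans (hc.outer.trans (by simp))
    rw [sub_zero]
    exact mul_le_mul_of_nonneg_right (Real.rpow_le_rpow (hw0 _ _) (truncAbove_zero_le_abs v x)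
      hp1.le) (fker_nonneg _)
  have htail : ∫⁻ y in (ball 0 (1 / 4))ᶜ,
      ENNReal.ofReal (truncAbove v 0 y ^ (p - 1) * fker n s p y) ≤ ENNReal.ofReal T := by
    refine (setLIntegral_fker_annulus_le H (fun x => Real.rpow_nonneg (hw0 0 x) _)
      (by norm_num : (0 : ℝ) < 1 / 4)).trans ?_
    rw [hT, ENNReal.ofReal_add (by positivity) zero_le_one, ENNReal.ofReal_mul (by positivity),
      ENNReal.ofReal_one]
    gcongr
  have hRHv := hRH v hv hin ((lintegral_mono_set (compl_subset_compl.2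
    (ball_subset_ball (by norm_num)))).trans htail)
  have hu := hv.mul_sub H (l := M⁻¹) (by positivity) 0
  have hMi1 : M⁻¹ ≤ 1 := inv_le_one_of_one_le₀ hM1
  have hMp : C * (M⁻¹) ^ p ≤ ε := by
    have h1 : C / ε ≤ M ^ p := by
      calc C / ε = ((C / ε) ^ p⁻¹) ^ p := by
            rw [← Real.rpow_mul (by positivity), inv_mul_cancel₀ hp.ne', Real.rpow_one]
        _ ≤ M ^ p := Real.rpow_le_rpow (by positivity) (le_max_right _ _) hp.le
    rw [Real.inv_rpow hM0.le, ← div_eq_mul_inv, div_le_iff₀ (by positivity)]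
    rwa [div_le_iff₀ hε, mul_comm] at h1
  have h1 := hLB _ hu (by
    simp only [truncAbove_zero_mul (inv_nonneg.2 hM0.le)]
    have : ∀ x, ENNReal.ofReal ((M⁻¹ * truncAbove v 0 x) ^ p) =
        ENNReal.ofReal ((M⁻¹) ^ p) * ENNReal.ofReal (truncAbove v 0 x ^ p) := fun x => by
      rw [Real.mul_rpow (by positivity) (hw0 _ _), ENNReal.ofReal_mul (by positivity)]
    simp only [this]
    rw [lintegral_const_mul' _ _ ENNReal.ofReal_ne_top]
    calc _ ≤ ENNReal.ofReal ((M⁻¹) ^ p) * ENNReal.ofReal C := by gcongr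
      _ ≤ _ := by
        rw [← ENNReal.ofReal_mul (by positivity), mul_comm]
        exact ENNReal.ofReal_le_ofReal hMp) (by
    refine (lintegral_mono fun x => ENNReal.ofReal_le_ofReal ?_).trans htail
    rw [truncAbove_zero_mul (inv_nonneg.2 hM0.le)]
    refine mul_le_mul_of_nonneg_right (Real.rpow_le_rpow (mul_nonneg (by positivity) (hw0 _ _))
      (mul_le_of_le_one_left (hw0 _ _) hMi1) hp1.le) (fker_nonneg _))
  filter_upwards [h1] with x hx
  rwa [sub_zero, inv_mul_le_iff₀ hM0, mul_one] at hx

lemma Controlled.mul_sub {v : Rn n → ℝ} {c X : ℝ} (h : Controlled n s p v c X) (hX : 0 ≤ X)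
    (l : ℝ) : Controlled n s p (fun x => l * (v x - c)) 0 (|l| * X) := by
  have e : ∀ x (q : ℝ), |l * (v x - c) - 0| ^ q = |l| ^ q * |v x - c| ^ q := fun x q => by
    rw [sub_zero, abs_mul, Real.mul_rpow (abs_nonneg _) (abs_nonneg _)]
  constructor
  · simp only [e, ENNReal.ofReal_mul (Real.rpow_nonneg (abs_nonneg l) _)]
    rw [lintegral_const_mul' _ _ ENNReal.ofReal_ne_top, Real.mul_rpow (abs_nonneg _) hX,
      ENNReal.ofReal_mul (by positivity)]
    gcongr
    exact h.inner
  · simp only [e, mul_assoc, ENNReal.ofReal_mul (Real.rpow_nonneg (abs_nonneg l) _)]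
    rw [lintegral_const_mul' _ _ ENNReal.ofReal_ne_top, Real.mul_rpow (abs_nonneg _) hX,
      ENNReal.ofReal_mul (by positivity)]
    gcongr
    exact h.outer

/-- Local boundedness of solutions. -/
theorem local_boundedness (H : Admissible n s p L) : ∃ M : ℝ, 1 ≤ M ∧ ∀ (v : Rn n → ℝ) (c X : ℝ),
    IsSol n s p L (ball 0 1) v → 0 < X → Controlled n s p v c X →
    ∀ᵐ x ∂volume.restrict (ball (0 : Rn n) (1 / 4)), |v x - c| ≤ M * X := by
  obtain ⟨M, hM, h⟩ := exists_upper_bound H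
  refine ⟨M, hM, fun v c X hv hX hc => ?_⟩
  have key : ∀ l : ℝ, |l| = X⁻¹ →
      ∀ᵐ x ∂volume.restrict (ball (0 : Rn n) (1 / 4)), l * (v x - c) ≤ M := fun l hl => by
    refine h _ (hv.mul_sub H (abs_pos.1 (hl ▸ inv_pos.2 hX)) c) ?_
    have := hc.mul_sub hX.le l
    rwa [hl, inv_mul_cancel₀ hX.ne'] at this
  filter_upwards [key X⁻¹ (abs_of_pos (inv_pos.2 hX)),
    key (-X⁻¹) (by rw [abs_neg, abs_of_pos (inv_pos.2 hX)])] with x h1 h2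
  rw [inv_mul_le_iff₀ hX, mul_comm] at h1
  rw [neg_mul, ← mul_neg, inv_mul_le_iff₀ hX, mul_comm] at h2
  exact abs_le.2 ⟨by linarith, h1⟩

end SupBound

section Growth

variable {n : ℕ} {s p L : ℝ}

/-- If `v ≥ 1` on a set of positive measure, the kernel integral over that set of the
increments is bounded below. -/
lemma le_setLIntegral_superlevel (H : Admissible n s p L) {v : Rn n → ℝ}
    {h : ℝ} (h2 : h ≤ 1 / 2) {x : Rn n} (hx : x ∈ ball (0 : Rn n) (1 / 2)) {A : Set (Rn n)}
    (hA : MeasurableSet A) (hAb : A ⊆ ball (0 : Rn n) (1 / 2)) (hA1 : ∀ y ∈ A, 1 ≤ v y) :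
    ENNReal.ofReal ((1 / 2) ^ (p - 1)) * volume A *
        ENNReal.ofReal (truncAbove (fun x => -v x) (-h) x) ≤
      ∫⁻ y in A, ENNReal.ofReal (truncAbove (fun x => -v x) (-h) x *
        (|-v x - -v y| ^ (p - 1) * fker n s p (x - y))) := by
  set w := truncAbove (fun x => -v x) (-h)
  rcases le_or_gt (-v x) (-h) with hxh | hxh
  · have : w x = 0 := truncAbove_of_le hxh
    rw [this, ENNReal.ofReal_zero, mul_zero]
    exact zero_le
  · have hw0 : 0 ≤ w x := truncAbove_nonneg _ _ _
    calc _ = ∫⁻ _ in A, ENNReal.ofReal (w x * (1 / 2) ^ (p - 1)) := by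
          rw [setLIntegral_const, ENNReal.ofReal_mul hw0]; ring
      _ ≤ _ := by
          refine setLIntegral_mono' hA fun y hy => ENNReal.ofReal_le_ofReal ?_
          refine mul_le_mul_of_nonneg_left ?_ hw0
          have hy1 := hA1 y hy
          have hne : x - y ≠ 0 := by
            rw [sub_ne_zero]; rintro rfl; linarith
          have h3 : ‖x - y‖ ≤ 1 := by
            have a1 := hAb hy
            rw [mem_ball_zero_iff] at a1 hx
            linarith [norm_sub_le x y]
          have h4 := rpow_inv_le_fker H hne h3
          rw [Real.one_rpow, inv_one] at h4
          have h5 : (1 : ℝ) / 2 ≤ |-v x - -v y| :=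
            le_trans (by linarith) (le_abs_self _)
          have h6 := Real.rpow_le_rpow (by norm_num) h5 H.p_sub_pos.le
          calc ((1 : ℝ) / 2) ^ (p - 1) = (1 / 2) ^ (p - 1) * 1 := (mul_one _).symm
            _ ≤ _ := mul_le_mul h6 h4 zero_le_one (by positivity)

/-- Growth lemma: a nonnegative solution which is at least `1` on half of `B_{1/2}` and whose
negative part has a small tail is bounded below on `B_{1/4}`. -/
theorem growth (H : Admissible n s p L) : ∃ h : ℝ, 0 < h ∧ h ≤ 1 / 2 ∧ ∀ v : Rn n → ℝ,
    IsSol n s p L (ball 0 1) v →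
    (∀ᵐ x ∂volume.restrict (ball (0 : Rn n) 1), 0 ≤ v x) →
    volume (ball (0 : Rn n) (1 / 2)) ≤ 2 * volume (ball (0 : Rn n) (1 / 2) ∩ {x | 1 ≤ v x}) →
    ∫⁻ y in (ball 0 1)ᶜ, ENNReal.ofReal (max (-v y) 0 ^ (p - 1) * fker n s p y) ≤
      ENNReal.ofReal (h ^ (p - 1)) →
    ∀ᵐ x ∂volume.restrict (ball (0 : Rn n) (1 / 4)), h / 2 ≤ v x := by
  have := H.nontrivial
  have hp := H.p_pos
  have hp1 := H.p_sub_pos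
  obtain ⟨C, hC, hcac⟩ := caccioppoli H
  set ω := (volume (ball (0 : Rn n) 1)).toReal with hω
  have hωv : volume (ball (0 : Rn n) 1) = ENNReal.ofReal ω :=
    (ENNReal.ofReal_toReal measure_ball_lt_top.ne).symm
  have hω0 : 0 ≤ ω := ENNReal.toReal_nonneg
  set ω' := (volume (ball (0 : Rn n) (1 / 2))).toReal with hω'
  have hωv' : volume (ball (0 : Rn n) (1 / 2)) = ENNReal.ofReal ω' :=
    (ENNReal.ofReal_toReal measure_ball_lt_top.ne).symm
  have hω0' : 0 < ω' :=
    ENNReal.toReal_pos (measure_ball_pos _ _ (by norm_num)).ne' measure_ball_lt_top.ne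
  set J := (∫⁻ z in (ball (0 : Rn n) 1)ᶜ, ENNReal.ofReal (fker n s p z)).toReal with hJ
  have hJv : ∫⁻ z in (ball (0 : Rn n) 1)ᶜ, ENNReal.ofReal (fker n s p z) = ENNReal.ofReal J :=
    (ENNReal.ofReal_toReal (lintegral_fker_far_lt_top H).ne).symm
  have hJ0 : 0 ≤ J := ENNReal.toReal_nonneg
  set T₁ := 2 ^ (p - 1) * (J + 1) with hT₁
  have hT₁0 : 0 ≤ T₁ := by positivity
  set D := (((1 : ℝ) / 4) ^ ((n : ℝ) + s * p))⁻¹ with hD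
  have hD0 : 0 ≤ D := by positivity
  set T := 2 ^ (p - 1) * (D * ω + T₁) with hT
  have hT0 : 0 ≤ T := by positivity
  obtain ⟨ε, hε, hLB⟩ := local_upper_bound H hT0
  set C₁ := C * (((1 : ℝ) / 2) ^ ((n : ℝ) + s * p + p))⁻¹ with hC₁
  have hC₁0 : 0 < C₁ := by positivity
  set b := (1 / 2) ^ (p - 1) * (ω' / 2) with hb
  have hb0 : 0 < b := by positivity
  set C₂ := 2 ^ p * (b⁻¹ * (C₁ * (ω + ω * T₁))) + 1 with hC₂
  have hC₂0 : 0 < C₂ := by positivity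
  set h := min (1 / 2) ((ε / C₂) ^ (p - 1)⁻¹) with hh
  have hh0 : 0 < h := lt_min (by norm_num) (by positivity)
  have hh2 : h ≤ 1 / 2 := min_le_left _ _
  have hhε : C₂ * h ^ (p - 1) ≤ ε := by
    have : h ^ (p - 1) ≤ ε / C₂ := by
      calc h ^ (p - 1) ≤ ((ε / C₂) ^ (p - 1)⁻¹) ^ (p - 1) :=
            Real.rpow_le_rpow hh0.le (min_le_right _ _) hp1.le
        _ = ε / C₂ := by
            rw [← Real.rpow_mul (by positivity), inv_mul_cancel₀ hp1.ne', Real.rpow_one]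
    rwa [le_div_iff₀ hC₂0, mul_comm] at this
  refine ⟨h, hh0, hh2, fun v hv hpos hhalf htail => ?_⟩
  have hu : IsSol n s p L (ball 0 1) (fun x => -v x) := by
    simpa using hv.mul_sub H (l := -1) (by norm_num) 0
  set w := truncAbove (fun x => -v x) (-h) with hw
  have hw0 : ∀ x, 0 ≤ w x := truncAbove_nonneg _ _
  have hwh : ∀ᵐ x ∂volume.restrict (ball (0 : Rn n) 1), w x ≤ h := by
    filter_upwards [hpos] with x hx
    exact max_le (by linarith) hh0.le
  have hwm : Measurable w := measurable_truncAbove hu.meas _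
  have hpq : h ^ p = h * h ^ (p - 1) := by
    rw [← Real.rpow_one_add' hh0.le (by linarith)]; congr 1; ring
  -- tail of the truncation
  have hwtail : ∫⁻ y in (ball (0 : Rn n) 1)ᶜ, ENNReal.ofReal (w y ^ (p - 1) * fker n s p y) ≤
      ENNReal.ofReal (T₁ * h ^ (p - 1)) := by
    have e1 : ∀ y, ENNReal.ofReal (w y ^ (p - 1) * fker n s p y) ≤
        ENNReal.ofReal (2 ^ (p - 1)) * (ENNReal.ofReal (h ^ (p - 1)) * ENNReal.ofReal (fker n s p y)
          + ENNReal.ofReal (max (-v y) 0 ^ (p - 1) * fker n s p y)) := by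
      intro y
      have hv0 : 0 ≤ max (-v y) 0 := le_max_right _ _
      have hf := fker_nonneg (n := n) (s := s) (p := p) y
      rw [← ENNReal.ofReal_mul (by positivity), ← ENNReal.ofReal_add (by positivity)
        (by positivity), ← ENNReal.ofReal_mul (by positivity), ← add_mul, ← mul_assoc]
      refine ENNReal.ofReal_le_ofReal (mul_le_mul_of_nonneg_right ?_ hf)
      refine le_trans (Real.rpow_le_rpow (hw0 y) ?_ hp1.le) (add_rpow_le hh0.le hv0 hp1.le)
      exact max_le (by linarith [le_max_left (-v y) 0]) (by positivity)
    refine (lintegral_mono e1).trans ?_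
    rw [lintegral_const_mul' _ _ ENNReal.ofReal_ne_top, lintegral_add_left (by
      have := measurable_fker (n := n) (s := s) (p := p); fun_prop),
      lintegral_const_mul' _ _ ENNReal.ofReal_ne_top, hJv]
    calc _ ≤ ENNReal.ofReal (2 ^ (p - 1)) * (ENNReal.ofReal (h ^ (p - 1)) * ENNReal.ofReal J +
          ENNReal.ofReal (h ^ (p - 1))) := by gcongr
      _ = _ := by
        rw [← ENNReal.ofReal_mul (by positivity), ← ENNReal.ofReal_add (by positivity)
          (by positivity), ← ENNReal.ofReal_mul (by positivity), hT₁]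
        congr 1; ring
  have hball : ∀ {g : ℝ → ℝ}, MonotoneOn g (Ici 0) →
      ∫⁻ x in ball (0 : Rn n) 1, ENNReal.ofReal (g (w x)) ≤
      ENNReal.ofReal (g h) * ENNReal.ofReal ω := fun {g} hg => by
    rw [← hωv, ← setLIntegral_const]
    refine lintegral_mono_ae ?_
    filter_upwards [hwh] with x hx
    exact ENNReal.ofReal_le_ofReal (hg (hw0 x) hh0.le hx)
  have hmono : ∀ {q : ℝ}, 0 ≤ q → MonotoneOn (fun t : ℝ => t ^ q) (Ici 0) :=
    fun hq a ha _ _ hab => Real.rpow_le_rpow ha hab hq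
  set A := ball (0 : Rn n) (1 / 2) ∩ {x | 1 ≤ v x} with hA
  have hAm : MeasurableSet A := measurableSet_ball.inter (measurableSet_le measurable_const hv.meas)
  have hAvol : ENNReal.ofReal (ω' / 2) ≤ volume A := by
    rw [div_eq_inv_mul, ENNReal.ofReal_mul (by norm_num), ENNReal.ofReal_inv_of_pos (by norm_num),
      ← hωv']
    rw [ENNReal.inv_mul_le_iff (by simp) (by simp)]
    simpa using hhalf
  have hcv := hcac _ hu (-h) (1 / 2) (1 / 2) (by norm_num) (by norm_num) (by norm_num)
  rw [show (1 : ℝ) / 2 + 1 / 2 = 1 by norm_num, ← hC₁, ← hw] at hcv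
  have hlow : ENNReal.ofReal b * ∫⁻ x in ball 0 (1 / 2), ENNReal.ofReal (w x) ≤
      ENNReal.ofReal (C₁ * (ω + ω * T₁) * h ^ p) := by
    rw [← lintegral_const_mul' _ _ ENNReal.ofReal_ne_top]
    refine le_trans (setLIntegral_mono' measurableSet_ball fun x hx => ?_) (hcv.trans ?_)
    · have := le_setLIntegral_superlevel H hh2 hx hAm inter_subset_left
        (v := v) (fun y hy => hy.2)
      refine le_trans ?_ (this.trans (lintegral_mono_set fun y hy =>
        ⟨ball_subset_ball (by norm_num) hy.1, ?_⟩))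
      · rw [hb, ENNReal.ofReal_mul (by positivity)]
        gcongr
      · have : 1 ≤ v y := hy.2
        show -v y ≤ -h
        linarith
    · calc _ ≤ ENNReal.ofReal C₁ * (ENNReal.ofReal (h ^ p) * ENNReal.ofReal ω +
            (ENNReal.ofReal h * ENNReal.ofReal ω) * ENNReal.ofReal (T₁ * h ^ (p - 1))) := by
            gcongr
            · exact hball (hmono hp.le)
            · exact hball (g := fun t => t) (fun _ _ _ _ hab => hab)
        _ = _ := by
            rw [← ENNReal.ofReal_mul (by positivity), ← ENNReal.ofReal_mul (by positivity),
              ← ENNReal.ofReal_mul (by positivity), ← ENNReal.ofReal_add (by positivity)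
              (by positivity), ← ENNReal.ofReal_mul (by positivity), hpq]
            congr 1; ring
  have hint : ∫⁻ x in ball 0 (1 / 2), ENNReal.ofReal (w x) ≤
      ENNReal.ofReal (b⁻¹ * (C₁ * (ω + ω * T₁) * h ^ p)) := by
    calc _ = ENNReal.ofReal b⁻¹ * (ENNReal.ofReal b *
          ∫⁻ x in ball 0 (1 / 2), ENNReal.ofReal (w x)) := by
          rw [← mul_assoc, ← ENNReal.ofReal_mul (by positivity), inv_mul_cancel₀ hb0.ne',
            ENNReal.ofReal_one, one_mul]
      _ ≤ ENNReal.ofReal b⁻¹ * ENNReal.ofReal (C₁ * (ω + ω * T₁) * h ^ p) := by gcongr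
      _ = _ := by rw [← ENNReal.ofReal_mul (by positivity)]
  have hsol := hu.mul_sub H (l := 2 / h) (by positivity) (-h)
  have htr : ∀ x, truncAbove (fun y => 2 / h * (-v y - -h)) 0 x = 2 / h * w x :=
    truncAbove_zero_mul (by positivity) _ _
  have hfin := hLB _ hsol (by
    simp only [htr]
    have e1 : ∀ᵐ x ∂volume.restrict (ball (0 : Rn n) (1 / 2)),
        ENNReal.ofReal ((2 / h * w x) ^ p) ≤
        ENNReal.ofReal (2 ^ p * h⁻¹) * ENNReal.ofReal (w x) := by
      have : ∀ᵐ x ∂volume.restrict (ball (0 : Rn n) (1 / 2)), w x ≤ h :=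
        ae_mono (Measure.restrict_mono (ball_subset_ball (by norm_num)) le_rfl) hwh
      filter_upwards [this] with x hx
      rw [← ENNReal.ofReal_mul (by positivity)]
      refine ENNReal.ofReal_le_ofReal ?_
      have hwp : w x ^ p = w x * w x ^ (p - 1) := by
        rw [← Real.rpow_one_add' (hw0 x) (by linarith)]; congr 1; ring
      rw [Real.mul_rpow (by positivity) (hw0 x), Real.div_rpow (by norm_num) hh0.le, hwp, hpq]
      have h1 := Real.rpow_le_rpow (hw0 x) hx hp1.le
      have h2 : 0 < h ^ (p - 1) := by positivity
      calc 2 ^ p / (h * h ^ (p - 1)) * (w x * w x ^ (p - 1)) ≤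
          2 ^ p / (h * h ^ (p - 1)) * (w x * h ^ (p - 1)) := by
            have := hw0 x
            gcongr
        _ = 2 ^ p * h⁻¹ * w x := by field_simp
    refine (lintegral_mono_ae e1).trans ?_
    rw [lintegral_const_mul' _ _ ENNReal.ofReal_ne_top]
    calc _ ≤ ENNReal.ofReal (2 ^ p * h⁻¹) *
          ENNReal.ofReal (b⁻¹ * (C₁ * (ω + ω * T₁) * h ^ p)) := by gcongr
      _ = ENNReal.ofReal (2 ^ p * (b⁻¹ * (C₁ * (ω + ω * T₁))) * h ^ (p - 1)) := by
          rw [← ENNReal.ofReal_mul (by positivity), hpq]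
          congr 1; field_simp
      _ ≤ _ := by
          refine ENNReal.ofReal_le_ofReal (le_trans ?_ hhε)
          gcongr
          linarith) (by
    simp only [htr]
    have e1 : ∀ y, ENNReal.ofReal ((2 / h * w y) ^ (p - 1) * fker n s p y) =
        ENNReal.ofReal ((2 / h) ^ (p - 1)) * ENNReal.ofReal (w y ^ (p - 1) * fker n s p y) :=
      fun y => by
        rw [← ENNReal.ofReal_mul (by positivity), ← mul_assoc,
          Real.mul_rpow (by positivity) (hw0 y)]
    simp only [e1]
    rw [lintegral_const_mul' _ _ ENNReal.ofReal_ne_top]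
    calc _ ≤ ENNReal.ofReal ((2 / h) ^ (p - 1)) *
          (ENNReal.ofReal D * (ENNReal.ofReal (h ^ (p - 1)) * ENNReal.ofReal ω) +
            ENNReal.ofReal (T₁ * h ^ (p - 1))) := by
          gcongr
          refine (setLIntegral_fker_annulus_le H (fun x => Real.rpow_nonneg (hw0 x) _)
            (by norm_num : (0 : ℝ) < 1 / 4)).trans ?_
          gcongr
          exact hball (hmono hp1.le)
      _ = _ := by
          rw [← ENNReal.ofReal_mul (by positivity), ← ENNReal.ofReal_mul (by positivity),
            ← ENNReal.ofReal_add (by positivity) (by positivity),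
            ← ENNReal.ofReal_mul (by positivity), hT, Real.div_rpow (by norm_num) hh0.le]
          have h2 : 0 < h ^ (p - 1) := by positivity
          congr 1; field_simp)
  filter_upwards [hfin] with x hx
  rw [div_mul_eq_mul_div, div_le_one hh0] at hx
  linarith

end Growth

section Rescaling

variable {n : ℕ} {s p L : ℝ}

lemma ae_comp_affine (x₀ : Rn n) {r : ℝ} (hr : 0 < r) {P : Rn n → Prop} (h : ∀ᵐ x, P x) :
    ∀ᵐ x, P (x₀ + r • x) := by
  have : Measure.QuasiMeasurePreserving (fun x : Rn n => x₀ + r • x) volume volume :=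
    ⟨(measurableEmbedding_affine x₀ hr).measurable, by
      rw [map_affine_volume x₀ hr]; exact Measure.smul_absolutelyContinuous⟩
  exact this.ae h

lemma ae_restrict_ball_comp_smul {r t σ : ℝ} (hσ : 0 < σ) (hr : σ * t ≤ r) {P : Rn n → Prop}
    (h : ∀ᵐ x ∂volume.restrict (ball (0 : Rn n) r), P x) :
    ∀ᵐ x ∂volume.restrict (ball (0 : Rn n) t), P (σ • x) := by
  rw [ae_restrict_iff' measurableSet_ball] at h ⊢
  filter_upwards [ae_comp_affine 0 hσ h] with x hx hxt
  rw [zero_add] at hx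
  refine hx (ball_subset_ball hr ?_)
  simpa using (affine_mem_ball 0 hσ x).1 hxt

lemma setLIntegral_fker_comp_smul (g : Rn n → ℝ) {σ r : ℝ} (hσ : 0 < σ) :
    ∫⁻ x in (ball (0 : Rn n) r)ᶜ, ENNReal.ofReal (g (σ • x) * fker n s p x) =
      ENNReal.ofReal (σ ^ (s * p)) *
        ∫⁻ x in (ball (0 : Rn n) (σ * r))ᶜ, ENNReal.ofReal (g x * fker n s p x) := by
  have hD : 0 < σ ^ ((n : ℝ) + s * p) := Real.rpow_pos_of_pos hσ _
  have e1 : ∀ x, ENNReal.ofReal (g (σ • x) * fker n s p x) =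
      (fun z => ENNReal.ofReal (σ ^ ((n : ℝ) + s * p)) * ENNReal.ofReal (g z * fker n s p z))
        (0 + σ • x) := by
    intro x
    rw [zero_add]
    simp only
    rw [← ENNReal.ofReal_mul hD.le, fker_smul hσ]
    congr 1; field_simp
  rw [lintegral_congr e1, setLIntegral_comp_affine 0 hσ
    (fun z => ENNReal.ofReal (σ ^ ((n : ℝ) + s * p)) * ENNReal.ofReal (g z * fker n s p z))
    measurableSet_ball.compl
    (measurableSet_ball (x := (0 : Rn n)) (ε := σ * r)).compl (fun x => by
      rw [mem_compl_iff, mem_compl_iff, affine_mem_ball 0 hσ]),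
    lintegral_const_mul' _ _ ENNReal.ofReal_ne_top, ← mul_assoc,
    ← ENNReal.ofReal_mul (by positivity), Real.rpow_add hσ, Real.rpow_natCast]
  congr 2
  field_simp

lemma lintegral_rpow_sub_one_le (hp : 1 < p) {f : Rn n → ℝ} (hf : ∀ x, 0 ≤ f x)
    {X : ℝ} (hX : 0 < X) (h : ∫⁻ x in ball (0 : Rn n) 1, ENNReal.ofReal (f x ^ qStar p) ≤
      ENNReal.ofReal (X ^ qStar p)) :
    ∫⁻ x in ball (0 : Rn n) 1, ENNReal.ofReal (f x ^ (p - 1)) ≤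
      ENNReal.ofReal ((1 + (volume (ball (0 : Rn n) 1)).toReal) * X ^ (p - 1)) := by
  set ω := (volume (ball (0 : Rn n) 1)).toReal with hω
  have hωv : volume (ball (0 : Rn n) 1) = ENNReal.ofReal ω :=
    (ENNReal.ofReal_toReal measure_ball_lt_top.ne).symm
  have hω0 : 0 ≤ ω := ENNReal.toReal_nonneg
  have e : ∀ x, ENNReal.ofReal (f x ^ (p - 1)) ≤ ENNReal.ofReal (X ^ (p - 1)) *
      (ENNReal.ofReal ((X ^ qStar p)⁻¹) * ENNReal.ofReal (f x ^ qStar p) + 1) := by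
    intro x
    have hfx := hf x
    rw [← ENNReal.ofReal_one, ← ENNReal.ofReal_mul (by positivity), ← ENNReal.ofReal_add
      (by positivity) zero_le_one, ← ENNReal.ofReal_mul (by positivity)]
    refine ENNReal.ofReal_le_ofReal ?_
    have h0 : 0 ≤ f x / X := by positivity
    have h1 : (f x / X) ^ (p - 1) ≤ (f x / X) ^ qStar p + 1 := by
      rcases le_or_gt (f x / X) 1 with hx | hx
      · linarith [Real.rpow_nonneg h0 (qStar p), Real.rpow_le_one h0 hx (sub_pos.2 hp).le]
      · linarith [Real.rpow_le_rpow_of_exponent_le hx.le (sub_one_le_qStar p)]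
    rw [Real.div_rpow hfx hX.le, Real.div_rpow hfx hX.le, div_le_iff₀ (by positivity)] at h1
    rw [inv_mul_eq_div, mul_comm]
    exact h1
  refine (lintegral_mono e).trans ?_
  rw [lintegral_const_mul' _ _ ENNReal.ofReal_ne_top, lintegral_add_right _ measurable_const,
    lintegral_const_mul' _ _ ENNReal.ofReal_ne_top, setLIntegral_one, hωv]
  calc _ ≤ ENNReal.ofReal (X ^ (p - 1)) * (ENNReal.ofReal ((X ^ qStar p)⁻¹) *
        ENNReal.ofReal (X ^ qStar p) + ENNReal.ofReal ω) := by gcongr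
    _ = _ := by
      rw [← ENNReal.ofReal_mul (by positivity), inv_mul_cancel₀ (by positivity),
        ← ENNReal.ofReal_add zero_le_one hω0, ← ENNReal.ofReal_mul (by positivity), mul_comm]

lemma le_rpow_of_rpow_inv_le {a q : ℝ} (ha : 0 ≤ a) (hq : 0 < q) {b : ℝ} (hb : a ^ q⁻¹ ≤ b) :
    a ≤ b ^ q := by
  calc a = (a ^ q⁻¹) ^ q := by rw [← Real.rpow_mul ha, inv_mul_cancel₀ hq.ne', Real.rpow_one]
    _ ≤ b ^ q := Real.rpow_le_rpow (by positivity) hb hq.le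

lemma Controlled.mono (hp : 1 < p) {v : Rn n → ℝ} {c X Y : ℝ} (h : Controlled n s p v c X)
    (hX : 0 ≤ X) (hXY : X ≤ Y) : Controlled n s p v c Y :=
  ⟨h.inner.trans (ENNReal.ofReal_le_ofReal (Real.rpow_le_rpow hX hXY (qStar_pos p).le)),
    h.outer.trans (ENNReal.ofReal_le_ofReal (Real.rpow_le_rpow hX hXY (by linarith)))⟩

lemma exists_controlled_comp_smul (H : Admissible n s p L) {σ : ℝ} (hσ : 0 < σ) :
    ∃ C : ℝ, 1 ≤ C ∧ ∀ (v : Rn n → ℝ) (c X ρ : ℝ), 0 < X → σ ≤ ρ → ρ ≤ 1 →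
      Controlled n s p v c X → Controlled n s p (fun x => v (ρ • x)) c (C * X) := by
  have hp1 := H.p_sub_pos
  have hq := qStar_pos p
  set ω := (volume (ball (0 : Rn n) 1)).toReal with hω
  have hω0 : 0 ≤ ω := ENNReal.toReal_nonneg
  set K₁ : ℝ := (σ ^ n)⁻¹ with hK₁
  set K₂ : ℝ := (σ ^ ((n : ℝ) + s * p))⁻¹ * (1 + ω) + 1 with hK₂
  have hK₁0 : 0 ≤ K₁ := by positivity
  have hK₂0 : 0 ≤ K₂ := by positivity
  set C := max 1 (max (K₁ ^ (qStar p)⁻¹) (K₂ ^ (p - 1)⁻¹)) with hC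
  have hC0 : 0 < C := lt_max_of_lt_left one_pos
  have hC₁ : K₁ ≤ C ^ qStar p :=
    le_rpow_of_rpow_inv_le hK₁0 hq ((le_max_left _ _).trans (le_max_right _ _))
  have hC₂ : K₂ ≤ C ^ (p - 1) :=
    le_rpow_of_rpow_inv_le hK₂0 hp1 ((le_max_right _ _).trans (le_max_right _ _))
  refine ⟨C, le_max_left _ _, fun v c X ρ hX hσρ hρ1 hv => ?_⟩
  have hρ : 0 < ρ := hσ.trans_le hσρ
  constructor
  · have := setLIntegral_comp_affine (0 : Rn n) hρ
      (fun z => ENNReal.ofReal (|v z - c| ^ qStar p)) measurableSet_ball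
      measurableSet_ball (affine_mem_ball (t := 1) 0 hρ)
    simp only [zero_add, mul_one] at this
    rw [this, Real.mul_rpow hC0.le hX.le, ENNReal.ofReal_mul (by positivity)]
    gcongr
    · refine le_trans ?_ hC₁
      rw [hK₁]; gcongr
    · exact (lintegral_mono_set (ball_subset_ball hρ1)).trans hv.inner
  · rw [setLIntegral_fker_comp_smul (fun z => |v z - c| ^ (p - 1)) hρ, mul_one]
    have h1 : ρ ^ (s * p) ≤ 1 := Real.rpow_le_one hρ.le hρ1 H.sp_pos.le
    calc _ ≤ ENNReal.ofReal 1 * (ENNReal.ofReal ((ρ ^ ((n : ℝ) + s * p))⁻¹) *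
          ENNReal.ofReal ((1 + ω) * X ^ (p - 1)) + ENNReal.ofReal (X ^ (p - 1))) := by
          gcongr
          refine (setLIntegral_fker_annulus_le H (fun x => Real.rpow_nonneg (abs_nonneg _) _)
            hρ).trans ?_
          gcongr
          · exact lintegral_rpow_sub_one_le H.one_lt_p (fun x => abs_nonneg _) hX hv.inner
          · exact hv.outer
      _ = ENNReal.ofReal (((ρ ^ ((n : ℝ) + s * p))⁻¹ * (1 + ω) + 1) * X ^ (p - 1)) := by
          rw [ENNReal.ofReal_one, one_mul, ← ENNReal.ofReal_mul (by positivity),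
            ← ENNReal.ofReal_add (by positivity) (by positivity)]
          congr 1; ring
      _ ≤ ENNReal.ofReal (C ^ (p - 1) * X ^ (p - 1)) := by
          refine ENNReal.ofReal_le_ofReal ?_
          gcongr
          refine le_trans ?_ hC₂
          rw [hK₂]
          have := H.exponent_pos
          gcongr
      _ = _ := by rw [Real.mul_rpow hC0.le hX.le]

end Rescaling

section OscillationDecay

variable {n : ℕ} {s p L : ℝ}

/-- A solution in the unit ball which is bounded by `1` there and whose tail is bounded by `T`. -/
structure Normalized (n : ℕ) (s p L T : ℝ) (u : Rn n → ℝ) : Prop where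
  sol : IsSol n s p L (ball 0 1) u
  bdd : ∀ᵐ x ∂volume.restrict (ball (0 : Rn n) 1), |u x| ≤ 1
  tail : ∫⁻ x in (ball (0 : Rn n) 1)ᶜ, ENNReal.ofReal (|u x| ^ (p - 1) * fker n s p x) ≤
    ENNReal.ofReal T

lemma Normalized.neg (H : Admissible n s p L) {T : ℝ} {u : Rn n → ℝ}
    (h : Normalized n s p L T u) : Normalized n s p L T (fun x => -u x) := by
  refine ⟨?_, by simpa using h.bdd, by simpa using h.tail⟩
  simpa using h.sol.mul_sub H (l := -1) (by norm_num) 0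

lemma setLIntegral_fker_comp_smul_le {g : Rn n → ℝ} {m T J σ : ℝ}
    (hm : 0 ≤ m) (hT : 0 ≤ T) (hJ : 0 ≤ J) (hσ : 0 < σ)
    (hJe : ∫⁻ x in (ball (0 : Rn n) 1)ᶜ, ENNReal.ofReal (fker n s p x) = ENNReal.ofReal J)
    (hgm : ∀ᵐ x ∂volume.restrict (ball (0 : Rn n) 1), g x ≤ m)
    (hgT : ∫⁻ x in (ball (0 : Rn n) 1)ᶜ, ENNReal.ofReal (g x * fker n s p x) ≤
      ENNReal.ofReal T) :
    ∫⁻ x in (ball (0 : Rn n) 1)ᶜ, ENNReal.ofReal (g (σ • x) * fker n s p x) ≤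
      ENNReal.ofReal (m * J + σ ^ (s * p) * T) := by
  have h1 : (ball (0 : Rn n) σ)ᶜ ⊆ (ball 0 1 \ ball 0 σ) ∪ (ball 0 1)ᶜ := by
    intro x hx
    by_cases h : x ∈ ball (0 : Rn n) 1
    · exact Or.inl ⟨h, hx⟩
    · exact Or.inr h
  have h2 : ∫⁻ x in ball (0 : Rn n) 1 \ ball 0 σ, ENNReal.ofReal (g x * fker n s p x) ≤
      ENNReal.ofReal m * ∫⁻ x in (ball (0 : Rn n) σ)ᶜ, ENNReal.ofReal (fker n s p x) := by
    calc _ ≤ ∫⁻ x in ball (0 : Rn n) 1 \ ball 0 σ,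
          ENNReal.ofReal m * ENNReal.ofReal (fker n s p x) := by
          refine lintegral_mono_ae ?_
          filter_upwards [ae_restrict_of_ae_restrict_of_subset sdiff_subset hgm] with x hx
          rw [← ENNReal.ofReal_mul hm]
          exact ENNReal.ofReal_le_ofReal (mul_le_mul_of_nonneg_right hx (fker_nonneg _))
      _ = ENNReal.ofReal m *
          ∫⁻ x in ball (0 : Rn n) 1 \ ball 0 σ, ENNReal.ofReal (fker n s p x) :=
          lintegral_const_mul' _ _ ENNReal.ofReal_ne_top
      _ ≤ _ := by gcongr; exact fun x hx => hx.2
  have h3 := setLIntegral_fker_comp_smul (n := n) (s := s) (p := p) (r := 1) (fun _ => 1) hσ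
  simp only [one_mul, mul_one, hJe] at h3
  rw [setLIntegral_fker_comp_smul g hσ, mul_one]
  have hσ' : 0 ≤ σ ^ (s * p) := by positivity
  calc _ ≤ ENNReal.ofReal (σ ^ (s * p)) * (ENNReal.ofReal m *
        (∫⁻ x in (ball (0 : Rn n) σ)ᶜ, ENNReal.ofReal (fker n s p x)) + ENNReal.ofReal T) := by
        gcongr
        exact (lintegral_mono_set h1).trans ((lintegral_union_le _ _ _).trans (add_le_add h2 hgT))
    _ = _ := by
        rw [mul_add, mul_left_comm, ← h3, ← ENNReal.ofReal_mul hm, ← ENNReal.ofReal_mul hσ',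
          ← ENNReal.ofReal_add (by positivity) (by positivity)]

lemma lower_bound_of_growth (H : Admissible n s p L) {h J T τ : ℝ} (hJ : 0 ≤ J) (hT : 0 ≤ T)
    (hJe : ∫⁻ x in (ball (0 : Rn n) 1)ᶜ, ENNReal.ofReal (fker n s p x) = ENNReal.ofReal J)
    (hgrowth : ∀ v : Rn n → ℝ, IsSol n s p L (ball 0 1) v →
      (∀ᵐ x ∂volume.restrict (ball (0 : Rn n) 1), 0 ≤ v x) →
      volume (ball (0 : Rn n) (1 / 2)) ≤ 2 * volume (ball (0 : Rn n) (1 / 2) ∩ {x | 1 ≤ v x}) →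
      ∫⁻ y in (ball (0 : Rn n) 1)ᶜ, ENNReal.ofReal (max (-v y) 0 ^ (p - 1) * fker n s p y) ≤
        ENNReal.ofReal (h ^ (p - 1)) →
      ∀ᵐ x ∂volume.restrict (ball (0 : Rn n) (1 / 4)), h / 2 ≤ v x)
    (hτ : 0 < τ) (hτ1 : τ ≤ 1) (hτT : τ ^ (s * p) * T ≤ h ^ (p - 1)) {u : Rn n → ℝ}
    (hu : Normalized n s p L T u)
    (hvol : volume (ball (0 : Rn n) (1 / 2)) ≤
      2 * volume (ball (0 : Rn n) (1 / 2) ∩ {x | 0 ≤ u (τ • x)})) :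
    ∀ᵐ x ∂volume.restrict (ball (0 : Rn n) 1), h / 2 - 1 ≤ u ((τ / 4) • x) := by
  have hp1 := H.p_sub_pos
  have hsol : IsSol n s p L (ball 0 1) (fun x => u (τ • x) + 1) := by
    have := hu.sol.affine H 0 (O' := ball 0 1) (-1) hτ one_ne_zero (fun x hx => by
      rw [affine_mem_ball 0 hτ] at hx
      exact ball_subset_ball (by linarith) hx)
    simpa using this
  have key := hgrowth _ hsol ?_ ?_ ?_
  · have := ae_restrict_ball_comp_smul (σ := 1 / 4) (t := 1) (by norm_num) (by norm_num) key
    filter_upwards [this] with x hx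
    rw [smul_smul, mul_one_div] at hx
    linarith
  · filter_upwards [ae_restrict_ball_comp_smul hτ (t := 1) (by linarith) hu.bdd] with x hx
    linarith [(abs_le.1 hx).1]
  · refine hvol.trans ?_
    refine mul_le_mul_right (measure_mono (inter_subset_inter_right _ fun x hx => ?_)) 2
    simpa using hx
  · refine (setLIntegral_fker_comp_smul_le (g := fun z => max (-(u z + 1)) 0 ^ (p - 1)) le_rfl hT
      hJ hτ hJe ?_ ?_).trans (ENNReal.ofReal_le_ofReal (by linarith))
    · filter_upwards [hu.bdd] with x hx
      rw [max_eq_right (by linarith [(abs_le.1 hx).1]), Real.zero_rpow hp1.ne']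
    · refine le_trans (lintegral_mono fun x => ENNReal.ofReal_le_ofReal ?_) hu.tail
      refine mul_le_mul_of_nonneg_right (Real.rpow_le_rpow (le_max_right _ _) ?_ hp1.le)
        (fker_nonneg _)
      exact max_le (by linarith [neg_abs_le (u x)]) (abs_nonneg _)

lemma Normalized.rescale (H : Admissible n s p L) {J T σ μ : ℝ} (hJ : 0 ≤ J)
    (hJe : ∫⁻ x in (ball (0 : Rn n) 1)ᶜ, ENNReal.ofReal (fker n s p x) = ENNReal.ofReal J)
    (hT : T = 4 ^ (p - 1) * (2 * J + 1)) (hσ : 0 < σ) (hσ1 : σ ≤ 1)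
    (hσT : σ ^ (s * p) * T ≤ 1) (hμ : 0 < μ) (hμ1 : μ ≤ 1 / 2) {u : Rn n → ℝ}
    (hu : Normalized n s p L T u)
    (hl : ∀ᵐ x ∂volume.restrict (ball (0 : Rn n) 1), 2 * μ - 1 ≤ u (σ • x)) :
    Normalized n s p L T (fun x => (1 - μ)⁻¹ * (u (σ • x) - μ)) := by
  have hp1 := H.p_sub_pos
  have hT0 : 0 ≤ T := by rw [hT]; positivity
  have hμ' : 0 < 1 - μ := by linarith
  refine ⟨?_, ?_, ?_⟩
  · have := hu.sol.affine H 0 (O' := ball 0 1) μ hσ (inv_ne_zero hμ'.ne') (fun x hx => by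
      rw [affine_mem_ball 0 hσ] at hx
      exact ball_subset_ball (by linarith) hx)
    simpa using this
  · filter_upwards [hl, ae_restrict_ball_comp_smul hσ (t := 1) (by linarith) hu.bdd] with x hx hx'
    rw [abs_mul, abs_of_pos (inv_pos.2 hμ'), inv_mul_le_iff₀ hμ', abs_le]
    constructor <;> linarith [(abs_le.1 hx').2]
  · have h1 : ∫⁻ x in (ball (0 : Rn n) 1)ᶜ,
        ENNReal.ofReal (|u (σ • x)| ^ (p - 1) * fker n s p x) ≤
        ENNReal.ofReal (1 * J + σ ^ (s * p) * T) := by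
      refine setLIntegral_fker_comp_smul_le (g := fun z => |u z| ^ (p - 1)) zero_le_one hT0 hJ
        hσ hJe ?_ hu.tail
      filter_upwards [hu.bdd] with x hx
      exact Real.rpow_le_one (abs_nonneg _) hx hp1.le
    have h2 : ∀ x, ENNReal.ofReal (|(1 - μ)⁻¹ * (u (σ • x) - μ)| ^ (p - 1) * fker n s p x) ≤
        ENNReal.ofReal (4 ^ (p - 1)) * (ENNReal.ofReal (|u (σ • x)| ^ (p - 1) * fker n s p x) +
          ENNReal.ofReal (fker n s p x)) := by
      intro x
      have hf := fker_nonneg (n := n) (s := s) (p := p) x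
      rw [← ENNReal.ofReal_add (by positivity) hf, ← ENNReal.ofReal_mul (by positivity)]
      refine ENNReal.ofReal_le_ofReal ?_
      have e1 : |(1 - μ)⁻¹ * (u (σ • x) - μ)| ≤ 2 * |u (σ • x) - μ| := by
        rw [abs_mul, abs_of_pos (inv_pos.2 hμ')]
        gcongr
        rw [inv_le_comm₀ hμ' two_pos]; linarith
      have e2 : μ ^ (p - 1) ≤ 1 := Real.rpow_le_one hμ.le (by linarith) hp1.le
      calc _ ≤ (2 * |u (σ • x) - μ|) ^ (p - 1) * fker n s p x := by gcongr
        _ = 2 ^ (p - 1) * |u (σ • x) - μ| ^ (p - 1) * fker n s p x := by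
          rw [Real.mul_rpow zero_le_two (abs_nonneg _)]
        _ ≤ 2 ^ (p - 1) * (2 ^ (p - 1) * (|u (σ • x)| ^ (p - 1) + |μ| ^ (p - 1))) *
            fker n s p x := by
          gcongr
          exact abs_sub_rpow_le _ _ hp1.le
        _ ≤ 2 ^ (p - 1) * (2 ^ (p - 1) * (|u (σ • x)| ^ (p - 1) + 1)) * fker n s p x := by
          rw [abs_of_pos hμ]; gcongr
        _ = _ := by
          rw [show (4 : ℝ) = 2 * 2 by norm_num, Real.mul_rpow zero_le_two zero_le_two]; ring
    refine (lintegral_mono h2).trans ?_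
    rw [lintegral_const_mul' _ _ ENNReal.ofReal_ne_top,
      lintegral_add_right _ measurable_fker.ennreal_ofReal, hJe, hT]
    calc _ ≤ ENNReal.ofReal (4 ^ (p - 1)) *
          (ENNReal.ofReal (1 * J + σ ^ (s * p) * T) + ENNReal.ofReal J) := by gcongr
      _ ≤ _ := by
        rw [← ENNReal.ofReal_add (by positivity) hJ, ← ENNReal.ofReal_mul (by positivity)]
        refine ENNReal.ofReal_le_ofReal ?_
        refine mul_le_mul_of_nonneg_left ?_ (by positivity)
        linarith

lemma exists_oscillation_step (H : Admissible n s p L) :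
    ∃ T μ σ : ℝ, 0 < T ∧ 0 < μ ∧ μ < 1 ∧ 0 < σ ∧ σ < 1 ∧ ∀ u : Rn n → ℝ,
      Normalized n s p L T u → ∃ c : ℝ,
        Normalized n s p L T (fun x => (1 - μ)⁻¹ * (u (σ • x) - c)) := by
  obtain ⟨h, h0, h1, hgrowth⟩ := growth H
  have hp1 := H.p_sub_pos
  have hsp := H.sp_pos
  set J := (∫⁻ x in (ball (0 : Rn n) 1)ᶜ, ENNReal.ofReal (fker n s p x)).toReal with hJd
  have hJ : 0 ≤ J := ENNReal.toReal_nonneg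
  have hJe : ∫⁻ x in (ball (0 : Rn n) 1)ᶜ, ENNReal.ofReal (fker n s p x) = ENNReal.ofReal J :=
    (ENNReal.ofReal_toReal (lintegral_fker_far_lt_top H).ne).symm
  obtain ⟨T, hT⟩ : ∃ T : ℝ, T = 4 ^ (p - 1) * (2 * J + 1) := ⟨_, rfl⟩
  have hT0 : 0 < T := by rw [hT]; positivity
  have hm : 0 < h ^ (p - 1) := by positivity
  set τ := min 1 ((h ^ (p - 1) / T) ^ (s * p)⁻¹) with hτd
  have hτ : 0 < τ := by positivity
  have hτ1 : τ ≤ 1 := min_le_left _ _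
  have hτT : τ ^ (s * p) * T ≤ h ^ (p - 1) := by
    rw [← le_div_iff₀ hT0]
    calc τ ^ (s * p) ≤ ((h ^ (p - 1) / T) ^ (s * p)⁻¹) ^ (s * p) :=
          Real.rpow_le_rpow hτ.le (min_le_right _ _) hsp.le
      _ = _ := by rw [← Real.rpow_mul (by positivity), inv_mul_cancel₀ hsp.ne', Real.rpow_one]
  have hσT : (τ / 4) ^ (s * p) * T ≤ 1 := by
    have e1 : (τ / 4) ^ (s * p) ≤ τ ^ (s * p) :=
      Real.rpow_le_rpow (by positivity) (by linarith) hsp.le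
    have e2 : h ^ (p - 1) ≤ 1 := Real.rpow_le_one h0.le (by linarith) hp1.le
    nlinarith
  have key : ∀ u : Rn n → ℝ, Normalized n s p L T u →
      volume (ball (0 : Rn n) (1 / 2)) ≤
        2 * volume (ball (0 : Rn n) (1 / 2) ∩ {x | 0 ≤ u (τ • x)}) →
      Normalized n s p L T (fun x => (1 - h / 4)⁻¹ * (u ((τ / 4) • x) - h / 4)) := by
    intro u hu hvol
    refine hu.rescale H hJ hJe hT (by positivity) (by linarith) hσT (by positivity)
      (by linarith) ?_
    filter_upwards [lower_bound_of_growth H hJ hT0.le hJe hgrowth hτ hτ1 hτT hu hvol] with x hx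
    linarith
  refine ⟨T, h / 4, τ / 4, hT0, by positivity, by linarith, by positivity, by linarith,
    fun u hu => ?_⟩
  by_cases hvol : volume (ball (0 : Rn n) (1 / 2)) ≤
      2 * volume (ball (0 : Rn n) (1 / 2) ∩ {x | 0 ≤ u (τ • x)})
  · exact ⟨_, key u hu hvol⟩
  · have hvol' : volume (ball (0 : Rn n) (1 / 2)) ≤
        2 * volume (ball (0 : Rn n) (1 / 2) ∩ {x | 0 ≤ -u (τ • x)}) := by
      set A := volume (ball (0 : Rn n) (1 / 2) ∩ {x | 0 ≤ u (τ • x)}) with hA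
      set B := volume (ball (0 : Rn n) (1 / 2) ∩ {x | 0 ≤ -u (τ • x)}) with hB
      have hAB : volume (ball (0 : Rn n) (1 / 2)) ≤ A + B := by
        refine (measure_mono fun x hx => ?_).trans (measure_union_le _ _)
        rcases le_total 0 (u (τ • x)) with h' | h'
        · exact Or.inl ⟨hx, h'⟩
        · exact Or.inr ⟨hx, neg_nonneg.2 h'⟩
      have hBA : A ≤ B := by
        by_contra! hlt
        exact hvol (hAB.trans (by rw [two_mul]; gcongr))
      exact hAB.trans (by rw [two_mul]; gcongr)
    refine ⟨-(h / 4), ?_⟩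
    convert (key _ (hu.neg H) hvol').neg H using 2
    ring

end OscillationDecay

section CampanatoDecay

variable {n : ℕ} {s p L : ℝ}

lemma Controlled.of_mul_sub {v : Rn n → ℝ} {c X l : ℝ} (hX : 0 ≤ X) (hl : 0 < l)
    (h : Controlled n s p (fun x => l * (v x - c)) 0 X) : Controlled n s p v c (l⁻¹ * X) := by
  have := h.mul_sub hX l⁻¹
  rw [abs_of_pos (inv_pos.2 hl)] at this
  constructor
  · simpa [inv_mul_cancel_left₀ hl.ne'] using this.inner
  · simpa [inv_mul_cancel_left₀ hl.ne'] using this.outer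

lemma Normalized.exists_controlled (H : Admissible n s p L) {T : ℝ} (hT : 0 ≤ T) :
    ∃ C : ℝ, 1 ≤ C ∧ ∀ u : Rn n → ℝ, Normalized n s p L T u → Controlled n s p u 0 C := by
  have hp1 := H.p_sub_pos
  have hq := qStar_pos p
  set ω := (volume (ball (0 : Rn n) 1)).toReal with hω
  have hωv : volume (ball (0 : Rn n) 1) = ENNReal.ofReal ω :=
    (ENNReal.ofReal_toReal measure_ball_lt_top.ne).symm
  refine ⟨max 1 (max (ω ^ (qStar p)⁻¹) (T ^ (p - 1)⁻¹)), le_max_left _ _, fun u hu => ⟨?_, ?_⟩⟩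
  · calc _ ≤ ∫⁻ x in ball (0 : Rn n) 1, 1 := by
          refine lintegral_mono_ae ?_
          filter_upwards [hu.bdd] with x hx
          rw [sub_zero, ← ENNReal.ofReal_one]
          exact ENNReal.ofReal_le_ofReal (Real.rpow_le_one (abs_nonneg _) hx hq.le)
      _ = ENNReal.ofReal ω := by rw [setLIntegral_one, hωv]
      _ ≤ _ := ENNReal.ofReal_le_ofReal (le_rpow_of_rpow_inv_le ENNReal.toReal_nonneg hq
          ((le_max_left _ _).trans (le_max_right _ _)))
  · simp only [sub_zero]
    exact hu.tail.trans (ENNReal.ofReal_le_ofReal (le_rpow_of_rpow_inv_le hT hp1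
      ((le_max_right _ _).trans (le_max_right _ _))))

lemma Normalized.iterate {T l σ : ℝ} (hl : 0 < l)
    (hstep : ∀ u : Rn n → ℝ, Normalized n s p L T u →
      ∃ c : ℝ, Normalized n s p L T (fun x => l * (u (σ • x) - c)))
    {u : Rn n → ℝ} (hu : Normalized n s p L T u) (j : ℕ) :
    ∃ c : ℝ, Normalized n s p L T (fun x => l ^ j * (u (σ ^ j • x) - c)) := by
  induction j with
  | zero => exact ⟨0, by simpa using hu⟩
  | succ j ih =>
    obtain ⟨c, hc⟩ := ih
    obtain ⟨c', hc'⟩ := hstep _ hc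
    refine ⟨c + c' / l ^ j, ?_⟩
    convert hc' using 2 with x
    rw [smul_smul, ← pow_succ]
    field_simp
    ring

lemma exists_normalized (H : Admissible n s p L) {T : ℝ} (hT : 0 < T) :
    ∃ N : ℝ, 0 < N ∧ ∀ (v : Rn n → ℝ) (c X : ℝ), IsSol n s p L (ball 0 1) v → 0 < X →
      Controlled n s p v c X →
      Normalized n s p L T (fun x => (N * X)⁻¹ * (v ((1 / 4 : ℝ) • x) - c)) := by
  have hp1 := H.p_sub_pos
  obtain ⟨M, hM1, hM⟩ := local_boundedness H
  obtain ⟨C, hC1, hC⟩ := exists_controlled_comp_smul H (σ := 1 / 4) (by norm_num)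
  have hT' : 0 < T ^ (p - 1)⁻¹ := by positivity
  have hN0 : 0 < max M (C / T ^ (p - 1)⁻¹) := lt_max_of_lt_left (by linarith)
  refine ⟨max M (C / T ^ (p - 1)⁻¹), hN0, fun v c X hv hX hc => ?_⟩
  have hMN : M ≤ max M (C / T ^ (p - 1)⁻¹) := le_max_left _ _
  have hCN : C / T ^ (p - 1)⁻¹ ≤ max M (C / T ^ (p - 1)⁻¹) := le_max_right _ _
  generalize max M (C / T ^ (p - 1)⁻¹) = N at hN0 hMN hCN ⊢
  have hl : 0 < (N * X)⁻¹ := by positivity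
  refine ⟨?_, ?_, ?_⟩
  · have := hv.affine H 0 (O' := ball 0 1) (σ := 1 / 4) c (by norm_num) hl.ne' (fun x hx => by
      rw [affine_mem_ball 0 (r := 1 / 4) (by norm_num)] at hx
      exact ball_subset_ball (by norm_num) hx)
    simpa using this
  · filter_upwards [ae_restrict_ball_comp_smul (σ := 1 / 4) (t := 1) (by norm_num) (by norm_num)
      (hM v c X hv hX hc)] with x hx
    rw [abs_mul, abs_of_pos hl, inv_mul_le_iff₀ (by positivity), mul_one]
    exact hx.trans (by gcongr)
  · have h1 := ((hC v c X (1 / 4) hX le_rfl (by norm_num) hc).mul_sub (by positivity)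
      (N * X)⁻¹).outer
    simp only [sub_zero] at h1
    refine h1.trans (ENNReal.ofReal_le_ofReal ?_)
    have h2 : |(N * X)⁻¹| * (C * X) = C / N := by
      rw [abs_of_pos hl]; field_simp
    rw [h2]
    calc (C / N) ^ (p - 1) ≤ (T ^ (p - 1)⁻¹) ^ (p - 1) := by
          refine Real.rpow_le_rpow (by positivity) ?_ hp1.le
          rw [div_le_iff₀ hT'] at hCN
          rw [div_le_iff₀ hN0]; linarith
      _ = T := by rw [← Real.rpow_mul hT.le, inv_mul_cancel₀ hp1.ne', Real.rpow_one]

theorem exists_controlled_decay (H : Admissible n s p L) :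
    ∃ α C : ℝ, 0 < α ∧ 1 ≤ C ∧ ∀ (v : Rn n → ℝ) (c X ρ : ℝ), IsSol n s p L (ball 0 1) v →
      0 < X → Controlled n s p v c X → 0 < ρ → ρ ≤ 1 →
      ∃ c' : ℝ, Controlled n s p (fun x => v (ρ • x)) c' (C * ρ ^ α * X) := by
  have hp := H.one_lt_p
  obtain ⟨T, μ, σ, hT, hμ, hμ1, hσ, hσ1, hstep⟩ := exists_oscillation_step H
  obtain ⟨N, hN, hnorm⟩ := exists_normalized H hT
  obtain ⟨A, hA, hcon⟩ := Normalized.exists_controlled H hT.le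
  obtain ⟨C₁, hC₁, hres₁⟩ := exists_controlled_comp_smul H (σ := 1 / 4) (by norm_num)
  obtain ⟨C₂, hC₂, hres₂⟩ := exists_controlled_comp_smul H hσ
  have hμ' : 0 < 1 - μ := by linarith
  have hα : 0 < Real.logb σ (1 - μ) := Real.logb_pos_of_base_lt_one hσ hσ1 hμ' (by linarith)
  have hσα : σ ^ Real.logb σ (1 - μ) = 1 - μ := Real.rpow_logb hσ hσ1.ne hμ'
  generalize Real.logb σ (1 - μ) = α at hα hσα
  have hB₁ := le_max_left (C₁ * 4 ^ α) (C₂ * (N * A * (1 - μ)⁻¹ * 4 ^ α))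
  have hB₂ := le_max_right (C₁ * 4 ^ α) (C₂ * (N * A * (1 - μ)⁻¹ * 4 ^ α))
  refine ⟨α, max (C₁ * 4 ^ α) (C₂ * (N * A * (1 - μ)⁻¹ * 4 ^ α)), hα,
    le_trans ?_ hB₁, fun v c X ρ hv hX hc hρ hρ1 => ?_⟩
  · exact one_le_mul_of_one_le_of_one_le hC₁ (Real.one_le_rpow (by norm_num) hα.le)
  generalize max (C₁ * 4 ^ α) (C₂ * (N * A * (1 - μ)⁻¹ * 4 ^ α)) = B at hB₁ hB₂ ⊢
  rcases le_or_gt (1 / 4) ρ with h4 | h4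
  · refine ⟨c, (hres₁ v c X ρ hX h4 hρ1 hc).mono hp (by positivity) ?_⟩
    have h1 : 1 ≤ 4 ^ α * ρ ^ α := by
      rw [← Real.mul_rpow (by norm_num) hρ.le]
      exact Real.one_le_rpow (by linarith) hα.le
    gcongr
    calc C₁ ≤ C₁ * (4 ^ α * ρ ^ α) := le_mul_of_one_le_right (by positivity) h1
      _ = C₁ * 4 ^ α * ρ ^ α := by ring
      _ ≤ B * ρ ^ α := by gcongr
  · obtain ⟨j, hj1, hj2⟩ := exists_nat_pow_near_of_lt_one (x := 4 * ρ) (by positivity)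
      (by linarith) hσ hσ1
    have hl : 0 < (1 - μ)⁻¹ := inv_pos.2 hμ'
    obtain ⟨d, hd⟩ := (hnorm v c X hv hX hc).iterate hl hstep j
    have hσj : 0 < σ ^ j := by positivity
    have h1 : Controlled n s p (fun x => v ((1 / 4 * σ ^ j) • x)) (c + N * X * d)
        (N * X * (1 - μ) ^ j * A) := by
      have e : (N * X * (1 - μ) ^ j) = (((1 - μ)⁻¹) ^ j * (N * X)⁻¹)⁻¹ := by
        rw [mul_inv, inv_inv, inv_pow, inv_inv, mul_comm]
      rw [e]
      refine Controlled.of_mul_sub (by linarith) (by positivity) ?_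
      convert hcon _ hd using 2 with x
      rw [smul_smul]
      field_simp
      ring
    have h2 := hres₂ _ _ _ (4 * ρ / σ ^ j) (by positivity)
      ((le_div_iff₀ hσj).2 (by rw [← pow_succ']; exact hj1.le)) ((div_le_one₀ hσj).2 hj2) h1
    refine ⟨c + N * X * d, ?_⟩
    have e : ∀ x : Rn n, (1 / 4 * σ ^ j) • (4 * ρ / σ ^ j) • x = ρ • x := by
      intro x
      rw [smul_smul]; congr 1; field_simp
    simp only [e] at h2
    refine h2.mono hp (by positivity) ?_
    have h3 : (1 - μ) ^ j ≤ (1 - μ)⁻¹ * (4 ^ α * ρ ^ α) := by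
      rw [← Real.mul_rpow (by norm_num) hρ.le]
      calc (1 - μ) ^ j = (1 - μ)⁻¹ * (1 - μ) ^ (j + 1) := by
            rw [pow_succ']; field_simp
        _ = (1 - μ)⁻¹ * (σ ^ (j + 1)) ^ α := by
            rw [← hσα, ← Real.rpow_natCast, ← Real.rpow_natCast, ← Real.rpow_mul hσ.le,
              ← Real.rpow_mul hσ.le, mul_comm α]
        _ ≤ _ := by gcongr
    calc C₂ * (N * X * (1 - μ) ^ j * A) ≤
          C₂ * (N * X * ((1 - μ)⁻¹ * (4 ^ α * ρ ^ α)) * A) := by gcongr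
      _ = C₂ * (N * A * (1 - μ)⁻¹ * 4 ^ α) * ρ ^ α * X := by ring
      _ ≤ B * ρ ^ α * X := by gcongr

end CampanatoDecay

section Excess

variable {n : ℕ} {s p L : ℝ}

lemma inv_volume_mul_setLIntegral_ball (H : Admissible n s p L) (x₀ : Rn n) {r : ℝ} (hr : 0 < r)
    (f : Rn n → ℝ≥0∞) :
    (volume (ball x₀ r))⁻¹ * ∫⁻ x in ball x₀ r, f x =
      (volume (ball (0 : Rn n) 1))⁻¹ * ∫⁻ x in ball (0 : Rn n) 1, f (x₀ + r • x) := by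
  have := H.nontrivial
  have hb : volume (ball (0 : Rn n) 1) ≠ 0 := (measure_ball_pos _ _ one_pos).ne'
  rw [setLIntegral_comp_affine x₀ hr f measurableSet_ball measurableSet_ball
    (affine_mem_ball x₀ hr), mul_one, Measure.addHaar_ball _ _ hr.le, finrank_euclideanSpace_fin,
    ENNReal.mul_inv (Or.inr measure_ball_lt_top.ne) (Or.inr hb),
    ENNReal.ofReal_inv_of_pos (by positivity), ← mul_assoc, mul_comm (ENNReal.ofReal _)⁻¹]

lemma tailFn_eq (f : Rn n → ℝ) (x₀ : Rn n) {r : ℝ} (hr : 0 < r) :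
    tailFn n s p f x₀ r = (∫⁻ x in (ball (0 : Rn n) 1)ᶜ,
      ENNReal.ofReal (|f (x₀ + r • x)| ^ (p - 1) * fker n s p x)) ^ (1 / (p - 1)) := by
  unfold tailFn
  congr 1
  have h1 : ∀ x : Rn n, ENNReal.ofReal (|f (x₀ + r • x)| ^ (p - 1) * fker n s p x) =
      ENNReal.ofReal (r ^ ((n : ℝ) + s * p)) * (fun z => ENNReal.ofReal
        (|f z| ^ (p - 1) / ‖z - x₀‖ ^ ((n : ℝ) + s * p))) (x₀ + r • x) := by
    intro x
    simp only
    rw [← ENNReal.ofReal_mul (by positivity), add_sub_cancel_left, div_eq_mul_inv]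
    have := fker_smul (n := n) (s := s) (p := p) hr x
    rw [fker] at this
    rw [this]
    have hD : 0 < r ^ ((n : ℝ) + s * p) := Real.rpow_pos_of_pos hr _
    congr 1; field_simp
  rw [lintegral_congr h1, lintegral_const_mul' _ _ ENNReal.ofReal_ne_top,
    setLIntegral_comp_affine x₀ hr (fun z => ENNReal.ofReal
        (|f z| ^ (p - 1) / ‖z - x₀‖ ^ ((n : ℝ) + s * p))) measurableSet_ball.compl
      (measurableSet_ball (x := x₀) (ε := r)).compl (fun x => by
      rw [mem_compl_iff, mem_compl_iff, affine_mem_ball x₀ hr, mul_one]),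
    ← mul_assoc, ← ENNReal.ofReal_mul (by positivity), Real.rpow_add hr, Real.rpow_natCast]
  congr 2
  field_simp

lemma exists_controlled_of_excess_le (H : Admissible n s p L) :
    ∃ C : ℝ, 1 ≤ C ∧ ∀ (v : Rn n → ℝ) (x₀ : Rn n) (r X : ℝ), 0 < r → 0 < X →
      excess n s p v x₀ r ≤ ENNReal.ofReal X →
      Controlled n s p (fun x => v (x₀ + r • x)) (ballAvg n v x₀ r) (C * X) := by
  have hp1 := H.p_sub_pos
  have hq := qStar_pos p
  have := H.nontrivial
  have hb : volume (ball (0 : Rn n) 1) ≠ 0 := (measure_ball_pos _ _ one_pos).ne'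
  set ω := (volume (ball (0 : Rn n) 1)).toReal with hω
  have hωv : volume (ball (0 : Rn n) 1) = ENNReal.ofReal ω :=
    (ENNReal.ofReal_toReal measure_ball_lt_top.ne).symm
  have hω0 : 0 ≤ ω := ENNReal.toReal_nonneg
  have hC : ω ≤ (max 1 (ω ^ (qStar p)⁻¹)) ^ qStar p :=
    le_rpow_of_rpow_inv_le hω0 hq (le_max_right _ _)
  refine ⟨max 1 (ω ^ (qStar p)⁻¹), le_max_left _ _, fun v x₀ r X hr hX h => ?_⟩
  have hC1 : 1 ≤ max 1 (ω ^ (qStar p)⁻¹) := le_max_left _ _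
  generalize max 1 (ω ^ (qStar p)⁻¹) = C at hC hC1 ⊢
  have h1 : locExcess n p v x₀ r ≤ ENNReal.ofReal X := le_self_add.trans h
  have h2 : tailFn n s p (fun x => v x - ballAvg n v x₀ r) x₀ r ≤ ENNReal.ofReal X :=
    le_add_self.trans h
  constructor
  · unfold locExcess at h1
    rw [inv_volume_mul_setLIntegral_ball H x₀ hr, one_div, ENNReal.rpow_inv_le_iff hq,
      ENNReal.ofReal_rpow_of_nonneg hX.le hq.le,
      ENNReal.inv_mul_le_iff hb measure_ball_lt_top.ne, hωv, ← ENNReal.ofReal_mul hω0] at h1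
    refine h1.trans (ENNReal.ofReal_le_ofReal ?_)
    rw [Real.mul_rpow (by linarith) hX.le]
    gcongr
  · rw [tailFn_eq _ x₀ hr, one_div, ENNReal.rpow_inv_le_iff hp1,
      ENNReal.ofReal_rpow_of_nonneg hX.le hp1.le] at h2
    exact h2.trans (ENNReal.ofReal_le_ofReal (Real.rpow_le_rpow hX.le
      (le_mul_of_one_le_left hX.le hC1) hp1.le))

lemma Controlled.exists_change_center (H : Admissible n s p L) {A : ℝ} (hA : 0 ≤ A) :
    ∃ C : ℝ, 1 ≤ C ∧ ∀ (w : Rn n → ℝ) (c m X : ℝ), Measurable w → 0 < X → |m - c| ≤ A * X →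
      Controlled n s p w c X → Controlled n s p w m (C * X) := by
  have hp1 := H.p_sub_pos
  have hq := qStar_pos p
  set ω := (volume (ball (0 : Rn n) 1)).toReal with hω
  have hωv : volume (ball (0 : Rn n) 1) = ENNReal.ofReal ω :=
    (ENNReal.ofReal_toReal measure_ball_lt_top.ne).symm
  have hω0 : 0 ≤ ω := ENNReal.toReal_nonneg
  set J := (∫⁻ x in (ball (0 : Rn n) 1)ᶜ, ENNReal.ofReal (fker n s p x)).toReal with hJd
  have hJ : 0 ≤ J := ENNReal.toReal_nonneg
  have hJe : ∫⁻ x in (ball (0 : Rn n) 1)ᶜ, ENNReal.ofReal (fker n s p x) = ENNReal.ofReal J :=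
    (ENNReal.ofReal_toReal (lintegral_fker_far_lt_top H).ne).symm
  obtain ⟨K₁, hK₁⟩ : ∃ K : ℝ, K = 2 ^ qStar p * (1 + A ^ qStar p * ω) := ⟨_, rfl⟩
  obtain ⟨K₂, hK₂⟩ : ∃ K : ℝ, K = 2 ^ (p - 1) * (1 + A ^ (p - 1) * J) := ⟨_, rfl⟩
  have hC₁ : K₁ ≤ (max 1 (max (K₁ ^ (qStar p)⁻¹) (K₂ ^ (p - 1)⁻¹))) ^ qStar p :=
    le_rpow_of_rpow_inv_le (by rw [hK₁]; positivity) hq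
      ((le_max_left _ _).trans (le_max_right _ _))
  have hC₂ : K₂ ≤ (max 1 (max (K₁ ^ (qStar p)⁻¹) (K₂ ^ (p - 1)⁻¹))) ^ (p - 1) :=
    le_rpow_of_rpow_inv_le (by rw [hK₂]; positivity) hp1
      ((le_max_right _ _).trans (le_max_right _ _))
  have hC1 : 1 ≤ max 1 (max (K₁ ^ (qStar p)⁻¹) (K₂ ^ (p - 1)⁻¹)) := le_max_left _ _
  refine ⟨_, hC1, fun w c m X hw hX hmc hc => ?_⟩
  generalize max 1 (max (K₁ ^ (qStar p)⁻¹) (K₂ ^ (p - 1)⁻¹)) = C at hC₁ hC₂ hC1 ⊢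
  have hbd : ∀ q : ℝ, 0 < q → ∀ x, |w x - m| ^ q ≤ 2 ^ q * (|w x - c| ^ q + A ^ q * X ^ q) := by
    intro q hq x
    rw [← Real.mul_rpow hA hX.le, show w x - m = (w x - c) - (m - c) by ring]
    refine (abs_sub_rpow_le _ _ hq.le).trans ?_
    gcongr
  constructor
  · have h1 : ∀ x, ENNReal.ofReal (|w x - m| ^ qStar p) ≤ ENNReal.ofReal (2 ^ qStar p) *
        (ENNReal.ofReal (|w x - c| ^ qStar p) + ENNReal.ofReal (A ^ qStar p * X ^ qStar p)) := by
      intro x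
      rw [← ENNReal.ofReal_add (by positivity) (by positivity),
        ← ENNReal.ofReal_mul (by positivity)]
      exact ENNReal.ofReal_le_ofReal (hbd _ hq x)
    refine (lintegral_mono h1).trans ?_
    rw [lintegral_const_mul' _ _ ENNReal.ofReal_ne_top, lintegral_add_right _ measurable_const,
      setLIntegral_const, hωv]
    calc _ ≤ ENNReal.ofReal (2 ^ qStar p) * (ENNReal.ofReal (X ^ qStar p) +
          ENNReal.ofReal (A ^ qStar p * X ^ qStar p) * ENNReal.ofReal ω) := by
          gcongr; exact hc.inner
      _ = ENNReal.ofReal (K₁ * X ^ qStar p) := by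
          rw [← ENNReal.ofReal_mul (by positivity), ← ENNReal.ofReal_add (by positivity)
            (by positivity), ← ENNReal.ofReal_mul (by positivity), hK₁]
          congr 1; ring
      _ ≤ _ := by
          rw [Real.mul_rpow (by linarith) hX.le]
          refine ENNReal.ofReal_le_ofReal ?_
          gcongr
  · have h1 : ∀ x, ENNReal.ofReal (|w x - m| ^ (p - 1) * fker n s p x) ≤
        ENNReal.ofReal (2 ^ (p - 1)) * (ENNReal.ofReal (|w x - c| ^ (p - 1) * fker n s p x) +
          ENNReal.ofReal (A ^ (p - 1) * X ^ (p - 1)) * ENNReal.ofReal (fker n s p x)) := by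
      intro x
      have hf := fker_nonneg (n := n) (s := s) (p := p) x
      rw [← ENNReal.ofReal_mul (by positivity), ← ENNReal.ofReal_add (by positivity)
        (by positivity), ← ENNReal.ofReal_mul (by positivity), ← add_mul, ← mul_assoc]
      exact ENNReal.ofReal_le_ofReal (mul_le_mul_of_nonneg_right (hbd _ hp1 x) hf)
    refine (lintegral_mono h1).trans ?_
    rw [lintegral_const_mul' _ _ ENNReal.ofReal_ne_top,
      lintegral_add_right _ (measurable_fker.ennreal_ofReal.const_mul _),
      lintegral_const_mul' _ _ ENNReal.ofReal_ne_top, hJe]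
    calc _ ≤ ENNReal.ofReal (2 ^ (p - 1)) * (ENNReal.ofReal (X ^ (p - 1)) +
          ENNReal.ofReal (A ^ (p - 1) * X ^ (p - 1)) * ENNReal.ofReal J) := by
          gcongr; exact hc.outer
      _ = ENNReal.ofReal (K₂ * X ^ (p - 1)) := by
          rw [← ENNReal.ofReal_mul (by positivity), ← ENNReal.ofReal_add (by positivity)
            (by positivity), ← ENNReal.ofReal_mul (by positivity), hK₂]
          congr 1; ring
      _ ≤ _ := by
          rw [Real.mul_rpow (by linarith) hX.le]
          refine ENNReal.ofReal_le_ofReal ?_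
          gcongr

lemma ofReal_abs_ballAvg_sub_le (H : Admissible n s p L) {v : Rn n → ℝ} (hv : Measurable v)
    (x₀ : Rn n) {r : ℝ} (hr : 0 < r) (c : ℝ)
    (hfin : ∫⁻ x in ball x₀ r, ENNReal.ofReal |v x - c| < ⊤) :
    ENNReal.ofReal |ballAvg n v x₀ r - c| ≤
      (volume (ball x₀ r))⁻¹ * ∫⁻ x in ball x₀ r, ENNReal.ofReal |v x - c| := by
  have := H.nontrivial
  have hb : volume (ball x₀ r) ≠ 0 := (measure_ball_pos _ _ hr).ne'
  have hbt : volume (ball x₀ r) ≠ ⊤ := measure_ball_lt_top.ne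
  have hI : IntegrableOn (fun x => v x - c) (ball x₀ r) := by
    refine ⟨(hv.sub_const c).aestronglyMeasurable, ?_⟩
    rw [hasFiniteIntegral_iff_norm]
    simpa [Real.norm_eq_abs] using hfin
  have hIv : IntegrableOn v (ball x₀ r) := by
    have := hI.add (integrableOn_const (C := c) hbt)
    refine this.congr (ae_of_all _ fun x => ?_)
    simp
  have hvr : 0 < volume.real (ball x₀ r) := ENNReal.toReal_pos hb hbt
  have e : ballAvg n v x₀ r - c = (volume.real (ball x₀ r))⁻¹ * ∫ x in ball x₀ r, (v x - c) := by
    unfold ballAvg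
    rw [setAverage_eq, integral_sub hIv (integrableOn_const hbt), setIntegral_const]
    simp only [smul_eq_mul]
    field_simp
  rw [e, abs_mul, abs_of_pos (inv_pos.2 hvr), ENNReal.ofReal_mul (by positivity),
    ENNReal.ofReal_inv_of_pos hvr, Measure.real, ENNReal.ofReal_toReal hbt]
  gcongr
  have := enorm_integral_le_lintegral_enorm (μ := volume.restrict (ball x₀ r))
    (fun x => v x - c)
  simpa only [Real.enorm_eq_ofReal_abs] using this

lemma exists_excess_le_of_controlled (H : Admissible n s p L) :
    ∃ C : ℝ, 1 ≤ C ∧ ∀ (v : Rn n → ℝ) (x₀ : Rn n) (r c X : ℝ), Measurable v → 0 < r → 0 < X →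
      Controlled n s p (fun x => v (x₀ + r • x)) c X →
      excess n s p v x₀ r ≤ ENNReal.ofReal (C * X) := by
  have hp1 := H.p_sub_pos
  have hq := qStar_pos p
  have hq1 := one_le_qStar p
  have := H.nontrivial
  have hb : volume (ball (0 : Rn n) 1) ≠ 0 := (measure_ball_pos _ _ one_pos).ne'
  set ω := (volume (ball (0 : Rn n) 1)).toReal with hω
  have hωv : volume (ball (0 : Rn n) 1) = ENNReal.ofReal ω :=
    (ENNReal.ofReal_toReal measure_ball_lt_top.ne).symm
  have hω0 : 0 < ω := ENNReal.toReal_pos hb measure_ball_lt_top.ne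
  obtain ⟨C, hC, hcc⟩ := Controlled.exists_change_center H (A := ω⁻¹ * (1 + ω)) (by positivity)
  obtain ⟨D, hD⟩ : ∃ D : ℝ, D = (ω⁻¹) ^ (1 / qStar p) := ⟨_, rfl⟩
  have hD0 : 0 ≤ D := by rw [hD]; positivity
  refine ⟨(D + 1) * C, by nlinarith, fun v x₀ r c X hv hr hX hc => ?_⟩
  have hw : Measurable (fun x => v (x₀ + r • x)) := by fun_prop
  have h1 : ∫⁻ x in ball (0 : Rn n) 1, ENNReal.ofReal |v (x₀ + r • x) - c| ≤
      ENNReal.ofReal ((1 + ω) * X) := by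
    have e : ∀ x, ENNReal.ofReal |v (x₀ + r • x) - c| ≤ ENNReal.ofReal X *
        (ENNReal.ofReal ((X ^ qStar p)⁻¹) *
          ENNReal.ofReal (|v (x₀ + r • x) - c| ^ qStar p) + 1) := by
      intro x
      rw [← ENNReal.ofReal_one, ← ENNReal.ofReal_mul (by positivity), ← ENNReal.ofReal_add
        (by positivity) zero_le_one, ← ENNReal.ofReal_mul (by positivity)]
      refine ENNReal.ofReal_le_ofReal ?_
      have ht := abs_nonneg (v (x₀ + r • x) - c)
      generalize |v (x₀ + r • x) - c| = t at ht
      have h0 : 0 ≤ t / X := by positivity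
      have h1 : t / X ≤ (t / X) ^ qStar p + 1 := by
        rcases le_or_gt (t / X) 1 with hx | hx
        · linarith [Real.rpow_nonneg h0 (qStar p)]
        · have := Real.rpow_le_rpow_of_exponent_le hx.le hq1
          rw [Real.rpow_one] at this
          linarith
      rw [Real.div_rpow ht hX.le, div_le_iff₀ hX] at h1
      rw [inv_mul_eq_div, mul_comm]
      exact h1
    refine (lintegral_mono e).trans ?_
    rw [lintegral_const_mul' _ _ ENNReal.ofReal_ne_top, lintegral_add_right _ measurable_const,
      lintegral_const_mul' _ _ ENNReal.ofReal_ne_top, setLIntegral_one, hωv]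
    calc _ ≤ ENNReal.ofReal X * (ENNReal.ofReal ((X ^ qStar p)⁻¹) *
          ENNReal.ofReal (X ^ qStar p) + ENNReal.ofReal ω) := by gcongr; exact hc.inner
      _ = _ := by
        rw [← ENNReal.ofReal_mul (by positivity), inv_mul_cancel₀ (by positivity),
          ← ENNReal.ofReal_add zero_le_one hω0.le, ← ENNReal.ofReal_mul hX.le, mul_comm]
  have h2 : |ballAvg n v x₀ r - c| ≤ ω⁻¹ * (1 + ω) * X := by
    have h3 : ∫⁻ x in ball x₀ r, ENNReal.ofReal |v x - c| < ⊤ := by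
      have := setLIntegral_comp_affine x₀ hr (fun z => ENNReal.ofReal |v z - c|)
        measurableSet_ball measurableSet_ball (affine_mem_ball (t := 1) x₀ hr)
      rw [mul_one] at this
      by_contra! htop
      rw [top_le_iff.1 htop, ENNReal.mul_top (by positivity)] at this
      exact absurd (this ▸ h1) (by simp)
    have h4 := ofReal_abs_ballAvg_sub_le H hv x₀ hr c h3
    rw [inv_volume_mul_setLIntegral_ball H x₀ hr] at h4
    have h5 := h4.trans (mul_le_mul_right h1 _)
    rw [hωv, ← ENNReal.ofReal_inv_of_pos hω0, ← ENNReal.ofReal_mul (by positivity),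
      ENNReal.ofReal_le_ofReal_iff (by positivity)] at h5
    linarith
  have h3 := hcc _ c _ X hw hX h2 hc
  have hCX : 0 ≤ C * X := by positivity
  unfold excess
  rw [mul_assoc, add_mul, ENNReal.ofReal_add (by positivity) (by positivity), one_mul]
  refine add_le_add ?_ ?_
  · unfold locExcess
    rw [inv_volume_mul_setLIntegral_ball H x₀ hr]
    calc _ ≤ (ENNReal.ofReal ω⁻¹ * ENNReal.ofReal ((C * X) ^ qStar p)) ^ (1 / qStar p) := by
          rw [hωv, ← ENNReal.ofReal_inv_of_pos hω0]
          have := h3.inner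
          gcongr
      _ = _ := by
          rw [← ENNReal.ofReal_mul (by positivity),
            ENNReal.ofReal_rpow_of_nonneg (by positivity) (by positivity),
            Real.mul_rpow (by positivity) (by positivity), ← Real.rpow_mul hCX,
            mul_one_div_cancel hq.ne', Real.rpow_one, hD]
  · rw [tailFn_eq _ x₀ hr, one_div, ENNReal.rpow_inv_le_iff hp1,
      ENNReal.ofReal_rpow_of_nonneg hCX hp1.le]
    exact h3.outer

end Excess

section WeakSolutions

variable {n : ℕ} {s p Λ : ℝ}

lemma excess_congr_ae {v w : Rn n → ℝ} (h : v =ᵐ[volume] w) (x₀ : Rn n) (r : ℝ) :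
    excess n s p v x₀ r = excess n s p w x₀ r := by
  have hb : ballAvg n v x₀ r = ballAvg n w x₀ r := by
    unfold ballAvg
    exact average_congr (ae_restrict_of_ae h)
  unfold excess locExcess tailFn
  rw [hb]
  have h1 : ∫⁻ x in ball x₀ r, ENNReal.ofReal (|v x - ballAvg n w x₀ r| ^ qStar p) =
      ∫⁻ x in ball x₀ r, ENNReal.ofReal (|w x - ballAvg n w x₀ r| ^ qStar p) := by
    refine lintegral_congr_ae (ae_restrict_of_ae ?_)
    filter_upwards [h] with x hx
    rw [hx]
  rw [h1]
  congr 3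
  refine lintegral_congr_ae (ae_restrict_of_ae ?_)
  filter_upwards [h] with x hx
  simp only [hx]

lemma PhiBounds.abs_le {Φ : ℝ → ℝ} (hΦ : PhiBounds Λ p Φ) (hΛ : 0 < Λ) (t : ℝ) :
    |Φ t| ≤ Λ * |t| ^ (p - 1) := by
  rcases eq_or_ne t 0 with rfl | ht
  · rw [hΦ.2.1, abs_zero]; positivity
  · have h0 : 0 < |t| := abs_pos.2 ht
    have h1 : 0 ≤ Φ t * t := le_trans (by positivity) (hΦ.2.2 t).1
    have h2 : |Φ t| * |t| ≤ Λ * |t| ^ (p - 1) * |t| := by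
      rw [← abs_mul, abs_of_nonneg h1, mul_assoc, ← Real.rpow_add_one h0.ne', sub_add_cancel]
      exact (hΦ.2.2 t).2
    exact le_of_mul_le_mul_right h2 h0

lemma WeakSol.exists_isSol {Φ : ℝ → ℝ} {K : Rn n → Rn n → ℝ} {Ω : Set (Rn n)} {g v : Rn n → ℝ}
    (H : Admissible n s p (Λ * Λ)) (hΛ : 0 < Λ) (hK : KernelBounds n Λ s p K)
    (hΦ : PhiBounds Λ p Φ) (hv : WeakSol n Φ K s p Ω (fun _ => 0) g v) :
    ∃ w : Rn n → ℝ, v =ᵐ[volume] w ∧ IsSol n s p (Λ * Λ) Ω w := by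
  obtain ⟨⟨hm, hLp, hgag⟩, -, hweak⟩ := hv
  rw [Measure.restrict_univ] at hm hLp
  simp only [gagliardo, Measure.restrict_univ] at hgag
  refine ⟨hm.mk v, hm.ae_eq_mk, ?_⟩
  have hvw := hm.ae_eq_mk
  have hwm := hm.measurable_mk
  generalize hm.mk v = w at hvw hwm
  have hp := H.p_pos
  have hp1 := H.p_sub_pos
  refine ⟨hwm, fun r => ?_, ?_, fun x y => Φ (w x - w y) * K x y, ?_, fun x y => ?_,
    fun x y => ?_, fun φ hφ => ?_⟩
  · refine lt_of_le_of_lt (setLIntegral_le_lintegral _ _) (lt_of_le_of_lt (le_of_eq ?_) hLp)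
    refine lintegral_congr_ae ?_
    filter_upwards [hvw] with x hx
    rw [hx]
  · refine lt_of_le_of_lt (le_of_eq ?_) hgag
    refine lintegral_congr_ae ?_
    filter_upwards [hvw] with x hx
    refine lintegral_congr_ae ?_
    filter_upwards [hvw] with y hy
    rw [hx, hy, fker, div_eq_mul_inv]
  · have h1 : Measurable (fun z : Rn n × Rn n => Φ (w z.1 - w z.2)) :=
      hΦ.1.measurable.comp ((hwm.comp measurable_fst).sub (hwm.comp measurable_snd))
    exact h1.mul hK.1
  · rcases eq_or_ne x y with rfl | hxy
    · simp [Real.zero_rpow hp.ne']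
    · have h1 := (hΦ.2.2 (w x - w y)).1
      have h2 := (hK.2 x y hxy).1
      simp only
      generalize w x - w y = d at h1 ⊢
      have e : 1 / (Λ * ‖x - y‖ ^ ((n : ℝ) + s * p)) = fker n s p (x - y) / Λ := by
        rw [fker]; field_simp
      rw [e, div_le_iff₀ hΛ] at h2
      rw [div_le_iff₀ hΛ] at h1
      have h0 := fker_nonneg (n := n) (s := s) (p := p) (x - y)
      have h3 : 0 ≤ Φ d * d * Λ := le_trans (by positivity) h1
      calc |d| ^ p * fker n s p (x - y) ≤ (Φ d * d * Λ) * (K x y * Λ) := by gcongr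
        _ = _ := by ring
  · rcases eq_or_ne x y with rfl | hxy
    · simp [Real.zero_rpow hp1.ne', hΦ.2.1]
    · have h1 := hΦ.abs_le hΛ (w x - w y)
      have h2 := (hK.2 x y hxy).2
      have h3 : 0 ≤ K x y := le_trans (by positivity) (hK.2 x y hxy).1
      rw [abs_mul, abs_of_nonneg h3]
      calc |Φ (w x - w y)| * K x y ≤ (Λ * |w x - w y| ^ (p - 1)) *
            (Λ / ‖x - y‖ ^ ((n : ℝ) + s * p)) := by gcongr
        _ = _ := by rw [fker, div_eq_mul_inv]; ring
  · have h1 := hweak φ hφ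
    simp only [mul_zero, integral_zero, nonlocalForm] at h1
    rw [← h1]
    refine integral_congr_ae ?_
    filter_upwards [hvw] with x hx
    refine integral_congr_ae ?_
    filter_upwards [hvw] with y hy
    rw [hx, hy]; ring

lemma IsSol.excess_decay {L : ℝ} (H : Admissible n s p L) :
    ∃ α C : ℝ, 0 < α ∧ 1 ≤ C ∧ ∀ (w : Rn n → ℝ) (O : Set (Rn n)) (x₀ : Rn n) (ρ r : ℝ),
      IsSol n s p L O w → ball x₀ r ⊆ O → 0 < ρ → ρ ≤ r →
      excess n s p w x₀ ρ ≤ ENNReal.ofReal (C * (ρ / r) ^ α) * excess n s p w x₀ r := by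
  obtain ⟨α, C, hα, hC, hdecay⟩ := exists_controlled_decay H
  obtain ⟨C₁, hC₁, h₁⟩ := exists_controlled_of_excess_le H
  obtain ⟨C₂, hC₂, h₂⟩ := exists_excess_le_of_controlled H
  have hCC : 1 ≤ C₂ * (C * C₁) := one_le_mul_of_one_le_of_one_le hC₂
    (one_le_mul_of_one_le_of_one_le hC hC₁)
  refine ⟨α, C₂ * (C * C₁), hα, hCC, fun w O x₀ ρ r hw hO hρ hρr => ?_⟩
  have hr : 0 < r := hρ.trans_le hρr
  have hk : 0 < C₂ * (C * C₁) * (ρ / r) ^ α := by positivity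
  rw [← ENNReal.div_le_iff' (by simpa using hk) ENNReal.ofReal_ne_top]
  refine le_of_forall_gt_imp_ge_of_dense fun a ha => ?_
  rcases eq_or_ne a ⊤ with rfl | hat
  · exact le_top
  have hX : 0 < a.toReal := ENNReal.toReal_pos (zero_le.trans_lt ha).ne' hat
  have haX : a = ENNReal.ofReal a.toReal := (ENNReal.ofReal_toReal hat).symm
  generalize a.toReal = X at hX haX
  rw [ENNReal.div_le_iff' (by simpa using hk) ENNReal.ofReal_ne_top]
  subst haX
  have hsol : IsSol n s p L (ball 0 1) (fun x => w (x₀ + r • x)) := by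
    have := hw.affine H x₀ (O' := ball 0 1) 0 hr one_ne_zero (fun x hx => by
      rw [affine_mem_ball x₀ hr, mul_one] at hx
      exact hO hx)
    simpa using this
  obtain ⟨c', hc'⟩ := hdecay _ _ (C₁ * X) (ρ / r) hsol (by positivity)
    (h₁ w x₀ r X hr hX ha.le) (by positivity) ((div_le_one₀ hr).2 hρr)
  have e : ∀ x : Rn n, r • (ρ / r) • x = ρ • x := fun x => by
    rw [smul_smul]; congr 1; field_simp
  simp only [e] at hc'
  refine (h₂ w x₀ ρ c' _ hw.meas hρ (by positivity) hc').trans (le_of_eq ?_)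
  rw [← ENNReal.ofReal_mul hk.le]
  congr 1; ring

/-- A power-type decay of a function of the radius implies the Campanato-type estimate with an
averaged right-hand side. -/
lemma decay_le_campanato {E : ℝ → ℝ≥0∞} {C α β ρ r R : ℝ} (hC : 0 < C) (hα : 0 ≤ α) (hβ : 0 ≤ β)
    (hρ : 0 < ρ) (hρr : ρ ≤ r) (hrR : r ≤ R)
    (hE : ∀ t, r ≤ t → t ≤ R → E ρ ≤ ENNReal.ofReal (C * (ρ / t) ^ α) * E t) :
    E ρ ≤ ENNReal.ofReal (C * 2 ^ (β + 1) * (ρ / r) ^ α * (r / R) ^ β) * E R +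
      ENNReal.ofReal (C * 2 ^ (β + 1) * (ρ / r) ^ α) *
        ∫⁻ t in Ioc r R, ENNReal.ofReal ((r / t) ^ β / t) * E t := by
  have hr : 0 < r := hρ.trans_le hρr
  have hE' : ∀ t, r ≤ t → t ≤ R → E ρ ≤ ENNReal.ofReal (C * (ρ / r) ^ α) * E t := by
    intro t h1 h2
    have ht : 0 < t := hr.trans_le h1
    refine (hE t h1 h2).trans ?_
    gcongr
  have hhalf : ∀ t, r ≤ t → t ≤ 2 * r → 1 ≤ 2 ^ β * (r / t) ^ β := by
    intro t h1 h2
    have ht : 0 < t := hr.trans_le h1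
    rw [← Real.mul_rpow zero_le_two (by positivity)]
    refine Real.one_le_rpow ?_ hβ
    rw [← mul_div_assoc, one_le_div₀ ht]
    exact h2
  have h2β : (2 : ℝ) ^ (β + 1) = 2 ^ β * 2 := Real.rpow_add_one two_ne_zero β
  rcases lt_or_ge R (2 * r) with hR | hR
  · refine (hE' R hrR le_rfl).trans (le_trans ?_ le_self_add)
    refine mul_le_mul' (ENNReal.ofReal_le_ofReal ?_) le_rfl
    have h1 := hhalf R hrR hR.le
    have h0 : 0 ≤ C * (ρ / r) ^ α := by positivity
    calc C * (ρ / r) ^ α ≤ C * (ρ / r) ^ α * (2 ^ β * (r / R) ^ β * 2) :=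
          le_mul_of_one_le_right h0 (by linarith)
      _ = _ := by rw [h2β]; ring
  · refine le_trans ?_ le_add_self
    have hk : 0 < C * (ρ / r) ^ α := by positivity
    obtain ⟨m, hm⟩ : ∃ m, m = E ρ / ENNReal.ofReal (C * (ρ / r) ^ α) := ⟨_, rfl⟩
    have hmE : E ρ = ENNReal.ofReal (C * (ρ / r) ^ α) * m := by
      rw [hm, ENNReal.mul_div_cancel (by simpa using hk) ENNReal.ofReal_ne_top]
    have hint : ENNReal.ofReal ((2 ^ (β + 1))⁻¹) * m ≤
        ∫⁻ t in Ioc r R, ENNReal.ofReal ((r / t) ^ β / t) * E t := by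
      calc _ = ∫⁻ t in Ioc r (2 * r), ENNReal.ofReal ((2 ^ (β + 1) * r)⁻¹) * m := by
            rw [setLIntegral_const, Real.volume_Ioc, mul_right_comm,
              ← ENNReal.ofReal_mul (by positivity)]
            congr 2
            field_simp
            ring
        _ ≤ ∫⁻ t in Ioc r (2 * r), ENNReal.ofReal ((r / t) ^ β / t) * E t := by
            refine setLIntegral_mono' measurableSet_Ioc fun t ht => ?_
            have ht0 : 0 < t := hr.trans ht.1
            refine mul_le_mul' (ENNReal.ofReal_le_ofReal ?_) ?_
            · rw [inv_le_iff_one_le_mul₀ (by positivity), h2β, div_mul_eq_mul_div,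
                one_le_div₀ ht0]
              have h1 := hhalf t ht.1.le ht.2
              calc t ≤ 1 * (2 * r) := by linarith [ht.2]
                _ ≤ (2 ^ β * (r / t) ^ β) * (2 * r) := by gcongr
                _ = _ := by ring
            · rw [hm]
              exact ENNReal.div_le_of_le_mul' (hE' t ht.1.le (ht.2.trans hR))
        _ ≤ _ := lintegral_mono_set (Ioc_subset_Ioc_right hR)
    calc E ρ = ENNReal.ofReal (C * 2 ^ (β + 1) * (ρ / r) ^ α) *
          (ENNReal.ofReal ((2 ^ (β + 1))⁻¹) * m) := by
          rw [hmE, ← mul_assoc, ← ENNReal.ofReal_mul (by positivity)]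
          congr 2
          field_simp
      _ ≤ _ := by gcongr

end WeakSolutions

/-- Theorem 1.6, Global excess decay, nonlocal Campanato theory. -/
theorem global_excess_decay_homogeneous
    (n : ℕ) (s p Λ : ℝ)
    (hn : 2 ≤ n) (hs : 0 < s) (hs1 : s < 1) (hp1 : 1 < p) (hΛ : 1 ≤ Λ) :
    ∃ α c : ℝ, 0 < α ∧ α < s * p / qStar p ∧ 1 ≤ c ∧
      ∀ (Φ : ℝ → ℝ) (K : Rn n → Rn n → ℝ) (Ω : Set (Rn n)) (g v : Rn n → ℝ)
        (x₀ : Rn n) (R : ℝ),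
        KernelBounds n Λ s p K → PhiBounds Λ p Φ → IsOpen Ω →
        memWsp n s p univ g →
        WeakSol n Φ K s p Ω (fun _ => 0) g v →
        ball x₀ R ⊆ Ω →
        ∀ ρ r : ℝ, 0 < ρ → ρ ≤ r → r ≤ R →
          excess n s p v x₀ ρ ≤
            ENNReal.ofReal (c * (ρ / r) ^ α * (r / R) ^ (s * p / qStar p)) *
                excess n s p v x₀ R +
              ENNReal.ofReal (c * (ρ / r) ^ α) *
                ∫⁻ t in Ioc r R,
                  ENNReal.ofReal ((r / t) ^ (s * p / qStar p) / t) *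
                    excess n s p v x₀ t := by
  have H : Admissible n s p (Λ * Λ) :=
    ⟨by omega, hs, hs1, hp1, one_le_mul_of_one_le_of_one_le hΛ hΛ⟩
  have hq := qStar_pos p
  have hβ : 0 < s * p / qStar p := div_pos H.sp_pos hq
  obtain ⟨α, C, hα, hC, hdecay⟩ := IsSol.excess_decay H
  refine ⟨min α (s * p / qStar p / 2), C * 2 ^ (s * p / qStar p + 1),
    lt_min hα (half_pos hβ), (min_le_right _ _).trans_lt (half_lt_self hβ),
    one_le_mul_of_one_le_of_one_le hC (Real.one_le_rpow one_le_two (by positivity)), ?_⟩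
  intro Φ K Ω g v x₀ R hK hΦ _ _ hv hball ρ r hρ hρr hrR
  obtain ⟨w, hvw, hw⟩ := hv.exists_isSol H (by linarith) hK hΦ
  simp only [excess_congr_ae hvw]
  refine decay_le_campanato (E := fun t => excess n s p w x₀ t) (by linarith)
    (lt_min hα (half_pos hβ)).le hβ.le hρ hρr hrR fun t hrt htR => ?_
  have ht : 0 < t := (hρ.trans_le hρr).trans_le hrt
  refine (hdecay w Ω x₀ ρ t hw ((ball_subset_ball htR).trans hball) hρ (hρr.trans hrt)).trans ?_
  refine mul_le_mul' (ENNReal.ofReal_le_ofReal (mul_le_mul_of_nonneg_left ?_ (by linarith))) le_rfl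
  exact Real.rpow_le_rpow_of_exponent_ge (by positivity)
    ((div_le_one₀ ht).2 (hρr.trans hrt)) (min_le_left _ _)
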